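/- Let K be a number field and let φ : ℝ → ℂ be a smooth compactly supported function whose support does not contain 0. Then the following 'explicit formula' holds: Φ(0) − Σ_ρ m(ρ)·Φ(ρ) + Φ(1) = Σ_{𝔭 finite} (log N𝔭)·( Σ_{k≥1} φ(k·log N𝔭) + Σ_{k≥1} N𝔭^{−k}·φ(−k·log N𝔭) ) + Σ_{𝔭 infinite} W_𝔭(φ), where ρ runs over the nontrivial zeros of the Dedekind zeta function ζ_K counted with multiplicity m(ρ), 𝔭 in the first sum runs over the nonzero prime ideals of the ring of integers of K, and for each infinite place 𝔭 one sets W_𝔭(φ) = ∫_0^∞ φ(t)·(1 − e^{κ_𝔭 t})^{−1} dt + ∫_{−∞}^0 φ(t)·e^t·(1 − e^{−κ_𝔭 t})^{−1} dt with κ_𝔭 = −2 if 𝔭 is real and κ_𝔭 = −1 if 𝔭 is complex. All the series and integrals occurring converge absolutely. -/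

import Mathlib

namespace ExplicitFormula

open MeasureTheory Filter Topology

section Poisson

variable {ι : Type*} [Fintype ι]

/-- The vector with integer coordinates `m`, seen as a real vector. -/
def intVec (m : ι → ℤ) : ι → ℝ := fun i => (m i : ℝ)

theorem measurableSet_unitBox :
    MeasurableSet {x : ι → ℝ | ∀ i, x i ∈ Set.Ioc (0 : ℝ) (0 + 1)} :=
  MeasurableSet.univ_pi' fun _ => measurableSet_Ioc

theorem hasSum_integral_unitBox {f : (ι → ℝ) → ℂ} (hf : Integrable f) :
    HasSum (fun m : ι → ℤ => ∫ x in {x : ι → ℝ | ∀ i, x i ∈ Set.Ioc (0 : ℝ) (0 + 1)},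
      f (x + intVec m)) (∫ x, f x) := by
  set B : Set (ι → ℝ) := {x : ι → ℝ | ∀ i, x i ∈ Set.Ioc (0 : ℝ) (0 + 1)} with hB
  have hBm : MeasurableSet B := measurableSet_unitBox
  let S : (ι → ℤ) → Set (ι → ℝ) := fun m => (fun x => x - intVec m) ⁻¹' B
  have hS : ∀ m, MeasurableSet (S m) := fun m => (measurable_sub_const _) hBm
  have hU : (⋃ m, S m) = Set.univ := by
    refine Set.eq_univ_of_forall fun x => Set.mem_iUnion.2 ⟨fun i => ⌈x i⌉ - 1, fun i => ?_⟩
    simp only [intVec, Pi.sub_apply, Set.mem_Ioc]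
    push_cast
    constructor
    · linarith [Int.ceil_lt_add_one (x i)]
    · linarith [Int.le_ceil (x i)]
  have hd : Pairwise (Function.onFun Disjoint S) := by
    intro m n hmn
    refine Set.disjoint_left.2 fun x hx hy => hmn ?_
    funext i
    have h1 := hx i
    have h2 := hy i
    simp only [intVec, Pi.sub_apply, Set.mem_Ioc] at h1 h2
    have h3 : (m i : ℝ) < n i + 1 := by linarith [h1.1, h2.2]
    have h4 : (n i : ℝ) < m i + 1 := by linarith [h2.1, h1.2]
    have h5 : m i < n i + 1 := by exact_mod_cast h3
    have h6 : n i < m i + 1 := by exact_mod_cast h4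
    omega
  have key := hasSum_integral_iUnion (μ := volume) (f := f) hS hd (by rw [hU]; exact hf.integrableOn)
  rw [hU, setIntegral_univ] at key
  have e : ∀ m : ι → ℤ, ∫ x in B, f (x + intVec m) = ∫ x in S m, f x := by
    intro m
    have hmp : MeasurePreserving (fun x : ι → ℝ => x + intVec m) volume volume :=
      measurePreserving_add_right volume (intVec m)
    rw [← hmp.setIntegral_preimage_emb (measurableEmbedding_addRight _) f (S m)]
    congr 2
    ext x
    simp [S]
  simpa only [e] using key

/-- Poisson summation on `ℝ^ι` for the lattice `ℤ^ι`. -/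
theorem tsum_eq_tsum_fourier_pi {F : (ι → ℝ) → ℂ} (hF : Continuous F) (hInt : Integrable F)
    (hbd : ∀ R : ℝ, ∃ u : (ι → ℤ) → ℝ, Summable u ∧ ∀ x : ι → ℝ, ‖x‖ ≤ R → ∀ m,
      ‖F (x + intVec m)‖ ≤ u m)
    (hhat : Summable fun n : ι → ℤ =>
      ∫ x : ι → ℝ, Complex.exp (-(2 * Real.pi * Complex.I * ∑ i, (n i : ℂ) * x i)) * F x) :
    ∑' m : ι → ℤ, F (intVec m) = ∑' n : ι → ℤ,
      ∫ x : ι → ℝ, Complex.exp (-(2 * Real.pi * Complex.I * ∑ i, (n i : ℂ) * x i)) * F x := by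
  set B : Set (ι → ℝ) := {x : ι → ℝ | ∀ i, x i ∈ Set.Ioc (0 : ℝ) (0 + 1)} with hB
  let q : (ι → ℝ) → UnitAddTorus ι := fun x i => (x i : UnitAddCircle)
  have hq : IsOpenQuotientMap q :=
    IsOpenQuotientMap.piMap (f := fun (_ : ι) (x : ℝ) => (x : UnitAddCircle)) fun _ =>
      QuotientAddGroup.isOpenQuotientMap_mk
  let P : (ι → ℝ) → ℂ := fun x => ∑' m : ι → ℤ, F (x + intVec m)
  have hPc : Continuous P := by
    rw [continuous_iff_continuousAt]
    intro x
    obtain ⟨u, hu, hu'⟩ := hbd (‖x‖ + 1)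
    have : ContinuousOn P (Metric.ball x 1) := by
      refine continuousOn_tsum (fun m => (hF.comp (by fun_prop)).continuousOn) hu ?_
      intro m y hy
      refine hu' y ?_ m
      have := norm_sub_norm_le y x
      rw [Metric.mem_ball, dist_eq_norm] at hy
      linarith
    exact this.continuousAt (Metric.ball_mem_nhds x one_pos)
  have hPper : ∀ x y, q x = q y → P x = P y := by
    intro x y hxy
    have : ∀ i, ∃ k : ℤ, x i = y i + k := by
      intro i
      have h := congrFun hxy i
      simp only [q] at h
      rw [eq_comm, QuotientAddGroup.eq, AddSubgroup.mem_zmultiples_iff] at h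
      obtain ⟨k, hk⟩ := h
      refine ⟨k, ?_⟩
      simp only [zsmul_eq_mul, mul_one] at hk
      linarith
    choose k hk using this
    simp only [P]
    rw [← (Equiv.addRight k).tsum_eq (fun m => F (y + intVec m))]
    refine tsum_congr fun m => ?_
    congr 1
    funext i
    simp only [intVec, Pi.add_apply, hk, Equiv.coe_addRight]
    push_cast; ring
  let G : UnitAddTorus ι → ℂ := fun t => P (Function.surjInv hq.surjective t)
  have hGq : ∀ x, G (q x) = P x := fun x => hPper _ _ (Function.surjInv_eq hq.surjective _)
  have hGc : Continuous G := by
    rw [hq.isQuotientMap.continuous_iff]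
    exact hPc.congr fun x => (hGq x).symm
  let f : C(UnitAddTorus ι, ℂ) := ⟨G, hGc⟩
  have hcoef : ∀ n : ι → ℤ, UnitAddTorus.mFourierCoeff f n =
      ∫ x : ι → ℝ, Complex.exp (-(2 * Real.pi * Complex.I * ∑ i, (n i : ℂ) * x i)) * F x := by
    intro n
    have hch : ∀ x : ι → ℝ, (UnitAddTorus.mFourier (-n)) (fun i => (x i : UnitAddCircle)) =
        Complex.exp (-(2 * Real.pi * Complex.I * ∑ i, (n i : ℂ) * x i)) := by
      intro x
      simp only [UnitAddTorus.mFourier, ContinuousMap.coe_mk, fourier_coe_apply, ← Complex.exp_sum]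
      congr 1
      rw [Finset.mul_sum, ← Finset.sum_neg_distrib]
      refine Finset.sum_congr rfl fun i _ => ?_
      simp only [Pi.neg_apply]
      push_cast; ring
    have hper : ∀ (x : ι → ℝ) (m : ι → ℤ),
        Complex.exp (-(2 * Real.pi * Complex.I * ∑ i, (n i : ℂ) * (x + intVec m) i)) =
        Complex.exp (-(2 * Real.pi * Complex.I * ∑ i, (n i : ℂ) * x i)) := by
      intro x m
      rw [Complex.exp_eq_exp_iff_exists_int]
      refine ⟨-∑ i, n i * m i, ?_⟩
      simp only [intVec, Pi.add_apply]
      push_cast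
      simp only [mul_add, Finset.sum_add_distrib]
      ring
    have hnorm : ∀ x : ι → ℝ,
        ‖Complex.exp (-(2 * Real.pi * Complex.I * ∑ i, (n i : ℂ) * x i))‖ = 1 := by
      intro x
      rw [show (-(2 * Real.pi * Complex.I * ∑ i, (n i : ℂ) * x i) : ℂ) =
        ((-(2 * Real.pi * ∑ i, (n i : ℝ) * x i) : ℝ) : ℂ) * Complex.I by push_cast; ring]
      exact Complex.norm_exp_ofReal_mul_I _
    have hcont : Continuous fun x : ι → ℝ =>
        Complex.exp (-(2 * Real.pi * Complex.I * ∑ i, (n i : ℂ) * x i)) := by fun_prop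
    have hInt' : Integrable fun x : ι → ℝ =>
        Complex.exp (-(2 * Real.pi * Complex.I * ∑ i, (n i : ℂ) * x i)) * F x := by
      refine (integrable_norm_iff (hcont.mul hF).aestronglyMeasurable).1 ?_
      simpa only [Pi.mul_apply, norm_mul, hnorm, one_mul] using hInt.norm
    have h1 := hasSum_integral_unitBox hInt'
    simp only [hper] at h1
    obtain ⟨u, hu, hu'⟩ := hbd 1
    have hBn : ∀ x ∈ B, ‖x‖ ≤ 1 := by
      intro x hx
      refine (pi_norm_le_iff_of_nonneg zero_le_one).2 fun i => ?_
      have := hx i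
      simp only [Set.mem_Ioc] at this
      rw [Real.norm_eq_abs, abs_le]; constructor <;> linarith
    have hBfin : volume B < ⊤ := by
      refine lt_of_le_of_lt (measure_mono fun x hx => ?_)
        (measure_closedBall_lt_top (x := (0 : ι → ℝ)) (r := 1))
      simpa using hBn x hx
    have : IsFiniteMeasure (volume.restrict B) := ⟨by simpa using hBfin⟩
    rw [UnitAddTorus.mFourierCoeff_eq_integral _ n 0, ← h1.tsum_eq]
    have hB' : {x : ι → ℝ | ∀ i, x i ∈ Set.Ioc ((0 : ι → ℝ) i) ((0 : ι → ℝ) i + 1)} = B := rfl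
    rw [hB']
    have h2 : ∀ m : ι → ℤ, Integrable (fun x => Complex.exp (-(2 * Real.pi * Complex.I *
        ∑ i, (n i : ℂ) * x i)) * F (x + intVec m)) (volume.restrict B) := by
      intro m
      refine Integrable.integrableOn ?_
      simpa only [hper] using hInt'.comp_add_right (intVec m)
    rw [integral_tsum_of_summable_integral_norm h2]
    · refine setIntegral_congr_fun measurableSet_unitBox fun x hx => ?_
      simp only [hch, smul_eq_mul]
      change _ * G (q x) = _
      rw [hGq, tsum_mul_left]
    · refine Summable.of_nonneg_of_le (fun m => integral_nonneg fun x => norm_nonneg _) (fun m => ?_)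
        (hu.mul_right (volume.real B))
      have := norm_setIntegral_le_of_norm_le_const (f := fun x => ‖Complex.exp (-(2 * Real.pi *
        Complex.I * ∑ i, (n i : ℂ) * x i)) * F (x + intVec m)‖) (C := u m) hBfin
        (fun x hx => by
          rw [norm_norm, norm_mul, hnorm, one_mul]
          exact hu' x (hBn x hx) m)
      exact (le_abs_self _).trans this
  have hsum : Summable (UnitAddTorus.mFourierCoeff f) := by
    refine hhat.congr fun n => (hcoef n).symm
  have := UnitAddTorus.hasSum_mFourier_series_apply_of_summable hsum (q 0)
  have h0 : f (q 0) = ∑' m : ι → ℤ, F (intVec m) := by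
    change G (q 0) = _
    rw [hGq]
    simp [P]
  rw [← h0, ← this.tsum_eq]
  refine tsum_congr fun n => ?_
  rw [hcoef]
  have : (UnitAddTorus.mFourier n) (q 0) = 1 := by
    simp [UnitAddTorus.mFourier, q]
  rw [this, smul_eq_mul, mul_one]

end Poisson

end ExplicitFormula

namespace ExplicitFormula

open MeasureTheory Filter Topology

section Theta

open Matrix

variable {ι : Type*} [Fintype ι]

theorem intVec_zero {ι : Type*} : intVec (0 : ι → ℤ) = 0 := by
  funext i; simp [intVec]

theorem one_le_norm_intVec {m : ι → ℤ} (hm : m ≠ 0) : 1 ≤ ‖intVec m‖ := by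
  obtain ⟨i, hi⟩ := Function.ne_iff.1 hm
  refine le_trans ?_ (norm_le_pi_norm (intVec m) i)
  simp only [intVec, Real.norm_eq_abs]
  exact_mod_cast Int.one_le_abs hi

theorem summable_norm_intVec_rpow {r : ℝ} (hr : r < -Fintype.card ι) :
    Summable fun m : ι → ℤ => ‖intVec m‖ ^ r := by
  classical
  let b := Pi.basisFun ℝ ι
  let L := Submodule.span ℤ (Set.range b)
  have hfin : Module.finrank ℤ L = Fintype.card ι :=
    Module.finrank_eq_card_basis (b.restrictScalars ℤ)
  have h := ZLattice.summable_norm_rpow L r (by rw [hfin]; exact hr)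
  let e := (b.restrictScalars ℤ).equivFun.symm.toEquiv
  refine (e.summable_iff.2 h).congr fun m => ?_
  have : ((e m : L) : ι → ℝ) = intVec m := by
    have h1 : e m = ∑ i, m i • b.restrictScalars ℤ i :=
      (b.restrictScalars ℤ).equivFun_symm_apply m
    rw [h1]
    funext j
    simp [intVec, b, Finset.sum_apply, Pi.single_apply]
  simp only [Function.comp_apply]
  rw [← this]; rfl

/-- `exp (-c x ^ 2)` is dominated by any negative power of `x`. -/
theorem exists_exp_neg_le_rpow {c : ℝ} (hc : 0 < c) (r : ℝ) :
    ∃ C : ℝ, 0 < C ∧ ∀ x : ℝ, 1 ≤ x → Real.exp (-c * x) ≤ C * x ^ r := by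
  have h := isLittleO_exp_neg_mul_rpow_atTop hc r
  have h2 := (h.bound zero_lt_one)
  obtain ⟨A, hA⟩ := eventually_atTop.1 h2
  set B := max A 1
  have hpos : 0 < min 1 (B ^ r) := lt_min one_pos (Real.rpow_pos_of_pos (by positivity) _)
  refine ⟨1 + (min 1 (B ^ r))⁻¹, by positivity, fun x hx => ?_⟩
  have hxr : 0 < x ^ r := Real.rpow_pos_of_pos (by linarith) _
  rcases le_or_gt A x with h | h
  · have := hA x h
    rw [Real.norm_eq_abs, Real.norm_eq_abs, abs_of_pos (Real.exp_pos _), abs_of_pos hxr] at this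
    nlinarith [inv_pos.2 hpos, mul_pos (inv_pos.2 hpos) hxr]
  · have h1 : Real.exp (-c * x) ≤ 1 := Real.exp_le_one_iff.2 (by nlinarith)
    have h3 : min 1 (B ^ r) ≤ x ^ r := by
      rcases le_or_gt 0 r with h0 | h0
      · exact (min_le_left _ _).trans (Real.one_le_rpow hx h0)
      · refine (min_le_right _ _).trans ?_
        exact Real.rpow_le_rpow_of_nonpos (by linarith) (h.le.trans (le_max_left _ _)) h0.le
    have h4 : 1 ≤ (min 1 (B ^ r))⁻¹ * x ^ r := by
      rw [inv_mul_eq_div, one_le_div hpos]; exact h3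
    nlinarith

theorem summable_exp_neg_norm_intVec_sq {c : ℝ} (hc : 0 < c) :
    Summable fun m : ι → ℤ => Real.exp (-c * ‖intVec m‖ ^ 2) := by
  obtain ⟨C, hC, h⟩ := exists_exp_neg_le_rpow hc (-(Fintype.card ι + 1 : ℝ))
  have hs := (summable_norm_intVec_rpow (ι := ι) (r := -(Fintype.card ι + 1 : ℝ)) (by linarith)).mul_left C
  refine (hs.add (summable_of_hasFiniteSupport (f := fun m : ι → ℤ => if m = 0 then (1:ℝ) else 0)
    ((Set.finite_singleton 0).subset fun m hm => by by_contra h0; simp_all))).of_nonneg_of_le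
    (fun m => (Real.exp_pos _).le) fun m => ?_
  by_cases hm : m = 0
  · subst hm
    have : 0 ≤ C * ‖intVec (0 : ι → ℤ)‖ ^ (-(Fintype.card ι + 1 : ℝ)) := by positivity
    simp [intVec_zero] at this ⊢
    linarith
  · simp only [hm, if_false, add_zero]
    refine le_trans ?_ (h _ (one_le_norm_intVec hm))
    refine Real.exp_le_exp.2 ?_
    have := one_le_norm_intVec hm
    nlinarith [mul_le_mul_of_nonneg_left (show ‖intVec m‖ ≤ ‖intVec m‖ ^ 2 by nlinarith) hc.le]

theorem exists_posDef_lower_bound {P : Matrix ι ι ℝ} (hP : P.PosDef) :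
    ∃ c : ℝ, 0 < c ∧ ∀ v : ι → ℝ, c * ‖v‖ ^ 2 ≤ v ⬝ᵥ P *ᵥ v := by
  have hcont : Continuous fun v : ι → ℝ => v ⬝ᵥ P *ᵥ v := by
    unfold dotProduct mulVec dotProduct; fun_prop
  have hpos : ∀ v : ι → ℝ, v ≠ 0 → 0 < v ⬝ᵥ P *ᵥ v := fun v hv => by
    simpa using hP.dotProduct_mulVec_pos hv
  rcases isEmpty_or_nonempty ι with h | h
  · exact ⟨1, one_pos, fun v => by simp [Subsingleton.elim v 0]⟩
  have hne : (Metric.sphere (0 : ι → ℝ) 1).Nonempty := ⟨fun _ => 1, by simp⟩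
  obtain ⟨v₀, hv₀, hmin⟩ := (isCompact_sphere (0 : ι → ℝ) 1).exists_isMinOn hne hcont.continuousOn
  refine ⟨v₀ ⬝ᵥ P *ᵥ v₀, hpos _ (by rintro rfl; simp at hv₀), fun v => ?_⟩
  by_cases hv : v = 0
  · simp [hv]
  have hn : 0 < ‖v‖ := norm_pos_iff.2 hv
  have h1 := hmin (show ‖v‖⁻¹ • v ∈ Metric.sphere (0 : ι → ℝ) 1 by
    simp [norm_smul, hn.ne'])
  simp only [Set.mem_ofPred_eq, mulVec_smul, dotProduct_smul, smul_dotProduct, smul_eq_mul] at h1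
  have h2 : v ⬝ᵥ P *ᵥ v = ‖v‖ ^ 2 * (‖v‖⁻¹ * (‖v‖⁻¹ * v ⬝ᵥ P *ᵥ v)) := by
    field_simp
  rw [h2]
  nlinarith [sq_nonneg ‖v‖]

/-- The theta constant of a real quadratic form. -/
noncomputable def theta (P : Matrix ι ι ℝ) : ℝ :=
  ∑' m : ι → ℤ, Real.exp (-Real.pi * (intVec m ⬝ᵥ P *ᵥ intVec m))

theorem summable_theta {P : Matrix ι ι ℝ} (hP : P.PosDef) :
    Summable fun m : ι → ℤ => Real.exp (-Real.pi * (intVec m ⬝ᵥ P *ᵥ intVec m)) := by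
  obtain ⟨c, hc, h⟩ := exists_posDef_lower_bound hP
  refine (summable_exp_neg_norm_intVec_sq (mul_pos Real.pi_pos hc)).of_nonneg_of_le
    (fun m => (Real.exp_pos _).le) fun m => Real.exp_le_exp.2 ?_
  nlinarith [h (intVec m), Real.pi_pos]

theorem integral_fourier_gaussian_matrix [DecidableEq ι] {A : Matrix ι ι ℝ} (hA : A.det ≠ 0)
    (n : ι → ℤ) :
    ∫ x : ι → ℝ, Complex.exp (-(2 * Real.pi * Complex.I * ∑ i, (n i : ℂ) * x i)) *
      (Real.exp (-Real.pi * ((A *ᵥ x) ⬝ᵥ (A *ᵥ x))) : ℝ) =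
    ((|A.det|⁻¹ * Real.exp (-Real.pi * (intVec n ⬝ᵥ (Aᵀ * A)⁻¹ *ᵥ intVec n)) : ℝ) : ℂ) := by
  have hAu : IsUnit A.det := isUnit_iff_ne_zero.2 hA
  set w : ι → ℝ := A⁻¹ᵀ *ᵥ intVec n with hw
  let g : (ι → ℝ) → ℂ := fun v => Complex.exp (-(Real.pi : ℂ) * ∑ i, (v i : ℂ) ^ 2 +
    ∑ i, (-(2 * Real.pi * Complex.I * w i)) * v i)
  have hg : ∀ x : ι → ℝ, Complex.exp (-(2 * Real.pi * Complex.I * ∑ i, (n i : ℂ) * x i)) *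
      (Real.exp (-Real.pi * ((A *ᵥ x) ⬝ᵥ (A *ᵥ x))) : ℝ) = g (toLin' A x) := by
    intro x
    simp only [g, toLin'_apply]
    have h1 : ∑ i, (n i : ℝ) * x i = ∑ i, w i * (A *ᵥ x) i := by
      change intVec n ⬝ᵥ x = w ⬝ᵥ (A *ᵥ x)
      rw [hw, mulVec_transpose, ← dotProduct_mulVec, mulVec_mulVec, nonsing_inv_mul _ hAu, one_mulVec]
    have h1' : ∑ i, (n i : ℂ) * x i = ∑ i, (w i : ℂ) * (A *ᵥ x) i := by exact_mod_cast h1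
    rw [h1', Complex.ofReal_exp, ← Complex.exp_add]
    congr 1
    push_cast [dotProduct]
    rw [add_comm]
    congr 1
    · simp only [sq]
    · rw [Finset.mul_sum, ← Finset.sum_neg_distrib]
      refine Finset.sum_congr rfl fun i _ => ?_
      ring
  simp_rw [hg]
  have hmap := Real.map_matrix_volume_pi_eq_smul_volume_pi hA
  have hemb : MeasurableEmbedding (toLin' A) := by
    have : Function.Injective (toLin' A) := by
      rw [← LinearMap.ker_eq_bot]
      exact LinearMap.ker_eq_bot.2 (mulVec_injective_iff_isUnit.2 ((isUnit_iff_isUnit_det A).2 hAu))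
    exact ((LinearMap.continuous_of_finiteDimensional _).measurableEmbedding this)
  rw [← hemb.integral_map, hmap, integral_smul_measure,
    GaussianFourier.integral_cexp_neg_mul_sum_add (by simpa using Real.pi_pos)]
  rw [ENNReal.toReal_ofReal (abs_nonneg _), abs_inv]
  have hpi : (Real.pi : ℂ) ≠ 0 := by exact_mod_cast Real.pi_ne_zero
  rw [div_self hpi, Complex.one_cpow, one_mul]
  have h2 : intVec n ⬝ᵥ (Aᵀ * A)⁻¹ *ᵥ intVec n = w ⬝ᵥ w := by
    rw [Matrix.mul_inv_rev, hw, ← transpose_nonsing_inv, ← mulVec_mulVec]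
    rw [mulVec_transpose, ← dotProduct_mulVec]
  rw [h2, Complex.real_smul]
  push_cast
  congr 2
  rw [div_eq_iff (by simp)]
  push_cast [dotProduct]
  simp only [Finset.mul_sum, Finset.sum_mul]
  refine Finset.sum_congr rfl fun i _ => ?_
  have : Complex.I ^ 2 = -1 := Complex.I_sq
  linear_combination (4 * (Real.pi : ℂ) ^ 2 * (w i : ℂ) ^ 2) * this

open scoped MatrixOrder Matrix.Norms.L2Operator in
theorem theta_inv [DecidableEq ι] {P : Matrix ι ι ℝ} (hP : P.PosDef) :
    theta P = (Real.sqrt P.det)⁻¹ * theta P⁻¹ := by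
  obtain ⟨A, hA⟩ : ∃ A : Matrix ι ι ℝ, P = Aᵀ * A := by
    obtain ⟨A, hA⟩ := CStarAlgebra.nonneg_iff_eq_star_mul_self.1 hP.posSemidef.nonneg
    exact ⟨A, by rw [hA, star_eq_conjTranspose, conjTranspose_eq_transpose_of_trivial]⟩
  have hdet : P.det = A.det ^ 2 := by rw [hA, det_mul, det_transpose, sq]
  have hA0 : A.det ≠ 0 := fun h => by
    have := hP.det_pos; rw [hdet, h] at this; simp at this
  have hq : ∀ x : ι → ℝ, (A *ᵥ x) ⬝ᵥ (A *ᵥ x) = x ⬝ᵥ P *ᵥ x := by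
    intro x
    rw [hA, ← mulVec_mulVec, dotProduct_mulVec x, vecMul_transpose]
  obtain ⟨c, hc, hlow⟩ := exists_posDef_lower_bound hP
  let F : (ι → ℝ) → ℂ := fun x => (Real.exp (-Real.pi * ((A *ᵥ x) ⬝ᵥ (A *ᵥ x))) : ℝ)
  have hFn : ∀ x, ‖F x‖ = Real.exp (-Real.pi * (x ⬝ᵥ P *ᵥ x)) := fun x => by
    simp only [F, hq, Complex.norm_real, Real.norm_eq_abs, abs_of_pos (Real.exp_pos _)]
  have hFc : Continuous F := by
    simp only [F]; unfold dotProduct mulVec dotProduct; fun_prop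
  have hsumm : ∀ n : ι → ℤ, _ := integral_fourier_gaussian_matrix hA0
  have hInt : Integrable F := by
    by_contra h
    have h0 := hsumm 0
    have : ∫ x : ι → ℝ, Complex.exp (-(2 * Real.pi * Complex.I * ∑ i, ((0 : ι → ℤ) i : ℂ) * x i)) *
      F x = 0 := by
      simp only [Pi.zero_apply, Int.cast_zero, zero_mul, Finset.sum_const_zero, mul_zero, neg_zero,
        Complex.exp_zero, one_mul]
      exact integral_undef h
    rw [this] at h0
    have h1 : |A.det|⁻¹ * Real.exp (-Real.pi * (intVec (0 : ι → ℤ) ⬝ᵥ (Aᵀ * A)⁻¹ *ᵥ intVec 0)) = 0 := by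
      exact_mod_cast h0.symm
    have : 0 < |A.det|⁻¹ * Real.exp (-Real.pi * (intVec (0 : ι → ℤ) ⬝ᵥ (Aᵀ * A)⁻¹ *ᵥ intVec 0)) := by
      positivity
    linarith
  have h := tsum_eq_tsum_fourier_pi hFc hInt (fun R => ?_) ?_
  · have h1 : ∑' m : ι → ℤ, F (intVec m) = (theta P : ℝ) := by
      rw [theta, Complex.ofReal_tsum]
      simp only [F, hq]
    rw [h1] at h
    simp only [F, hsumm] at h
    rw [← Complex.ofReal_tsum, Complex.ofReal_inj] at h
    rw [h, hdet, Real.sqrt_sq_eq_abs, tsum_mul_left, ← hA, theta]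
  · refine ⟨fun m => Real.exp (Real.pi * c * R ^ 2) * Real.exp (-(Real.pi * c / 2) * ‖intVec m‖ ^ 2),
      (summable_exp_neg_norm_intVec_sq (by positivity)).mul_left _, fun x hx m => ?_⟩
    simp only [hFn, ← Real.exp_add]
    refine Real.exp_le_exp.2 ?_
    have h1 := hlow (x + intVec m)
    have h2 : ‖intVec m‖ ≤ ‖x + intVec m‖ + ‖x‖ := by
      have := norm_sub_le (x + intVec m) x
      rwa [add_sub_cancel_left] at this
    have h3 : ‖intVec m‖ ^ 2 ≤ 2 * ‖x + intVec m‖ ^ 2 + 2 * R ^ 2 := by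
      have := norm_nonneg (intVec m)
      have := norm_nonneg x
      nlinarith [sq_nonneg (‖x + intVec m‖ - ‖x‖)]
    have h4 : c * ‖intVec m‖ ^ 2 ≤ c * (2 * ‖x + intVec m‖ ^ 2 + 2 * R ^ 2) :=
      mul_le_mul_of_nonneg_left h3 hc.le
    nlinarith [Real.pi_pos]
  · simp only [F, hsumm]
    rw [← hA]
    have := (summable_theta hP.inv).mul_left |A.det|⁻¹
    exact Complex.ofRealCLM.summable this

end Theta

end ExplicitFormula

namespace ExplicitFormula

open MeasureTheory Filter Topology
open NumberField nonZeroDivisors Matrix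

variable {K : Type*} [Field K] [NumberField K]

theorem sum_embeddings_eq_sum_places {R : Type*} [Semiring R] (g : InfinitePlace K → R) :
    ∑ σ : K →+* ℂ, g (InfinitePlace.mk σ) = ∑ w : InfinitePlace K, (w.mult : R) * g w := by
  classical
  rw [← Finset.sum_fiberwise Finset.univ (fun σ : K →+* ℂ => InfinitePlace.mk σ)]
  refine Finset.sum_congr rfl fun w _ => ?_
  rw [Finset.sum_congr rfl (g := fun _ => g w) (by simp +contextual), Finset.sum_const,
    InfinitePlace.card_filter_mk_eq, nsmul_eq_mul]

theorem prod_embeddings_eq_prod_places {R : Type*} [CommMonoid R] (g : InfinitePlace K → R) :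
    ∏ σ : K →+* ℂ, g (InfinitePlace.mk σ) = ∏ w : InfinitePlace K, g w ^ w.mult := by
  classical
  rw [← Finset.prod_fiberwise Finset.univ (fun σ : K →+* ℂ => InfinitePlace.mk σ)]
  refine Finset.prod_congr rfl fun w _ => ?_
  rw [Finset.prod_congr rfl (g := fun _ => g w) (by simp +contextual), Finset.prod_const,
    InfinitePlace.card_filter_mk_eq]

theorem sum_conjugate {R : Type*} [AddCommMonoid R] (g : (K →+* ℂ) → R) :
    ∑ σ : K →+* ℂ, g (ComplexEmbedding.conjugate σ) = ∑ σ, g σ :=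
  Equiv.sum_comp (Function.Involutive.toPerm _ (ComplexEmbedding.involutive_conjugate K)) g

theorem trace_eq_sum_ringHom (x : K) :
    ((Algebra.trace ℚ K x : ℚ) : ℂ) = ∑ σ : K →+* ℂ, σ x := by
  have := trace_eq_sum_embeddings (K := ℚ) (L := K) ℂ (x := x)
  rw [eq_ratCast] at this
  rw [this]
  exact (Fintype.sum_equiv (RingHom.equivRatAlgHom K ℂ) _ _ fun σ => rfl).symm

/-- The quadratic form `∑ σ, exp (2 y σ) * |σ x| ^ 2` attached to a tuple `y` of real numbers
indexed by the infinite places. -/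
noncomputable def placeForm (y : InfinitePlace K → ℝ) (x : K) : ℝ :=
  ∑ w : InfinitePlace K, w.mult * (Real.exp (2 * y w) * w x ^ 2)

theorem placeForm_eq_sum_embeddings (y : InfinitePlace K → ℝ) (x : K) :
    placeForm y x = ∑ σ : K →+* ℂ, Real.exp (2 * y (InfinitePlace.mk σ)) * ‖σ x‖ ^ 2 := by
  rw [placeForm, ← sum_embeddings_eq_sum_places]
  rfl

/-- The matrix `(σ (b τ))`. -/
noncomputable def embMatrix (b : (K →+* ℂ) → K) : Matrix (K →+* ℂ) (K →+* ℂ) ℂ :=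
  Matrix.of fun σ τ => σ (b τ)

variable [DecidableEq (K →+* ℂ)]

/-- The diagonal matrix `exp (2 y)`. -/
noncomputable def scaleMatrix (y : InfinitePlace K → ℝ) : Matrix (K →+* ℂ) (K →+* ℂ) ℂ :=
  Matrix.diagonal fun σ => (Real.exp (2 * y (InfinitePlace.mk σ)) : ℂ)

/-- The Gram matrix of `placeForm y`. -/
noncomputable def gramMatrix (b : (K →+* ℂ) → K) (y : InfinitePlace K → ℝ) :
    Matrix (K →+* ℂ) (K →+* ℂ) ℝ :=
  ((embMatrix b)ᴴ * scaleMatrix y * embMatrix b).map Complex.re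

theorem gramMatrix_entry (b : (K →+* ℂ) → K) (y : InfinitePlace K → ℝ) (i j : K →+* ℂ) :
    ((embMatrix b)ᴴ * scaleMatrix y * embMatrix b) i j =
      ∑ σ : K →+* ℂ, starRingEnd ℂ (σ (b i)) * (Real.exp (2 * y (InfinitePlace.mk σ)) : ℂ)
        * σ (b j) := by
  rw [Matrix.mul_apply]
  simp [scaleMatrix, Matrix.mul_diagonal, embMatrix]

theorem gramMatrix_map (b : (K →+* ℂ) → K) (y : InfinitePlace K → ℝ) :
    (gramMatrix b y).map (fun x : ℝ => (x : ℂ)) =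
      (embMatrix b)ᴴ * scaleMatrix y * embMatrix b := by
  ext i j
  simp only [gramMatrix, Matrix.map_apply]
  rw [← Complex.conj_eq_iff_re, gramMatrix_entry, map_sum, ← sum_conjugate]
  refine Finset.sum_congr rfl fun σ _ => ?_
  rw [map_mul, map_mul, Complex.conj_ofReal]
  simp [ComplexEmbedding.conjugate_coe_eq]

theorem dotProduct_gramMatrix (b : (K →+* ℂ) → K) (y : InfinitePlace K → ℝ)
    (v : (K →+* ℂ) → ℝ) :
    v ⬝ᵥ gramMatrix b y *ᵥ v = ∑ σ : K →+* ℂ, Real.exp (2 * y (InfinitePlace.mk σ)) *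
      ‖∑ τ : K →+* ℂ, (v τ : ℂ) * σ (b τ)‖ ^ 2 := by
  rw [← Complex.ofReal_inj]
  have h1 : ((v ⬝ᵥ gramMatrix b y *ᵥ v : ℝ) : ℂ) =
      ∑ i, ∑ j, (v i : ℂ) * (((embMatrix b)ᴴ * scaleMatrix y * embMatrix b) i j * v j) := by
    rw [← gramMatrix_map]
    simp [dotProduct, Matrix.mulVec, Finset.mul_sum]
  rw [h1]
  simp_rw [gramMatrix_entry]
  push_cast
  simp_rw [← Complex.conj_mul', map_sum, map_mul, Complex.conj_ofReal, Finset.sum_mul,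
    Finset.mul_sum]
  rw [Finset.sum_comm_cycle]
  refine Finset.sum_congr rfl fun σ _ => Finset.sum_congr rfl fun i _ =>
    Finset.sum_congr rfl fun j _ => ?_
  ring

theorem embMatrix_transpose_mul {b c : (K →+* ℂ) → K}
    (h : ∀ i j, Algebra.trace ℚ K (b i * c j) = if i = j then 1 else 0) :
    (embMatrix b)ᵀ * embMatrix c = 1 := by
  ext i j
  have := trace_eq_sum_ringHom (b i * c j)
  rw [h] at this
  simp only [Matrix.mul_apply, embMatrix, Matrix.transpose_apply, Matrix.of_apply, Matrix.one_apply]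
  simp only [map_mul] at this
  rw [← this]
  split_ifs <;> simp

theorem gramMatrix_mul_dual {b c : (K →+* ℂ) → K}
    (h : ∀ i j, Algebra.trace ℚ K (b i * c j) = if i = j then 1 else 0)
    (y : InfinitePlace K → ℝ) :
    gramMatrix b y * gramMatrix c (-y) = 1 := by
  have h1 := embMatrix_transpose_mul h
  have hinj : Function.Injective
      (fun A : Matrix (K →+* ℂ) (K →+* ℂ) ℝ => A.map (fun x : ℝ => (x : ℂ))) :=
    fun A B hAB => by
      ext i j
      have := congrFun (congrFun hAB i) j
      simpa using this
  apply hinj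
  have hr : ∀ A : Matrix (K →+* ℂ) (K →+* ℂ) ℝ, A.map (fun x : ℝ => (x : ℂ)) =
    (Complex.ofRealHom.mapMatrix A) := fun A => rfl
  simp only
  have hc : (gramMatrix c (-y)).map (fun x : ℝ => (x : ℂ)) =
      (embMatrix c)ᵀ * scaleMatrix (-y) * (embMatrix c).map (starRingEnd ℂ) := by
    have h2 : (gramMatrix c (-y)).map (fun x : ℝ => (x : ℂ)) =
      ((gramMatrix c (-y)).map (fun x : ℝ => (x : ℂ))).map (starRingEnd ℂ) := by
      ext i j; simp
    rw [h2, gramMatrix_map, Matrix.map_mul, Matrix.map_mul]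
    congr 2
    · ext i j; simp [embMatrix]
    · ext i j; simp only [scaleMatrix, Matrix.map_apply, Matrix.diagonal_apply]
      split_ifs
      · exact Complex.conj_ofReal _
      · simp
  rw [hr (_ * _), map_mul, ← hr, ← hr, gramMatrix_map, hc, hr, map_one]
  have h3 : embMatrix b * (embMatrix c)ᵀ = 1 := by
    have := mul_eq_one_comm.mp h1
    rw [← Matrix.transpose_inj, Matrix.transpose_mul] at this
    simpa using this
  have h4 : (embMatrix b)ᴴ * (embMatrix c).map (starRingEnd ℂ) = 1 := by
    have := congrArg (fun A : Matrix (K →+* ℂ) (K →+* ℂ) ℂ => A.map (starRingEnd ℂ)) h1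
    simp only [Matrix.map_mul] at this
    rw [Matrix.map_one _ (map_zero _) (map_one _)] at this
    exact this
  have h5 : scaleMatrix y * scaleMatrix (-y) = 1 := by
    rw [scaleMatrix, scaleMatrix, Matrix.diagonal_mul_diagonal, ← Matrix.diagonal_one]
    congr 1
    ext σ
    rw [← Complex.ofReal_mul, ← Real.exp_add]
    simp
  calc (embMatrix b)ᴴ * scaleMatrix y * embMatrix b *
        ((embMatrix c)ᵀ * scaleMatrix (-y) * (embMatrix c).map (starRingEnd ℂ))
      = (embMatrix b)ᴴ * (scaleMatrix y * (embMatrix b * (embMatrix c)ᵀ) * scaleMatrix (-y)) *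
        (embMatrix c).map (starRingEnd ℂ) := by simp only [Matrix.mul_assoc]
    _ = 1 := by rw [h3, Matrix.mul_one, h5, Matrix.mul_one, h4]

end ExplicitFormula

namespace ExplicitFormula

open MeasureTheory Filter Topology
open NumberField nonZeroDivisors Matrix Module

variable {K : Type*} [Field K] [NumberField K]

section
variable [DecidableEq (K →+* ℂ)]

theorem embMatrix_det_ne_zero (b : Basis (K →+* ℂ) ℚ K) : (embMatrix b).det ≠ 0 := by
  have := embMatrix_transpose_mul (b := b) (c := b.traceDual) (fun i j => by
    rw [Basis.trace_mul_traceDual])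
  have h2 := congrArg Matrix.det this
  rw [Matrix.det_mul, Matrix.det_transpose, Matrix.det_one] at h2
  exact left_ne_zero_of_mul_eq_one h2

theorem gramMatrix_det (b : (K →+* ℂ) → K) (y : InfinitePlace K → ℝ) :
    (gramMatrix b y).det =
      Real.exp (2 * ∑ w : InfinitePlace K, w.mult * y w) * ‖(embMatrix b).det‖ ^ 2 := by
  have h : (((gramMatrix b y).det : ℝ) : ℂ) =
      ((gramMatrix b y).map (fun x : ℝ => (x : ℂ))).det :=
    RingHom.map_det Complex.ofRealHom _
  rw [← Complex.ofReal_inj, h, gramMatrix_map, Matrix.det_mul, Matrix.det_mul,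
    Matrix.det_conjTranspose, scaleMatrix, Matrix.det_diagonal]
  push_cast
  have hp := prod_embeddings_eq_prod_places (R := ℂ) (fun w : InfinitePlace K =>
    Complex.exp (2 * y w))
  rw [← Complex.conj_mul', hp, Finset.mul_sum, Complex.exp_sum]
  have : ∏ w : InfinitePlace K, Complex.exp (2 * y w) ^ w.mult =
      ∏ w : InfinitePlace K, Complex.exp (2 * ((w.mult : ℂ) * y w)) := by
    refine Finset.prod_congr rfl fun w _ => ?_
    rw [← Complex.exp_nat_mul]
    congr 1; ring
  rw [this]
  simp only [RCLike.star_def]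
  ring

theorem gramMatrix_isHermitian (b : (K →+* ℂ) → K) (y : InfinitePlace K → ℝ) :
    (gramMatrix b y).IsHermitian := by
  ext i j
  have h : ((embMatrix b)ᴴ * scaleMatrix y * embMatrix b).IsHermitian := by
    rw [Matrix.IsHermitian, Matrix.conjTranspose_mul, Matrix.conjTranspose_mul,
      Matrix.conjTranspose_conjTranspose, Matrix.mul_assoc]
    congr 2
    rw [scaleMatrix, Matrix.diagonal_conjTranspose]
    congr 1; ext σ
    exact Complex.conj_ofReal _
  have := congrFun (congrFun h i) j
  rw [Matrix.conjTranspose_apply] at this ⊢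
  simp only [gramMatrix, Matrix.map_apply]
  rw [← this]
  simp

theorem gramMatrix_posDef (b : Basis (K →+* ℂ) ℚ K) (y : InfinitePlace K → ℝ) :
    (gramMatrix b y).PosDef := by
  refine Matrix.PosDef.of_dotProduct_mulVec_pos (gramMatrix_isHermitian _ _) fun v hv => ?_
  rw [star_trivial, dotProduct_gramMatrix]
  refine Finset.sum_pos' (fun σ _ => by positivity) ?_
  by_contra! hcon
  apply hv
  have h0 : (embMatrix b) *ᵥ (fun τ => (v τ : ℂ)) = 0 := by
    ext σ
    have := hcon σ (Finset.mem_univ _)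
    have h1 : ‖∑ τ : K →+* ℂ, (v τ : ℂ) * σ (b τ)‖ ^ 2 ≤ 0 := by
      by_contra! h
      exact absurd this (not_le.mpr (mul_pos (Real.exp_pos _) h))
    have h2 : ∑ τ : K →+* ℂ, (v τ : ℂ) * σ (b τ) = 0 := by
      rw [← norm_eq_zero]; nlinarith [norm_nonneg (∑ τ : K →+* ℂ, (v τ : ℂ) * σ (b τ))]
    simp only [Matrix.mulVec, dotProduct, embMatrix, Matrix.of_apply, Pi.zero_apply]
    rw [← h2]
    exact Finset.sum_congr rfl fun _ _ => mul_comm _ _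
  have := Matrix.eq_zero_of_mulVec_eq_zero (embMatrix_det_ne_zero b) h0
  ext τ
  simpa using congrFun this τ

theorem embMatrix_det_eq (b c : Basis (K →+* ℂ) ℚ K) :
    ‖(embMatrix c).det‖ = ‖(embMatrix b).det‖ * |(b.det c : ℚ)| := by
  have : embMatrix c = embMatrix b * (b.toMatrix c).map (fun q : ℚ => (q : ℂ)) := by
    ext σ τ
    simp only [embMatrix, Matrix.of_apply, Matrix.mul_apply, Matrix.map_apply,
      Basis.toMatrix_apply]
    conv_lhs => rw [← b.sum_repr (c τ)]
    rw [map_sum]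
    refine Finset.sum_congr rfl fun i _ => ?_
    rw [Algebra.smul_def, map_mul, mul_comm]
    simp
  rw [this, Matrix.det_mul, norm_mul]
  congr 1
  have h : ((b.toMatrix c).map (fun q : ℚ => (q : ℂ))).det = (((b.toMatrix c).det : ℚ) : ℂ) :=
    (RingHom.map_det (Rat.castHom ℂ) _).symm
  rw [h, Basis.det_apply, ← Complex.ofReal_ratCast, Complex.norm_real, Real.norm_eq_abs]
  simp

end

theorem card_chooseBasisIndex (J : (FractionalIdeal (𝓞 K)⁰ K)ˣ) :
    Fintype.card (Free.ChooseBasisIndex ℤ J.1) = Fintype.card (K →+* ℂ) := by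
  rw [← finrank_eq_card_basis (basisOfFractionalIdeal K J), Embeddings.card]

theorem nonempty_ringOfIntegers_index :
    Nonempty (Free.ChooseBasisIndex ℤ (𝓞 K) ≃ (K →+* ℂ)) := by
  refine ⟨Fintype.equivOfCardEq ?_⟩
  rw [← finrank_eq_card_basis (integralBasis K), Embeddings.card]

variable (K) in
/-- The square root of the absolute value of the discriminant. -/
noncomputable def sqrtDisc : ℝ := by
  classical exact ‖(embMatrix ((integralBasis K).reindex
    (nonempty_ringOfIntegers_index (K := K)).some)).det‖

variable (K) in
theorem sqrtDisc_pos : 0 < sqrtDisc K := by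
  classical exact norm_pos_iff.mpr (embMatrix_det_ne_zero _)

theorem exists_basis_fractionalIdeal [DecidableEq (K →+* ℂ)] (J : (FractionalIdeal (𝓞 K)⁰ K)ˣ) :
    ∃ b : Basis (K →+* ℂ) ℚ K,
      Submodule.span ℤ (Set.range b) = (J.1 : Submodule (𝓞 K) K).restrictScalars ℤ ∧
        ‖(embMatrix b).det‖ = sqrtDisc K * FractionalIdeal.absNorm J.1 := by
  obtain ⟨e⟩ := Fintype.card_eq.mp (card_chooseBasisIndex J)
  set e0 := (nonempty_ringOfIntegers_index (K := K)).some with he0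
  refine ⟨(basisOfFractionalIdeal K J).reindex e, ?_, ?_⟩
  · ext x
    rw [Basis.range_reindex, mem_span_basisOfFractionalIdeal]
    rfl
  · have h := det_basisOfFractionalIdeal_eq_absNorm (K := K) J (e0.trans e.symm)
    rw [embMatrix_det_eq ((integralBasis K).reindex e0), ← h]
    congr 1
    · rw [sqrtDisc]; congr!
    · rw [Basis.det_reindex]
      congr 3
      ext i
      simp

/-- The theta function of a fractional ideal. -/
noncomputable def idealTheta (J : FractionalIdeal (𝓞 K)⁰ K) (y : InfinitePlace K → ℝ) : ℝ :=
  ∑' x : {x : K // x ∈ J}, Real.exp (-Real.pi * placeForm y (x : K))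

/-- A basis of a fractional ideal identifies it with the standard lattice. -/
theorem exists_intVec_equiv {J : FractionalIdeal (𝓞 K)⁰ K} {b : Basis (K →+* ℂ) ℚ K}
    (hb : Submodule.span ℤ (Set.range b) = (J : Submodule (𝓞 K) K).restrictScalars ℤ) :
    ∃ e : ((K →+* ℂ) → ℤ) ≃ {x : K // x ∈ J}, (e 0 : K) = 0 ∧
      ∀ m, (e m : K) = ∑ τ, (m τ : K) * b τ := by
  have hmem : ∀ m : (K →+* ℂ) → ℤ, ∑ τ, (m τ : K) * b τ ∈ J := fun m => by
    have : ∑ τ, m τ • b τ ∈ Submodule.span ℤ (Set.range b) :=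
      Submodule.sum_mem _ fun τ _ => Submodule.smul_mem _ _ (Submodule.subset_span ⟨τ, rfl⟩)
    rw [hb] at this
    simpa using this
  refine ⟨Equiv.ofBijective (fun m => (⟨_, hmem m⟩ : {x : K // x ∈ J})) ⟨fun m m' h => ?_, fun x => ?_⟩,
    ?_, fun m => rfl⟩
  · have h' : ∑ τ, (m τ : K) * b τ = ∑ τ, (m' τ : K) * b τ := congrArg Subtype.val h
    have h2 := Fintype.linearIndependent_iff.mp b.linearIndependent
      (fun τ => (m τ : ℚ) - m' τ) (by
        simpa [Algebra.smul_def, sub_mul, sub_eq_zero] using h')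
    ext τ
    have := h2 τ
    exact_mod_cast sub_eq_zero.mp this
  · have hx : (x : K) ∈ Submodule.span ℤ (Set.range b) := by rw [hb]; exact x.2
    obtain ⟨c, hc⟩ := (Submodule.mem_span_range_iff_exists_fun ℤ).mp hx
    exact ⟨c, Subtype.ext (by simpa using hc)⟩
  · simp [Equiv.ofBijective]

theorem placeForm_sum (b : (K →+* ℂ) → K) [DecidableEq (K →+* ℂ)] (y : InfinitePlace K → ℝ)
    (m : (K →+* ℂ) → ℤ) :
    placeForm y (∑ τ, (m τ : K) * b τ) = intVec m ⬝ᵥ gramMatrix b y *ᵥ intVec m := by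
  rw [placeForm_eq_sum_embeddings, dotProduct_gramMatrix]
  refine Finset.sum_congr rfl fun σ _ => ?_
  simp [intVec]

theorem idealTheta_eq_theta [DecidableEq (K →+* ℂ)] {J : FractionalIdeal (𝓞 K)⁰ K}
    {b : Basis (K →+* ℂ) ℚ K}
    (hb : Submodule.span ℤ (Set.range b) = (J : Submodule (𝓞 K) K).restrictScalars ℤ)
    (y : InfinitePlace K → ℝ) : idealTheta J y = theta (gramMatrix b y) := by
  obtain ⟨e, -, he⟩ := exists_intVec_equiv hb
  rw [idealTheta, theta, ← e.tsum_eq]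
  refine tsum_congr fun m => ?_
  rw [he, placeForm_sum]

theorem summable_idealTheta (J : (FractionalIdeal (𝓞 K)⁰ K)ˣ) (y : InfinitePlace K → ℝ) :
    Summable fun x : {x : K // x ∈ J.1} => Real.exp (-Real.pi * placeForm y (x : K)) := by
  classical
  obtain ⟨b, hb, -⟩ := exists_basis_fractionalIdeal J
  obtain ⟨e, -, he⟩ := exists_intVec_equiv hb
  rw [← e.summable_iff]
  convert! summable_theta (gramMatrix_posDef b y) using 2 with m
  simp [he, placeForm_sum]

theorem exists_placeForm_lower_bound (J : (FractionalIdeal (𝓞 K)⁰ K)ˣ) :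
    ∃ (c : ℝ) (e : ((K →+* ℂ) → ℤ) ≃ {x : K // x ∈ J.1}), 0 < c ∧ (e 0 : K) = 0 ∧
      ∀ m, c * ‖intVec m‖ ^ 2 ≤ placeForm 0 (e m : K) := by
  classical
  obtain ⟨b, hb, -⟩ := exists_basis_fractionalIdeal J
  obtain ⟨e, h0, he⟩ := exists_intVec_equiv hb
  obtain ⟨c, hc, h⟩ := exists_posDef_lower_bound (gramMatrix_posDef b 0)
  exact ⟨c, e, hc, h0, fun m => by rw [he, placeForm_sum]; exact h _⟩

/-- The dual of a fractional ideal for the trace form. -/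
noncomputable def dualIdeal (J : (FractionalIdeal (𝓞 K)⁰ K)ˣ) : (FractionalIdeal (𝓞 K)⁰ K)ˣ :=
  Units.mk0 (FractionalIdeal.dual ℤ ℚ J.1) (FractionalIdeal.dual_ne_zero ℤ ℚ J.ne_zero)

theorem idealTheta_dual (J : (FractionalIdeal (𝓞 K)⁰ K)ˣ) (y : InfinitePlace K → ℝ) :
    idealTheta J.1 y = (sqrtDisc K * FractionalIdeal.absNorm J.1)⁻¹ *
      Real.exp (-∑ w : InfinitePlace K, w.mult * y w) * idealTheta (dualIdeal J).1 (-y) := by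
  classical
  obtain ⟨b, hb, hdet⟩ := exists_basis_fractionalIdeal J
  have hb' : Submodule.span ℤ (Set.range b.traceDual) =
      ((dualIdeal J).1 : Submodule (𝓞 K) K).restrictScalars ℤ := by
    rw [← Submodule.traceDual_span_of_basis ℤ (J.1 : Submodule (𝓞 K) K) b hb.symm,
      ← FractionalIdeal.coe_dual ℤ ℚ J.ne_zero]
    rfl
  have hinv : (gramMatrix b y)⁻¹ = gramMatrix b.traceDual (-y) :=
    Matrix.inv_eq_right_inv (gramMatrix_mul_dual (fun i j => by
      rw [Basis.trace_mul_traceDual]) y)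
  rw [idealTheta_eq_theta hb, idealTheta_eq_theta hb', theta_inv (gramMatrix_posDef b y), hinv,
    gramMatrix_det, hdet, Real.sqrt_mul (by positivity), Real.sqrt_sq
      (mul_nonneg (sqrtDisc_pos K).le (by exact_mod_cast FractionalIdeal.absNorm_nonneg _)),
    two_mul, Real.exp_add, Real.sqrt_mul_self (by positivity), mul_inv, Real.exp_neg]
  ring

theorem absNorm_dualIdeal (J : (FractionalIdeal (𝓞 K)⁰ K)ˣ) :
    (sqrtDisc K * FractionalIdeal.absNorm J.1) *
      (sqrtDisc K * FractionalIdeal.absNorm (dualIdeal J).1) = 1 := by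
  have h1 := idealTheta_dual J 0
  have h2 := idealTheta_dual (dualIdeal J) 0
  have h3 : dualIdeal (dualIdeal J) = J := Units.ext (FractionalIdeal.dual_dual ℤ ℚ J.1)
  have h4 : 0 < idealTheta J.1 0 :=
    (summable_idealTheta J 0).tsum_pos (fun _ => (Real.exp_pos _).le) ⟨0, J.1.zero_mem⟩ (Real.exp_pos _)
  rw [h3] at h2
  simp only [neg_zero, Pi.zero_apply, mul_zero, Finset.sum_const_zero, Real.exp_zero,
    mul_one] at h1 h2
  rw [h2, ← mul_assoc, ← mul_inv] at h1
  have h5 := mul_right_cancel₀ h4.ne' ((one_mul _).trans h1)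
  rw [eq_comm, inv_eq_one] at h5
  exact h5

end ExplicitFormula

namespace ExplicitFormula

open MeasureTheory Filter Topology
open NumberField NumberField.Units NumberField.Units.dirichletUnitTheorem nonZeroDivisors Module
open scoped ENNReal Classical

variable {K : Type*} [Field K] [NumberField K]

section

/-- Coordinates on the space of tuples indexed by the infinite places, adapted to the unit
lattice: `t` is the weighted mean. -/
noncomputable def placeCoord (t : ℝ) (z : logSpace K) (w : InfinitePlace K) : ℝ :=
  if h : w = w₀ then t - (∑ v, z v) / (w.mult : ℝ) else t + z ⟨w, h⟩ / (w.mult : ℝ)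

theorem placeCoord_w₀ (t : ℝ) (z : logSpace K) :
    placeCoord t z w₀ = t - (∑ v, z v) / (w₀ : InfinitePlace K).mult := by
  simp only [placeCoord, dif_pos]

theorem placeCoord_ne (t : ℝ) (z : logSpace K) (w : {w : InfinitePlace K // w ≠ w₀}) :
    placeCoord t z w = t + z w / w.1.mult := by
  simp [placeCoord, w.2]

theorem placeCoord_add (t t' : ℝ) (z z' : logSpace K) :
    placeCoord (t + t') (z + z') = placeCoord t z + placeCoord t' z' := by
  ext w
  by_cases h : w = w₀
  · subst h
    simp only [Pi.add_apply, placeCoord_w₀, Finset.sum_add_distrib]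
    ring
  · have := fun t z => placeCoord_ne t z (⟨w, h⟩ : {w : InfinitePlace K // w ≠ w₀})
    simp only at this
    rw [Pi.add_apply, this, this, this, Pi.add_apply]
    ring

theorem placeCoord_smul (c t : ℝ) (z : logSpace K) :
    placeCoord (c * t) (c • z) = c • placeCoord t z := by
  ext w
  by_cases h : w = w₀
  · subst h
    simp only [Pi.smul_apply, placeCoord_w₀, smul_eq_mul, ← Finset.mul_sum]
    ring
  · have := fun t z => placeCoord_ne t z (⟨w, h⟩ : {w : InfinitePlace K // w ≠ w₀})
    simp only at this
    rw [Pi.smul_apply, this, this, Pi.smul_apply, smul_eq_mul, smul_eq_mul]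
    ring

theorem placeCoord_neg (t : ℝ) (z : logSpace K) :
    placeCoord (-t) (-z) = -placeCoord t z := by
  simpa using placeCoord_smul (-1) t z

theorem placeCoord_add_left (t t' : ℝ) (z : logSpace K) (w : InfinitePlace K) :
    placeCoord (t + t') z w = placeCoord t z w + t' := by
  by_cases h : w = w₀
  · subst h
    simp only [placeCoord_w₀]
    ring
  · have := fun t z => placeCoord_ne t z (⟨w, h⟩ : {w : InfinitePlace K // w ≠ w₀})
    simp only at this
    rw [this, this]
    ring

theorem mult_ne_zero_real {K : Type*} [Field K] (w : InfinitePlace K) : (w.mult : ℝ) ≠ 0 := by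
  exact_mod_cast InfinitePlace.mult_ne_zero

theorem sum_mult_placeCoord (t : ℝ) (z : logSpace K) :
    ∑ w : InfinitePlace K, w.mult * placeCoord t z w = finrank ℚ K * t := by
  have h1 : ∑ w : InfinitePlace K, (w.mult : ℝ) * t = finrank ℚ K * t := by
    rw [← Finset.sum_mul, ← InfinitePlace.sum_mult_eq]
    push_cast
    rfl
  have h2 : ∑ w : InfinitePlace K, (w.mult : ℝ) * (placeCoord t z w - t) = 0 := by
    rw [Fintype.sum_eq_add_sum_subtype_ne _ w₀]
    simp only [placeCoord_w₀, placeCoord_ne]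
    rw [Finset.sum_congr rfl (g := fun w => z w)]
    · have := mult_ne_zero_real (w₀ : InfinitePlace K)
      field_simp
      ring_nf
    · intro w _
      have := mult_ne_zero_real w.1
      field_simp
  simp only [mul_sub, Finset.sum_sub_distrib] at h2
  linarith

theorem placeCoord_logEmbedding (u : (𝓞 K)ˣ) (w : InfinitePlace K) :
    placeCoord 0 (logEmbedding K (Additive.ofMul u)) w = Real.log (w (u : K)) := by
  have hm := mult_ne_zero_real w
  by_cases h : w = w₀
  · subst h
    rw [placeCoord_w₀, sum_logEmbedding_component]
    field_simp
    ring
  · have := placeCoord_ne 0 (logEmbedding K (Additive.ofMul u))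
      (⟨w, h⟩ : {w : InfinitePlace K // w ≠ w₀})
    simp only at this
    rw [this, logEmbedding_component]
    field_simp
    ring

theorem placeForm_placeCoord_add_logEmbedding (t : ℝ) (z : logSpace K) (u : (𝓞 K)ˣ) (x : K) :
    placeForm (placeCoord t (logEmbedding K (Additive.ofMul u) + z)) x =
      placeForm (placeCoord t z) ((u : K) * x) := by
  refine Finset.sum_congr rfl fun w _ => ?_
  have h := placeCoord_add 0 t (logEmbedding K (Additive.ofMul u)) z
  rw [zero_add] at h
  have hu : 0 < w (u : K) := InfinitePlace.pos_iff.mpr (by simp)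
  rw [h, Pi.add_apply, placeCoord_logEmbedding, mul_add, Real.exp_add, two_mul, Real.exp_add,
    Real.exp_log hu, map_mul]
  ring

/-- `placeCoord` as a linear equivalence. -/
theorem exists_placeCoord_equiv :
    ∃ e : (ℝ × logSpace K) ≃L[ℝ] (InfinitePlace K → ℝ), ∀ p, e p = placeCoord p.1 p.2 := by
  let l : (ℝ × logSpace K) →ₗ[ℝ] (InfinitePlace K → ℝ) :=
    { toFun := fun p => placeCoord p.1 p.2
      map_add' := fun p q => placeCoord_add _ _ _ _
      map_smul' := fun c p => placeCoord_smul _ _ _ }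
  have hl : Function.Injective l := by
    rw [injective_iff_map_eq_zero]
    rintro ⟨t, z⟩ h
    have h' : placeCoord t z = 0 := h
    have ht : t = 0 := by
      have := sum_mult_placeCoord t z
      rw [h'] at this
      simpa [(finrank_pos (R := ℚ) (M := K)).ne'] using this.symm
    subst ht
    refine Prod.ext rfl ?_
    ext w
    have := placeCoord_ne 0 z w
    rw [h'] at this
    simpa [mult_ne_zero_real w.1] using this.symm
  have hr : finrank ℝ (ℝ × logSpace K) = finrank ℝ (InfinitePlace K → ℝ) := by
    rw [finrank_prod, finrank_self, finrank_fintype_fun_eq_card, finrank_fintype_fun_eq_card,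
      Fintype.card_subtype_compl, Fintype.card_subtype_eq]
    have := Fintype.card_pos (α := InfinitePlace K)
    omega
  exact ⟨(LinearEquiv.ofInjectiveOfFinrankEq l hl hr).toContinuousLinearEquiv, fun p => rfl⟩

theorem measurable_placeCoord :
    Measurable fun p : ℝ × logSpace K => placeCoord p.1 p.2 := by
  obtain ⟨e, he⟩ := exists_placeCoord_equiv (K := K)
  simpa only [← he] using e.continuous.measurable

variable (K) in
theorem exists_lintegral_placeCoord :
    ∃ c : ℝ≥0∞, c ≠ 0 ∧ c ≠ ∞ ∧ ∀ g : (InfinitePlace K → ℝ) → ℝ≥0∞, Measurable g →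
      ∫⁻ t : ℝ, ∫⁻ z : logSpace K, g (placeCoord t z) = c * ∫⁻ y, g y := by
  obtain ⟨e, he⟩ := exists_placeCoord_equiv (K := K)
  have h0 : (volume : Measure (ℝ × logSpace K)).IsAddHaarMeasure :=
    Measure.prod.instIsAddHaarMeasure _ _
  have h1 : (Measure.map e (volume : Measure (ℝ × logSpace K))).IsAddHaarMeasure :=
    e.isAddHaarMeasure_map _
  have h2 := Measure.isAddLeftInvariant_eq_smul
    (Measure.map e (volume : Measure (ℝ × logSpace K))) volume
  refine ⟨((Measure.map e volume).addHaarScalarFactor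
    (volume : Measure (InfinitePlace K → ℝ)) : ℝ≥0∞), ?_, ENNReal.coe_ne_top, fun g hg => ?_⟩
  · exact ENNReal.coe_ne_zero.mpr (Measure.addHaarScalarFactor_pos_of_isAddHaarMeasure
      (Measure.map e (volume : Measure (ℝ × logSpace K))) volume).ne'
  · rw [← lintegral_prod (f := fun p : ℝ × logSpace K => g (placeCoord p.1 p.2))
      (hg.comp measurable_placeCoord).aemeasurable, ← Measure.volume_eq_prod,
      ← smul_eq_mul, ← lintegral_smul_measure]
    have h3 := lintegral_map (μ := (volume : Measure (ℝ × logSpace K))) hg e.continuous.measurable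
    rw [h2] at h3
    simp only [he] at h3
    rw [← h3]
    rfl

variable (K) in
/-- A fundamental domain for the unit lattice. -/
def unitDomain : Set (logSpace K) :=
  ZSpan.fundamentalDomain ((basisUnitLattice K).ofZLatticeBasis ℝ (unitLattice K))

theorem isAddFundamentalDomain_unitDomain :
    IsAddFundamentalDomain (unitLattice K) (unitDomain K) volume :=
  ZLattice.isAddFundamentalDomain (basisUnitLattice K) volume

theorem isBounded_unitDomain : Bornology.IsBounded (unitDomain K) :=
  ZSpan.fundamentalDomain_isBounded _

theorem measurableSet_unitDomain : MeasurableSet (unitDomain K) :=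
  ZSpan.fundamentalDomain_measurableSet _

theorem volume_unitDomain_lt_top : volume (unitDomain K) < ∞ :=
  isBounded_unitDomain.measure_lt_top

theorem volume_unitDomain_ne_zero : volume (unitDomain K) ≠ 0 :=
  ZSpan.measure_fundamentalDomain_ne_zero _

theorem tsum_units_eq (F : (𝓞 K)ˣ ⧸ torsion K → ℝ≥0∞) :
    ∑' u : (𝓞 K)ˣ, F (QuotientGroup.mk u) = torsionOrder K * ∑' q, F q := by
  rw [← (Subgroup.groupEquivQuotientProdSubgroup (s := torsion K)).symm.tsum_eq,
    ENNReal.tsum_prod', ← ENNReal.tsum_mul_left]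
  refine tsum_congr fun q => ?_
  have : ∀ t : torsion K, QuotientGroup.mk (s := torsion K)
      ((Subgroup.groupEquivQuotientProdSubgroup (s := torsion K)).symm (q, t)) = q := fun t => by
    set u := (Subgroup.groupEquivQuotientProdSubgroup (s := torsion K)).symm (q, t) with hu
    have h : Subgroup.groupEquivQuotientProdSubgroup u = (q, t) := by
      rw [hu, Equiv.apply_symm_apply]
    exact congrArg Prod.fst h
  simp only [this]
  rw [ENNReal.tsum_const, ENat.card_eq_coe_natCard]
  rfl

instance : VAddInvariantMeasure (unitLattice K) (logSpace K) volume :=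
  ⟨fun c s _ => measure_preimage_add volume (c : logSpace K) s⟩

theorem tsum_units_lintegral (h : logSpace K → ℝ≥0∞) :
    ∑' u : (𝓞 K)ˣ, ∫⁻ z in unitDomain K, h (logEmbedding K (Additive.ofMul u) + z) =
      torsionOrder K * ∫⁻ z, h z := by
  rw [isAddFundamentalDomain_unitDomain.lintegral_eq_tsum' h]
  have e1 : ∑' g : unitLattice K, ∫⁻ x in unitDomain K, h (-g +ᵥ x) =
      ∑' g : unitLattice K, ∫⁻ x in unitDomain K, h (g +ᵥ x) :=
    (Equiv.neg (unitLattice K)).tsum_eq (fun g => ∫⁻ x in unitDomain K, h (g +ᵥ x))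
  rw [e1, ← (logEmbeddingEquiv K).toEquiv.tsum_eq]
  exact tsum_units_eq fun q => ∫⁻ x in unitDomain K, h
    (logEmbeddingEquiv K (Additive.ofMul q) +ᵥ x)

end

end ExplicitFormula

namespace ExplicitFormula

open MeasureTheory Filter Topology
open NumberField NumberField.Units NumberField.Units.dirichletUnitTheorem nonZeroDivisors Module
open scoped ENNReal Classical

section

theorem image_exp_univ : Real.exp '' Set.univ = Set.Ioi 0 := by
  rw [Set.image_univ, Real.range_exp]

theorem integrable_comp_exp {E : Type*} [NormedAddCommGroup E] [NormedSpace ℝ E] (g : ℝ → E) :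
    IntegrableOn g (Set.Ioi 0) ↔ Integrable fun r => Real.exp r • g (Real.exp r) := by
  rw [← image_exp_univ, integrableOn_image_iff_integrableOn_abs_deriv_smul MeasurableSet.univ
    (fun x _ => (Real.hasDerivAt_exp x).hasDerivWithinAt) Real.exp_injective.injOn,
    integrableOn_univ]
  simp only [abs_of_pos (Real.exp_pos _)]

theorem integral_comp_exp {E : Type*} [NormedAddCommGroup E] [NormedSpace ℝ E] (g : ℝ → E) :
    ∫ x in Set.Ioi 0, g x = ∫ r, Real.exp r • g (Real.exp r) := by
  rw [← image_exp_univ, integral_image_eq_integral_abs_deriv_smul MeasurableSet.univ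
    (fun x _ => (Real.hasDerivAt_exp x).hasDerivWithinAt) Real.exp_injective.injOn,
    setIntegral_univ]
  simp only [abs_of_pos (Real.exp_pos _)]

theorem exp_mul_sub_eq (a b r : ℝ) : Real.exp (a * r - b * Real.exp (2 * r)) =
    Real.exp r * (Real.exp r ^ (a - 1) * Real.exp (-b * Real.exp r ^ (2 : ℝ))) := by
  rw [← Real.exp_mul, ← Real.exp_mul, ← Real.exp_add, ← Real.exp_add]
  ring_nf

theorem integrable_exp_mul_sub {a b : ℝ} (ha : 0 < a) (hb : 0 < b) :
    Integrable fun r => Real.exp (a * r - b * Real.exp (2 * r)) := by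
  simp only [exp_mul_sub_eq]
  exact (integrable_comp_exp _).mp
    (integrableOn_rpow_mul_exp_neg_mul_rpow (by linarith) two_pos hb)

theorem integral_exp_mul_sub {a b : ℝ} (ha : 0 < a) (hb : 0 < b) :
    ∫ r, Real.exp (a * r - b * Real.exp (2 * r)) =
      b ^ (-a / 2) * (1 / 2) * Real.Gamma (a / 2) := by
  simp only [exp_mul_sub_eq]
  have := integral_rpow_mul_exp_neg_mul_rpow (p := 2) (q := a - 1) (b := b) two_pos
    (by linarith) hb
  rw [integral_comp_exp] at this
  simpa using this

end

variable {K : Type*} [Field K] [NumberField K]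

section

variable (K) in
/-- The archimedean factor of the completed zeta function, at a real argument. -/
noncomputable def archFactor (s : ℝ) : ℝ :=
  ∏ w : InfinitePlace K, ((Real.pi * w.mult) ^ (-(s * w.mult) / 2) * (1 / 2) *
    Real.Gamma (s * w.mult / 2))

theorem archFactor_pos {s : ℝ} (hs : 0 < s) : 0 < archFactor K s := by
  refine Finset.prod_pos fun w _ => ?_
  have : 0 < (w.mult : ℝ) := by exact_mod_cast InfinitePlace.mult_pos
  have := Real.Gamma_pos_of_pos (show 0 < s * w.mult / 2 by positivity)
  positivity

theorem lintegral_exp_placeForm {s : ℝ} (hs : 0 < s) {x : K} (hx : x ≠ 0) :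
    ∫⁻ y, ENNReal.ofReal (Real.exp (s * ∑ w : InfinitePlace K, (w.mult : ℝ) * y w)) *
        ENNReal.ofReal (Real.exp (-Real.pi * placeForm y x)) =
      ENNReal.ofReal (archFactor K s) *
        ENNReal.ofReal (((|Algebra.norm ℚ x| : ℚ) : ℝ) ^ (-s)) := by
  have hm : ∀ w : InfinitePlace K, 0 < (w.mult : ℝ) := fun w => by
    exact_mod_cast InfinitePlace.mult_pos
  have hw : ∀ w : InfinitePlace K, 0 < w x := fun w => w.pos_iff.mpr hx
  let F : InfinitePlace K → ℝ → ℝ := fun w r =>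
    Real.exp (s * w.mult * r - Real.pi * w.mult * w x ^ 2 * Real.exp (2 * r))
  have hF : ∀ y : InfinitePlace K → ℝ,
      ENNReal.ofReal (Real.exp (s * ∑ w : InfinitePlace K, (w.mult : ℝ) * y w)) *
      ENNReal.ofReal (Real.exp (-Real.pi * placeForm y x)) =
        ENNReal.ofReal (∏ w, F w (y w)) := fun y => by
    rw [← ENNReal.ofReal_mul (Real.exp_pos _).le, ← Real.exp_sum, ← Real.exp_add, placeForm, Finset.mul_sum, Finset.mul_sum,
      ← Finset.sum_add_distrib]
    congr 2
    refine Finset.sum_congr rfl fun w _ => ?_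
    ring
  have hb : ∀ w : InfinitePlace K, 0 < Real.pi * w.mult * w x ^ 2 := fun w => by
    have := hm w
    have := hw w
    positivity
  have hInt : ∀ w, Integrable (F w) := fun w =>
    integrable_exp_mul_sub (mul_pos hs (hm w)) (hb w)
  simp_rw [hF]
  have hInt' : Integrable fun y : InfinitePlace K → ℝ => ∏ w, F w (y w) :=
    Integrable.fintype_prod hInt
  rw [← ofReal_integral_eq_lintegral_ofReal hInt'
    (ae_of_all _ fun y => Finset.prod_nonneg fun w _ => (Real.exp_pos _).le),
    integral_fintype_prod_volume_eq_prod, ← ENNReal.ofReal_mul (archFactor_pos hs).le,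
    ← InfinitePlace.prod_eq_abs_norm, ← Real.finsetProd_rpow _ _
      (fun w _ => pow_nonneg (hw w).le _), archFactor, ← Finset.prod_mul_distrib]
  congr 1
  refine Finset.prod_congr rfl fun w _ => ?_
  rw [integral_exp_mul_sub (mul_pos hs (hm w)) (hb w), Real.mul_rpow (by have := hm w; positivity)
    (by positivity), ← Real.rpow_natCast (w x) 2, ← Real.rpow_mul (hw w).le,
    ← Real.rpow_natCast (w x) w.mult, ← Real.rpow_mul (hw w).le]
  rw [show ((2 : ℕ) : ℝ) * (-(s * w.mult) / 2) = w.mult * -s by push_cast; ring]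
  ring

end

section

/-- The integral ideals in the class of the inverse of `J`. -/
def idealsInClass (J : (FractionalIdeal (𝓞 K)⁰ K)ˣ) : Set (Ideal (𝓞 K)) :=
  {I | I ≠ ⊥ ∧ ∃ x : K, FractionalIdeal.spanSingleton (𝓞 K)⁰ x = I * J.1}

/-- A generator of `I * J`. -/
noncomputable def classGen (J : (FractionalIdeal (𝓞 K)⁰ K)ˣ) (I : idealsInClass J) : K :=
  I.2.2.choose

theorem spanSingleton_classGen (J : (FractionalIdeal (𝓞 K)⁰ K)ˣ) (I : idealsInClass J) :
    FractionalIdeal.spanSingleton (𝓞 K)⁰ (classGen J I) = I.1 * J.1 :=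
  I.2.2.choose_spec

theorem classGen_ne_zero (J : (FractionalIdeal (𝓞 K)⁰ K)ˣ) (I : idealsInClass J) :
    classGen J I ≠ 0 := by
  intro h
  have h1 := spanSingleton_classGen J I
  rw [h, FractionalIdeal.spanSingleton_zero] at h1
  exact mul_ne_zero (FractionalIdeal.coeIdeal_ne_zero.mpr I.2.1) J.ne_zero h1.symm

theorem abs_norm_classGen (J : (FractionalIdeal (𝓞 K)⁰ K)ˣ) (I : idealsInClass J) :
    |Algebra.norm ℚ (classGen J I)| = Ideal.absNorm I.1 * FractionalIdeal.absNorm J.1 := by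
  rw [← FractionalIdeal.absNorm_span_singleton (R := 𝓞 K), spanSingleton_classGen, map_mul,
    FractionalIdeal.coeIdeal_absNorm]

theorem unit_mul_classGen_mem (J : (FractionalIdeal (𝓞 K)⁰ K)ˣ) (I : idealsInClass J)
    (u : (𝓞 K)ˣ) : (u : K) * classGen J I ∈ J.1 := by
  have h1 : classGen J I ∈ (I.1 : FractionalIdeal (𝓞 K)⁰ K) * J.1 := by
    rw [← spanSingleton_classGen]
    exact FractionalIdeal.mem_spanSingleton_self _ _
  have h2 : classGen J I ∈ J.1 := by
    have : (I.1 : FractionalIdeal (𝓞 K)⁰ K) * J.1 ≤ 1 * J.1 :=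
      mul_le_mul_left FractionalIdeal.coeIdeal_le_one _
    rw [one_mul] at this
    exact this h1
  have := Submodule.smul_mem (J.1 : Submodule (𝓞 K) K) (u : 𝓞 K) h2
  rwa [Algebra.smul_def] at this

/-- Nonzero elements of a fractional ideal, parametrized by ideals and units. -/
theorem bijective_unit_mul_classGen (J : (FractionalIdeal (𝓞 K)⁰ K)ˣ) :
    Function.Bijective fun p : idealsInClass J × (𝓞 K)ˣ =>
      (⟨(p.2 : K) * classGen J p.1, unit_mul_classGen_mem J p.1 p.2, mul_ne_zero
        (by simp) (classGen_ne_zero J p.1)⟩ :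
        {x : K // x ∈ J.1 ∧ x ≠ 0}) := by
  have hsp : ∀ p : idealsInClass J × (𝓞 K)ˣ,
      FractionalIdeal.spanSingleton (𝓞 K)⁰ ((p.2 : K) * classGen J p.1) = p.1.1 * J.1 :=
    fun p => by
      rw [← spanSingleton_classGen]
      refine (FractionalIdeal.spanSingleton_eq_spanSingleton.mpr ⟨p.2, ?_⟩).symm
      rw [Units.smul_def, Algebra.smul_def]
  constructor
  · rintro ⟨I, u⟩ ⟨I', u'⟩ h
    have h0 : (u : K) * classGen J I = (u' : K) * classGen J I' := congrArg Subtype.val h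
    have h1 := (hsp ⟨I, u⟩).symm.trans ((congrArg _ h0).trans (hsp ⟨I', u'⟩))
    have h2 : I = I' := by
      have := mul_right_cancel₀ J.ne_zero h1
      exact Subtype.ext (FractionalIdeal.coeIdeal_injective this)
    subst h2
    have h3 := mul_right_cancel₀ (classGen_ne_zero J I) h0
    simp only [Prod.mk.injEq, true_and]
    ext
    exact h3
  · rintro ⟨x, hxJ, hx0⟩
    have h1 : FractionalIdeal.spanSingleton (𝓞 K)⁰ x * (J⁻¹).1 ≤ 1 := by
      have : FractionalIdeal.spanSingleton (𝓞 K)⁰ x ≤ J.1 :=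
        FractionalIdeal.spanSingleton_le_iff_mem.mpr hxJ
      calc _ ≤ J.1 * (J⁻¹).1 := mul_le_mul_left this _
        _ = 1 := J.mul_inv
    obtain ⟨I, hI⟩ := FractionalIdeal.le_one_iff_exists_coeIdeal.mp h1
    have h2 : FractionalIdeal.spanSingleton (𝓞 K)⁰ x = I * J.1 := by
      rw [hI, mul_assoc, Units.inv_mul, mul_one]
    have hI0 : I ≠ ⊥ := by
      rintro rfl
      simp only [FractionalIdeal.coeIdeal_bot, zero_mul] at h2
      exact hx0 (FractionalIdeal.spanSingleton_eq_zero_iff.mp h2)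
    let I' : idealsInClass J := ⟨I, hI0, x, h2⟩
    obtain ⟨u, hu⟩ := FractionalIdeal.spanSingleton_eq_spanSingleton.mp
      ((spanSingleton_classGen J I').trans h2.symm)
    refine ⟨(I', u), Subtype.ext ?_⟩
    exact (Algebra.smul_def _ _).symm.trans hu

theorem countable_ne_zero_mem (J : (FractionalIdeal (𝓞 K)⁰ K)ˣ) :
    Countable {x : K // x ∈ J.1 ∧ x ≠ 0} := by
  obtain ⟨c, e, -⟩ := exists_placeForm_lower_bound J
  have := e.symm.injective.countable
  exact Function.Injective.countable (f := fun x : {x : K // x ∈ J.1 ∧ x ≠ 0} =>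
    (⟨x.1, x.2.1⟩ : {x : K // x ∈ J.1})) fun x y h => Subtype.ext (Subtype.mk.inj h)

theorem countable_idealsInClass (J : (FractionalIdeal (𝓞 K)⁰ K)ˣ) :
    Countable (idealsInClass J) := by
  have := countable_ne_zero_mem J
  exact Function.Injective.countable (f := fun I => Equiv.ofBijective _
    (bijective_unit_mul_classGen J) (I, 1)) fun I I' h =>
      congrArg Prod.fst ((Equiv.ofBijective _ (bijective_unit_mul_classGen J)).injective h)

/-- The contribution of the nonzero elements to the theta function. -/
noncomputable def thetaTail (J : (FractionalIdeal (𝓞 K)⁰ K)ˣ) (y : InfinitePlace K → ℝ) : ℝ≥0∞ :=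
  ∑' x : {x : K // x ∈ J.1 ∧ x ≠ 0}, ENNReal.ofReal (Real.exp (-Real.pi * placeForm y (x : K)))

/-- The integral of `thetaTail` over a fundamental domain of the units. -/
noncomputable def thetaTailInt (J : (FractionalIdeal (𝓞 K)⁰ K)ˣ) (t : ℝ) : ℝ≥0∞ :=
  ∫⁻ z in unitDomain K, thetaTail J (placeCoord t z)

theorem measurable_placeForm (x : K) :
    Measurable fun y : InfinitePlace K → ℝ => placeForm y x := by
  unfold placeForm
  fun_prop

theorem measurable_thetaTerm (x : K) : Measurable fun p : ℝ × logSpace K =>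
    ENNReal.ofReal (Real.exp (-Real.pi * placeForm (placeCoord p.1 p.2) x)) :=
  (((measurable_placeForm x).comp measurable_placeCoord).const_mul _).exp.ennreal_ofReal

theorem measurable_thetaTerm_right (t : ℝ) (x : K) : Measurable fun z : logSpace K =>
    ENNReal.ofReal (Real.exp (-Real.pi * placeForm (placeCoord t z) x)) :=
  Measurable.comp (g := fun p : ℝ × logSpace K =>
    ENNReal.ofReal (Real.exp (-Real.pi * placeForm (placeCoord p.1 p.2) x)))
    (f := fun z => (t, z)) (measurable_thetaTerm x) measurable_prodMk_left

theorem thetaTailInt_eq (J : (FractionalIdeal (𝓞 K)⁰ K)ˣ) (t : ℝ) :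
    thetaTailInt J t = torsionOrder K * ∑' I : idealsInClass J, ∫⁻ z : logSpace K,
      ENNReal.ofReal (Real.exp (-Real.pi * placeForm (placeCoord t z) (classGen J I))) := by
  unfold thetaTailInt thetaTail
  have := countable_ne_zero_mem J
  rw [lintegral_tsum fun x : {x : K // x ∈ J.1 ∧ x ≠ 0} => (measurable_thetaTerm_right t x.1).aemeasurable]
  refine (Equiv.tsum_eq (Equiv.ofBijective _ (bijective_unit_mul_classGen J)) _).symm.trans ?_
  rw [ENNReal.tsum_prod', ← ENNReal.tsum_mul_left]
  refine tsum_congr fun I => ?_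
  rw [← tsum_units_lintegral (fun z : logSpace K =>
      ENNReal.ofReal (Real.exp (-Real.pi * placeForm (placeCoord t z) (classGen J I))))]
  refine tsum_congr fun u => ?_
  simp only [placeForm_placeCoord_add_logEmbedding, Equiv.ofBijective_apply]

theorem sum_mul_placeCoord_exp (s t : ℝ) (z : logSpace K) :
    Real.exp (finrank ℚ K * s * t) =
      Real.exp (s * ∑ w : InfinitePlace K, w.mult * placeCoord t z w) := by
  rw [sum_mult_placeCoord]
  ring_nf

theorem exists_lintegral_thetaTailInt (K : Type*) [Field K] [NumberField K] :
    ∃ C : ℝ≥0∞, C ≠ 0 ∧ C ≠ ∞ ∧ ∀ (J : (FractionalIdeal (𝓞 K)⁰ K)ˣ) (s : ℝ), 0 < s →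
      ∫⁻ t, ENNReal.ofReal (Real.exp (finrank ℚ K * s * t)) * thetaTailInt J t =
        C * ENNReal.ofReal (archFactor K s) * ∑' I : idealsInClass J, ENNReal.ofReal
          (((Ideal.absNorm I.1 : ℝ) * (FractionalIdeal.absNorm J.1 : ℚ)) ^ (-s)) := by
  obtain ⟨c, hc0, hc1, hc⟩ := exists_lintegral_placeCoord K
  refine ⟨torsionOrder K * c, ?_, ENNReal.mul_ne_top (by simp) hc1, fun J s hs => ?_⟩
  · exact mul_ne_zero (by exact_mod_cast (torsionOrder_pos K).ne') hc0
  have := countable_idealsInClass J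
  simp_rw [thetaTailInt_eq]
  have hm : ∀ I : idealsInClass J, Measurable fun t : ℝ => ENNReal.ofReal (Real.exp
      (finrank ℚ K * s * t)) * ∫⁻ z : logSpace K,
      ENNReal.ofReal (Real.exp (-Real.pi * placeForm (placeCoord t z) (classGen J I))) :=
    fun I => (by fun_prop : Measurable fun t : ℝ => ENNReal.ofReal (Real.exp
      (finrank ℚ K * s * t))).mul (measurable_thetaTerm (classGen J I)).lintegral_prod_right'
  simp_rw [mul_left_comm _ (torsionOrder K : ℝ≥0∞), ← ENNReal.tsum_mul_left]
  rw [lintegral_tsum fun I => ((hm I).const_mul _).aemeasurable]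
  refine tsum_congr fun I => ?_
  rw [lintegral_const_mul _ (hm I), mul_assoc, mul_assoc]
  congr 1
  have h1 : ∀ t : ℝ, ENNReal.ofReal (Real.exp (finrank ℚ K * s * t)) * ∫⁻ z : logSpace K,
      ENNReal.ofReal (Real.exp (-Real.pi * placeForm (placeCoord t z) (classGen J I))) =
      ∫⁻ z : logSpace K, (fun y : InfinitePlace K → ℝ => ENNReal.ofReal (Real.exp
        (s * ∑ w, w.mult * y w)) * ENNReal.ofReal (Real.exp (-Real.pi *
          placeForm y (classGen J I)))) (placeCoord t z) := fun t => by
    rw [← lintegral_const_mul' _ _ ENNReal.ofReal_ne_top]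
    refine lintegral_congr fun z => ?_
    rw [sum_mul_placeCoord_exp s t z]
  have h2 := hc (fun y : InfinitePlace K → ℝ => ENNReal.ofReal (Real.exp
      (s * ∑ w, w.mult * y w)) * ENNReal.ofReal (Real.exp (-Real.pi *
        placeForm y (classGen J I)))) <|
    (by fun_prop : Measurable fun y : InfinitePlace K → ℝ => ENNReal.ofReal (Real.exp
      (s * ∑ w, w.mult * y w))).mul ((measurable_placeForm _).const_mul _).exp.ennreal_ofReal
  refine (lintegral_congr h1).trans (h2.trans ?_)
  rw [lintegral_exp_placeForm hs (classGen_ne_zero J I), abs_norm_classGen]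
  push_cast
  rfl

end

end ExplicitFormula

namespace ExplicitFormula

open MeasureTheory Filter Topology
open NumberField NumberField.Units NumberField.Units.dirichletUnitTheorem nonZeroDivisors Module
open scoped ENNReal Classical

variable {K : Type*} [Field K] [NumberField K]

section

theorem ofReal_idealTheta (J : (FractionalIdeal (𝓞 K)⁰ K)ˣ) (y : InfinitePlace K → ℝ) :
    ENNReal.ofReal (idealTheta J.1 y) = 1 + thetaTail J y := by
  let f : K → ℝ≥0∞ := fun x => ENNReal.ofReal (Real.exp (-Real.pi * placeForm y x))
  have h1 : thetaTail J y = ∑' x, Set.indicator {x : K | x ∈ J.1 ∧ x ≠ 0} f x :=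
    tsum_subtype {x : K | x ∈ J.1 ∧ x ≠ 0} f
  rw [idealTheta, ENNReal.ofReal_tsum_of_nonneg (fun x => (Real.exp_pos _).le)
    (summable_idealTheta J y), h1]
  have h2 : ∑' x : {x : K // x ∈ J.1}, ENNReal.ofReal (Real.exp (-Real.pi * placeForm y x.1)) =
      ∑' x, Set.indicator {x : K | x ∈ J.1} f x := tsum_subtype {x : K | x ∈ J.1} f
  rw [h2]
  have h3 : ∀ x, Set.indicator {x : K | x ∈ J.1} f x = Set.indicator {0} f x +
      Set.indicator {x : K | x ∈ J.1 ∧ x ≠ 0} f x := fun x => by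
    by_cases hx : x = 0
    · subst hx
      simp [FractionalIdeal.zero_mem]
    · by_cases hJ : x ∈ J.1 <;> simp [hx, hJ]
  have hf0 : f 0 = 1 := by simp [f, placeForm]
  simp_rw [h3]
  rw [ENNReal.tsum_add, ← tsum_subtype {0} f, tsum_singleton, hf0]

theorem thetaTail_logEmbedding_add (J : (FractionalIdeal (𝓞 K)⁰ K)ˣ) (t : ℝ) (z : logSpace K)
    (u : (𝓞 K)ˣ) :
    thetaTail J (placeCoord t (logEmbedding K (Additive.ofMul u) + z)) =
      thetaTail J (placeCoord t z) := by
  unfold thetaTail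
  simp only [placeForm_placeCoord_add_logEmbedding]
  have hmem : ∀ (v : (𝓞 K)ˣ) (x : {x : K // x ∈ J.1 ∧ x ≠ 0}),
      (v : K) * x.1 ∈ J.1 ∧ (v : K) * x.1 ≠ 0 := fun v x => by
    refine ⟨?_, mul_ne_zero (by simp) x.2.2⟩
    have := Submodule.smul_mem (J.1 : Submodule (𝓞 K) K) (v : 𝓞 K) x.2.1
    rwa [Algebra.smul_def] at this
  let e : {x : K // x ∈ J.1 ∧ x ≠ 0} ≃ {x : K // x ∈ J.1 ∧ x ≠ 0} :=
    { toFun := fun x => ⟨(u : K) * x.1, hmem u x⟩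
      invFun := fun x => ⟨((u⁻¹ : (𝓞 K)ˣ) : K) * x.1, hmem u⁻¹ x⟩
      left_inv := fun x => Subtype.ext <| by
        simp only [← mul_assoc, ← map_mul, ← Units.val_mul, inv_mul_cancel]
        simp
      right_inv := fun x => Subtype.ext <| by
        simp only [← mul_assoc, ← map_mul, ← Units.val_mul, mul_inv_cancel]
        simp }
  exact e.tsum_eq fun x : {x : K // x ∈ J.1 ∧ x ≠ 0} =>
    ENNReal.ofReal (Real.exp (-Real.pi * placeForm (placeCoord t z) x.1))

theorem thetaTail_vadd (J : (FractionalIdeal (𝓞 K)⁰ K)ˣ) (t : ℝ) (g : unitLattice K)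
    (z : logSpace K) :
    thetaTail J (placeCoord t (g +ᵥ z)) = thetaTail J (placeCoord t z) := by
  obtain ⟨g, hg⟩ := g
  obtain ⟨u, -, rfl⟩ := hg
  exact thetaTail_logEmbedding_add J t z u.toMul

theorem isAddFundamentalDomain_neg_unitDomain :
    IsAddFundamentalDomain (unitLattice K) (Neg.neg ⁻¹' unitDomain K) volume := by
  have := isAddFundamentalDomain_unitDomain (K := K) |>.preimage_of_equiv (f := Neg.neg)
    (Measure.measurePreserving_neg volume).quasiMeasurePreserving
    (e := Neg.neg) (Equiv.neg (unitLattice K)).bijective fun g x => by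
      change -(-g +ᵥ x) = g +ᵥ -x
      simp only [Submodule.vadd_def, vadd_eq_add, NegMemClass.coe_neg]
      abel
  exact this

theorem measurable_thetaTail_placeCoord (J : (FractionalIdeal (𝓞 K)⁰ K)ˣ) (t : ℝ) :
    Measurable fun z : logSpace K => thetaTail J (placeCoord t z) := by
  have := countable_ne_zero_mem J
  exact Measurable.tsum fun x => measurable_thetaTerm_right t x.1

theorem thetaTailInt_eq_neg (J : (FractionalIdeal (𝓞 K)⁰ K)ˣ) (t : ℝ) :
    thetaTailInt J t = ∫⁻ z in unitDomain K, thetaTail J (placeCoord t (-z)) := by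
  have hn := Measure.measurePreserving_neg (volume : Measure (logSpace K))
  rw [thetaTailInt, isAddFundamentalDomain_unitDomain.setLIntegral_eq
    isAddFundamentalDomain_neg_unitDomain _ (thetaTail_vadd J t),
    ← hn.setLIntegral_comp_preimage (s := Neg.neg ⁻¹' unitDomain K)
      (hn.measurable measurableSet_unitDomain) (measurable_thetaTail_placeCoord J t)]
  congr 2
  ext z
  simp

theorem volume_add_thetaTailInt (J : (FractionalIdeal (𝓞 K)⁰ K)ˣ) (t : ℝ) :
    volume (unitDomain K) + thetaTailInt J t =
      ENNReal.ofReal ((sqrtDisc K * FractionalIdeal.absNorm J.1)⁻¹ *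
        Real.exp (-(finrank ℚ K * t))) *
      (volume (unitDomain K) + thetaTailInt (dualIdeal J) (-t)) := by
  have h1 : ∀ (J : (FractionalIdeal (𝓞 K)⁰ K)ˣ) (p : logSpace K → InfinitePlace K → ℝ),
      volume (unitDomain K) + ∫⁻ z in unitDomain K, thetaTail J (p z) =
        ∫⁻ z in unitDomain K, ENNReal.ofReal (idealTheta J.1 (p z)) := fun J p => by
    simp_rw [ofReal_idealTheta]
    rw [lintegral_add_left measurable_const, setLIntegral_const, one_mul]
  rw [thetaTailInt_eq_neg (dualIdeal J), h1, ← lintegral_const_mul' _ _ ENNReal.ofReal_ne_top,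
    thetaTailInt, h1]
  refine lintegral_congr fun z => ?_
  have hpos : (0 : ℝ) ≤ (sqrtDisc K * FractionalIdeal.absNorm J.1)⁻¹ :=
    inv_nonneg.mpr <| mul_nonneg (sqrtDisc_pos K).le <|
      Rat.cast_nonneg.mpr (FractionalIdeal.absNorm_nonneg J.1)
  rw [idealTheta_dual, sum_mult_placeCoord, ENNReal.ofReal_mul
    (mul_nonneg hpos (Real.exp_pos _).le), placeCoord_neg]

theorem placeForm_mono {y y' : InfinitePlace K → ℝ} (h : y ≤ y') (x : K) :
    placeForm y x ≤ placeForm y' x := by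
  refine Finset.sum_le_sum fun w _ => ?_
  have := h w
  gcongr

theorem placeForm_add_const (a : ℝ) (y : InfinitePlace K → ℝ) (x : K) :
    placeForm (fun w => a + y w) x = Real.exp (2 * a) * placeForm y x := by
  rw [placeForm, placeForm, Finset.mul_sum]
  refine Finset.sum_congr rfl fun w _ => ?_
  rw [mul_add, Real.exp_add]
  ring

theorem thetaTail_antitone (J : (FractionalIdeal (𝓞 K)⁰ K)ˣ) : Antitone (thetaTail J) := by
  intro y y' h
  refine ENNReal.tsum_le_tsum fun x => ENNReal.ofReal_le_ofReal (Real.exp_le_exp.mpr ?_)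
  have := placeForm_mono h x.1
  nlinarith [Real.pi_pos]

theorem placeCoord_mono_left (z : logSpace K) : Monotone fun t => placeCoord t z := by
  intro t t' h w
  have : placeCoord t' z w = placeCoord t z w + (t' - t) := by
    have := placeCoord_add_left t (t' - t) z w
    simpa using this
  simp only [this]
  linarith

theorem thetaTailInt_antitone (J : (FractionalIdeal (𝓞 K)⁰ K)ˣ) : Antitone (thetaTailInt J) :=
  fun _ _ h => lintegral_mono fun z => thetaTail_antitone J (placeCoord_mono_left z h)

theorem exists_placeCoord_lower_bound (K : Type*) [Field K] [NumberField K] :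
    ∃ B : ℝ, ∀ z ∈ unitDomain K, ∀ (t : ℝ) (w : InfinitePlace K), t + B ≤ placeCoord t z w := by
  obtain ⟨e, he⟩ := exists_placeCoord_equiv (K := K)
  obtain ⟨R, hR⟩ := (isBounded_unitDomain (K := K)).exists_norm_le
  refine ⟨-(‖(e : (ℝ × logSpace K) →L[ℝ] (InfinitePlace K → ℝ))‖ * R), fun z hz t w => ?_⟩
  have h1 := placeCoord_add_left 0 t z w
  have h2 : ‖placeCoord 0 z‖ ≤ ‖(e : (ℝ × logSpace K) →L[ℝ] (InfinitePlace K → ℝ))‖ * R := by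
    rw [← he (0, z)]
    refine ((e : (ℝ × logSpace K) →L[ℝ] (InfinitePlace K → ℝ)).le_opNorm (0, z)).trans ?_
    gcongr
    simpa [Prod.norm_def] using hR z hz
  have h3 := (norm_le_pi_norm (placeCoord 0 z) w).trans h2
  rw [zero_add] at h1
  rw [h1]
  linarith [neg_abs_le (placeCoord 0 z w), Real.norm_eq_abs (placeCoord 0 z w)]

theorem exists_thetaTail_le (J : (FractionalIdeal (𝓞 K)⁰ K)ˣ) :
    ∃ c : ℝ, 0 < c ∧ ∀ (t : ℝ), ∀ z ∈ unitDomain K, thetaTail J (placeCoord t z) ≤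
      ENNReal.ofReal (Real.exp (-c * Real.exp (2 * t))) *
        ∑' m : (K →+* ℂ) → ℤ, ENNReal.ofReal (Real.exp (-(c * Real.exp (2 * t)) *
          ‖intVec m‖ ^ 2)) := by
  obtain ⟨c, e, hc, he0, he⟩ := exists_placeForm_lower_bound J
  obtain ⟨B, hB⟩ := exists_placeCoord_lower_bound K
  set c' := Real.pi * (Real.exp (2 * B) * c) / 2 with hc'
  have hc'0 : 0 < c' := by positivity
  refine ⟨c', hc'0, fun t z hz => ?_⟩
  rw [← ENNReal.tsum_mul_left]
  let i : {x : K // x ∈ J.1 ∧ x ≠ 0} → ((K →+* ℂ) → ℤ) := fun x => e.symm ⟨x.1, x.2.1⟩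
  have hi : Function.Injective i := fun x y h =>
    Subtype.ext (Subtype.mk.inj (e.symm.injective h))
  refine le_trans (ENNReal.tsum_le_tsum fun x => ?_) (ENNReal.tsum_comp_le_tsum_of_injective hi _)
  rw [← ENNReal.ofReal_mul (Real.exp_pos _).le, ← Real.exp_add]
  refine ENNReal.ofReal_le_ofReal (Real.exp_le_exp.mpr ?_)
  have hix : (e (i x) : K) = x.1 := by simp [i]
  have h0 : i x ≠ 0 := fun h => x.2.2 (by rw [← hix, h, he0])
  have h1 := one_le_norm_intVec h0
  have h2 := he (i x)
  rw [hix] at h2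
  have h3 : placeForm (fun w => (t + B) + (0 : InfinitePlace K → ℝ) w) x.1 ≤
      placeForm (placeCoord t z) x.1 :=
    placeForm_mono (fun w => by simpa using hB z hz t w) x.1
  rw [placeForm_add_const, mul_add, Real.exp_add] at h3
  have h4 : Real.exp (2 * t) * Real.exp (2 * B) * (c * ‖intVec (i x)‖ ^ 2) ≤
      placeForm (placeCoord t z) x.1 := le_trans (by gcongr) h3
  have h5 : 1 ≤ ‖intVec (i x)‖ ^ 2 := one_le_pow₀ h1
  have h6 := mul_le_mul_of_nonneg_left h4 Real.pi_pos.le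
  have h7 : c' * Real.exp (2 * t) ≤ c' * Real.exp (2 * t) * ‖intVec (i x)‖ ^ 2 :=
    le_mul_of_one_le_right (by positivity) h5
  have h8 : Real.pi * (Real.exp (2 * t) * Real.exp (2 * B) * (c * ‖intVec (i x)‖ ^ 2)) =
      2 * (c' * Real.exp (2 * t) * ‖intVec (i x)‖ ^ 2) := by
    rw [hc']
    ring
  linarith

theorem exists_thetaTailInt_le (J : (FractionalIdeal (𝓞 K)⁰ K)ˣ) :
    ∃ c : ℝ, 0 < c ∧ ∀ (t : ℝ), thetaTailInt J t ≤
      ENNReal.ofReal (Real.exp (-c * Real.exp (2 * t))) *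
        (∑' m : (K →+* ℂ) → ℤ, ENNReal.ofReal (Real.exp (-(c * Real.exp (2 * t)) *
          ‖intVec m‖ ^ 2))) * volume (unitDomain K) := by
  obtain ⟨c, hc, h⟩ := exists_thetaTail_le J
  refine ⟨c, hc, fun t => ?_⟩
  rw [← setLIntegral_const]
  exact setLIntegral_mono measurable_const fun z hz => h t z hz

theorem tsum_ofReal_exp_lt_top {ι : Type*} [Fintype ι] {c : ℝ} (hc : 0 < c) :
    ∑' m : ι → ℤ, ENNReal.ofReal (Real.exp (-c * ‖intVec m‖ ^ 2)) < ∞ := by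
  rw [← ENNReal.ofReal_tsum_of_nonneg (fun m => (Real.exp_pos _).le)
    (summable_exp_neg_norm_intVec_sq hc)]
  exact ENNReal.ofReal_lt_top

theorem thetaTailInt_ne_top (J : (FractionalIdeal (𝓞 K)⁰ K)ˣ) (t : ℝ) :
    thetaTailInt J t ≠ ∞ := by
  obtain ⟨c, hc, h⟩ := exists_thetaTailInt_le J
  exact ((h t).trans_lt (ENNReal.mul_lt_top (ENNReal.mul_lt_top ENNReal.ofReal_lt_top
    (tsum_ofReal_exp_lt_top (by positivity))) volume_unitDomain_lt_top)).ne

theorem exists_toReal_thetaTailInt_le (J : (FractionalIdeal (𝓞 K)⁰ K)ˣ) :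
    ∃ c C : ℝ, 0 < c ∧ ∀ t : ℝ, 0 ≤ t →
      (thetaTailInt J t).toReal ≤ C * Real.exp (-c * Real.exp (2 * t)) := by
  obtain ⟨c, hc, h⟩ := exists_thetaTailInt_le J
  have hfin := tsum_ofReal_exp_lt_top (ι := K →+* ℂ) hc
  refine ⟨c, (∑' m : (K →+* ℂ) → ℤ, ENNReal.ofReal (Real.exp (-c * ‖intVec m‖ ^ 2))).toReal *
    (volume (unitDomain K)).toReal, hc, fun t ht => ?_⟩
  have h1 : thetaTailInt J t ≤ ENNReal.ofReal (Real.exp (-c * Real.exp (2 * t))) *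
      (∑' m : (K →+* ℂ) → ℤ, ENNReal.ofReal (Real.exp (-c * ‖intVec m‖ ^ 2))) *
        volume (unitDomain K) := by
    refine (h t).trans ?_
    gcongr with m
    have : 1 ≤ Real.exp (2 * t) := Real.one_le_exp (by linarith)
    nlinarith
  have h2 := ENNReal.toReal_mono (ENNReal.mul_lt_top (ENNReal.mul_lt_top ENNReal.ofReal_lt_top
    hfin) volume_unitDomain_lt_top).ne h1
  rw [ENNReal.toReal_mul, ENNReal.toReal_mul, ENNReal.toReal_ofReal (Real.exp_pos _).le] at h2
  linarith

end

end ExplicitFormula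

namespace ExplicitFormula

open MeasureTheory Filter Topology
open NumberField NumberField.Units NumberField.Units.dirichletUnitTheorem nonZeroDivisors Module
open scoped ENNReal Classical

variable {K : Type*} [Field K] [NumberField K]

section

variable (K) in
/-- The class group, as a quotient of the group of fractional ideals of `K`. -/
abbrev IdealClasses : Type _ := (FractionalIdeal (𝓞 K)⁰ K)ˣ ⧸ (toPrincipalIdeal (𝓞 K) K).range

noncomputable instance : Fintype (IdealClasses K) :=
  Fintype.ofEquiv _ (ClassGroup.equiv K).toEquiv

theorem mem_idealsInClass_iff {J : (FractionalIdeal (𝓞 K)⁰ K)ˣ} {I : Ideal (𝓞 K)} (hI : I ≠ ⊥) :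
    I ∈ idealsInClass J ↔ (QuotientGroup.mk (Units.mk0 (I : FractionalIdeal (𝓞 K)⁰ K)
      (FractionalIdeal.coeIdeal_ne_zero.mpr hI)) : IdealClasses K)⁻¹ = QuotientGroup.mk J := by
  rw [← QuotientGroup.mk_inv, QuotientGroup.eq, inv_inv, mem_principal_ideals_iff]
  simp only [idealsInClass, Set.mem_ofPred_eq, hI, ne_eq, not_false_eq_true, true_and,
    Units.val_mul, Units.val_mk0]

/-- A system of representatives of the ideal classes. -/
def IsClassReps (J : IdealClasses K → (FractionalIdeal (𝓞 K)⁰ K)ˣ) : Prop :=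
  Function.Bijective fun c => (QuotientGroup.mk (J c) : IdealClasses K)

theorem isClassReps_out : IsClassReps (Quotient.out : IdealClasses K → _) := by
  have : (fun c : IdealClasses K => (QuotientGroup.mk (Quotient.out c) : IdealClasses K)) = id := by
    ext c
    exact QuotientGroup.out_eq' c
  rw [IsClassReps, this]
  exact Function.bijective_id

theorem IsClassReps.dual {J : IdealClasses K → (FractionalIdeal (𝓞 K)⁰ K)ˣ} (hJ : IsClassReps J) :
    IsClassReps fun c => dualIdeal (J c) := by
  have h : ∀ J : (FractionalIdeal (𝓞 K)⁰ K)ˣ, dualIdeal J = dualIdeal 1 * J⁻¹ := fun J => by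
    ext1
    simp only [dualIdeal, Units.val_mk0, Units.val_mul, Units.val_inv_eq_inv_val, Units.val_one]
    exact FractionalIdeal.dual_eq_mul_inv ℤ ℚ (B := 𝓞 K) (L := K) (I := J.1)
  have h2 : (fun c => (QuotientGroup.mk (dualIdeal (J c)) : IdealClasses K)) =
      (fun x => (QuotientGroup.mk (dualIdeal 1) : IdealClasses K) * x⁻¹) ∘
        fun c => QuotientGroup.mk (J c) := by
    ext c
    simp only [Function.comp_apply, h (J c)]
    rfl
  rw [IsClassReps, h2]
  exact ((Group.mulLeft_bijective _).comp (inv_involutive.bijective)).comp hJ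

theorem IsClassReps.sum_tsum {J : IdealClasses K → (FractionalIdeal (𝓞 K)⁰ K)ˣ}
    (hJ : IsClassReps J) (g : Ideal (𝓞 K) → ℝ≥0∞) :
    ∑ c, ∑' I : idealsInClass (J c), g I = ∑' I : {I : Ideal (𝓞 K) // I ≠ ⊥}, g I := by
  have h1 : ∀ c, ∑' I : idealsInClass (J c), g I =
      ∑' I, Set.indicator (idealsInClass (J c)) g I := fun c => tsum_subtype _ g
  have h2 : ∑' I : {I : Ideal (𝓞 K) // I ≠ ⊥}, g I =
      ∑' I, Set.indicator {I : Ideal (𝓞 K) | I ≠ ⊥} g I :=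
    tsum_subtype {I : Ideal (𝓞 K) | I ≠ ⊥} g
  rw [h2]
  simp_rw [h1]
  rw [← tsum_fintype (L := .unconditional _), ENNReal.tsum_comm]
  refine tsum_congr fun I => ?_
  by_cases hI : I = ⊥
  · subst hI
    simp [idealsInClass]
  · obtain ⟨c, hc, huniq⟩ := hJ.existsUnique (QuotientGroup.mk
      (Units.mk0 (I : FractionalIdeal (𝓞 K)⁰ K)
        (FractionalIdeal.coeIdeal_ne_zero.mpr hI)) : IdealClasses K)⁻¹
    rw [tsum_eq_single c]
    · rw [Set.indicator_of_mem ((mem_idealsInClass_iff hI).mpr hc.symm),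
        Set.indicator_of_mem (show I ∈ {I : Ideal (𝓞 K) | I ≠ ⊥} from hI)]
    · intro c' hc'
      refine Set.indicator_of_notMem (fun h => hc' ?_) _
      exact huniq c' ((mem_idealsInClass_iff hI).mp h).symm

theorem absNorm_pos (J : (FractionalIdeal (𝓞 K)⁰ K)ˣ) :
    (0 : ℝ) < (FractionalIdeal.absNorm J.1 : ℚ) := by
  refine Rat.cast_pos.mpr (lt_of_le_of_ne (FractionalIdeal.absNorm_nonneg J.1) fun h => ?_)
  exact J.ne_zero (FractionalIdeal.absNorm_eq_zero_iff.mp h.symm)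

/-- The shift making the functional equation symmetric. -/
noncomputable def idealShift (J : (FractionalIdeal (𝓞 K)⁰ K)ˣ) : ℝ :=
  -Real.log (sqrtDisc K * FractionalIdeal.absNorm J.1) / finrank ℚ K

theorem finrank_pos_real : (0 : ℝ) < finrank ℚ K := by
  exact_mod_cast Module.finrank_pos

theorem exp_finrank_mul_idealShift (J : (FractionalIdeal (𝓞 K)⁰ K)ˣ) (s : ℝ) :
    Real.exp (-(finrank ℚ K * s * idealShift J)) =
      (sqrtDisc K * FractionalIdeal.absNorm J.1) ^ s := by
  rw [Real.rpow_def_of_pos (mul_pos (sqrtDisc_pos K) (absNorm_pos J)), idealShift]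
  have := (finrank_pos_real (K := K)).ne'
  congr 1
  field_simp

theorem idealShift_dualIdeal (J : (FractionalIdeal (𝓞 K)⁰ K)ˣ) :
    idealShift (dualIdeal J) = -idealShift J := by
  have h := absNorm_dualIdeal J
  rw [mul_comm] at h
  rw [idealShift, idealShift, eq_inv_of_mul_eq_one_left h, Real.log_inv]
  ring

/-- The theta integral attached to a fractional ideal. -/
noncomputable def heckeInt (J : (FractionalIdeal (𝓞 K)⁰ K)ˣ) (X : ℝ) : ℝ :=
  (volume (unitDomain K) + thetaTailInt J (Real.log X + idealShift J)).toReal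

theorem heckeInt_eq (J : (FractionalIdeal (𝓞 K)⁰ K)ˣ) (X : ℝ) :
    heckeInt J X = (volume (unitDomain K)).toReal +
      (thetaTailInt J (Real.log X + idealShift J)).toReal :=
  ENNReal.toReal_add volume_unitDomain_lt_top.ne (thetaTailInt_ne_top J _)

theorem heckeInt_inv (J : (FractionalIdeal (𝓞 K)⁰ K)ˣ) {X : ℝ} (hX : 0 < X) :
    heckeInt J (1 / X) = X ^ (finrank ℚ K : ℝ) * heckeInt (dualIdeal J) X := by
  have hpos := mul_pos (sqrtDisc_pos K) (absNorm_pos J)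
  rw [heckeInt, volume_add_thetaTailInt, ENNReal.toReal_mul, ENNReal.toReal_ofReal
    (mul_nonneg (inv_nonneg.mpr hpos.le) (Real.exp_pos _).le), heckeInt, idealShift_dualIdeal]
  congr 1
  · have h := exp_finrank_mul_idealShift J 1
    rw [Real.rpow_one, mul_one] at h
    rw [one_div, Real.log_inv, Real.rpow_def_of_pos hX,
      show -((finrank ℚ K : ℝ) * (-Real.log X + idealShift J)) =
        -(finrank ℚ K * idealShift J) + Real.log X * finrank ℚ K by ring, Real.exp_add, h,
      ← mul_assoc, inv_mul_cancel₀ hpos.ne', one_mul]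
  · rw [one_div, Real.log_inv]
    congr 3
    ring

theorem heckeInt_antitoneOn (J : (FractionalIdeal (𝓞 K)⁰ K)ˣ) :
    AntitoneOn (heckeInt J) (Set.Ioi 0) := by
  intro x hx y hy h
  rw [heckeInt_eq, heckeInt_eq]
  have := ENNReal.toReal_mono (thetaTailInt_ne_top J _) (thetaTailInt_antitone J
    (add_le_add_left (Real.log_le_log hx h) (idealShift J)))
  linarith

theorem heckeInt_isBigO (J : (FractionalIdeal (𝓞 K)⁰ K)ˣ) (r : ℝ) :
    (fun X => heckeInt J X - (volume (unitDomain K)).toReal) =O[atTop] fun X => X ^ r := by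
  obtain ⟨c, C, hc, h⟩ := exists_toReal_thetaTailInt_le J
  set c' := c * Real.exp (2 * idealShift J) with hc'
  obtain ⟨D, hD, hD'⟩ := exists_exp_neg_le_rpow (show 0 < c' by positivity) r
  refine Asymptotics.IsBigO.of_bound (|C| * D) ?_
  filter_upwards [eventually_ge_atTop 1, eventually_ge_atTop (Real.exp (-idealShift J))]
    with X hX1 hX2
  have hX0 : 0 < X := by linarith
  have ht : 0 ≤ Real.log X + idealShift J := by
    have := Real.log_le_log (Real.exp_pos _) hX2
    rw [Real.log_exp] at this
    linarith
  rw [heckeInt_eq, add_sub_cancel_left, Real.norm_of_nonneg ENNReal.toReal_nonneg,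
    Real.norm_of_nonneg (by positivity)]
  have h1 : -c * Real.exp (2 * (Real.log X + idealShift J)) ≤ -c' * X := by
    rw [show 2 * (Real.log X + idealShift J) = Real.log X + Real.log X + 2 * idealShift J by ring,
      Real.exp_add, Real.exp_add, Real.exp_log hX0, hc']
    have : X ≤ X * X := by nlinarith
    have h3 : 0 < c * Real.exp (2 * idealShift J) := by positivity
    nlinarith
  calc _ ≤ C * Real.exp (-c * Real.exp (2 * (Real.log X + idealShift J))) := h _ ht
    _ ≤ |C| * Real.exp (-c' * X) := by
      have := Real.exp_le_exp.mpr h1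
      gcongr
      exact le_abs_self C
    _ ≤ |C| * (D * X ^ r) := by
      gcongr
      exact hD' X hX1
    _ = _ := by ring

theorem sum_heckeInt_locallyIntegrableOn
    (J : IdealClasses K → (FractionalIdeal (𝓞 K)⁰ K)ˣ) :
    LocallyIntegrableOn (fun X => ((∑ c, heckeInt (J c) X : ℝ) : ℂ)) (Set.Ioi 0) := by
  rw [locallyIntegrableOn_iff isOpen_Ioi.isLocallyClosed]
  intro k hk hkc
  refine Integrable.ofReal (integrable_finsetSum _ fun c _ => ?_)
  exact ((heckeInt_antitoneOn (J c)).mono hk).integrableOn_isCompact hkc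

theorem sum_heckeInt_isBigO (J : IdealClasses K → (FractionalIdeal (𝓞 K)⁰ K)ˣ) (r : ℝ) :
    (fun X => ((∑ c, heckeInt (J c) X : ℝ) : ℂ) -
      ((∑ _c : IdealClasses K, (volume (unitDomain K)).toReal : ℝ) : ℂ)) =O[atTop]
      fun X => X ^ r := by
  refine Asymptotics.IsBigO.trans (Asymptotics.IsBigO.of_norm_eventuallyLE ?_)
    (Asymptotics.IsBigO.sum fun c (_ : c ∈ Finset.univ) => heckeInt_isBigO (J c) r)
  refine Eventually.of_forall fun X => le_of_eq ?_
  simp only [Finset.sum_apply]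
  rw [← Complex.ofReal_sub, Complex.norm_real, ← Finset.sum_sub_distrib]
  refine Real.norm_of_nonneg (Finset.sum_nonneg fun c _ => ?_)
  rw [heckeInt_eq, add_sub_cancel_left]
  exact ENNReal.toReal_nonneg

/-- The pair of theta functions whose Mellin transform is the completed zeta function. -/
noncomputable def heckePair (J : IdealClasses K → (FractionalIdeal (𝓞 K)⁰ K)ˣ) :
    WeakFEPair ℂ where
  f X := ((∑ c, heckeInt (J c) X : ℝ) : ℂ)
  g X := ((∑ c, heckeInt (dualIdeal (J c)) X : ℝ) : ℂ)
  k := finrank ℚ K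
  ε := 1
  f₀ := ((∑ _c : IdealClasses K, (volume (unitDomain K)).toReal : ℝ) : ℂ)
  g₀ := ((∑ _c : IdealClasses K, (volume (unitDomain K)).toReal : ℝ) : ℂ)
  hf_int := sum_heckeInt_locallyIntegrableOn J
  hg_int := sum_heckeInt_locallyIntegrableOn fun c => dualIdeal (J c)
  hk := finrank_pos_real
  hε := one_ne_zero
  h_feq x hx := by
    simp only [heckeInt_inv _ hx, ← Finset.mul_sum]
    push_cast
    simp
  hf_top r := sum_heckeInt_isBigO J r
  hg_top r := sum_heckeInt_isBigO (fun c => dualIdeal (J c)) r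

theorem measurable_thetaTailInt (J : (FractionalIdeal (𝓞 K)⁰ K)ˣ) :
    Measurable (thetaTailInt J) := (thetaTailInt_antitone J).measurable

theorem exists_lintegral_sum_thetaTailInt (K : Type*) [Field K] [NumberField K] :
    ∃ C : ℝ, 0 < C ∧ ∀ (J : IdealClasses K → (FractionalIdeal (𝓞 K)⁰ K)ˣ), IsClassReps J →
      ∀ s : ℝ, 0 < s →
      ∫⁻ t, ∑ c, ENNReal.ofReal (Real.exp (finrank ℚ K * s * t)) *
          thetaTailInt (J c) (t + idealShift (J c)) =
        ENNReal.ofReal (C * archFactor K s * sqrtDisc K ^ s) *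
          ∑' I : {I : Ideal (𝓞 K) // I ≠ ⊥}, ENNReal.ofReal ((Ideal.absNorm I.1 : ℝ) ^ (-s)) := by
  obtain ⟨C, hC0, hC1, hC⟩ := exists_lintegral_thetaTailInt K
  refine ⟨C.toReal, ENNReal.toReal_pos hC0 hC1, fun J hJ s hs => ?_⟩
  have hm : ∀ c, Measurable fun t => ENNReal.ofReal (Real.exp (finrank ℚ K * s * t)) *
      thetaTailInt (J c) (t + idealShift (J c)) := fun c =>
    (by fun_prop : Measurable fun t : ℝ => ENNReal.ofReal (Real.exp (finrank ℚ K * s * t))).mul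
      ((measurable_thetaTailInt _).comp (measurable_add_const _))
  rw [lintegral_finsetSum _ fun c _ => hm c, ← hJ.sum_tsum fun I =>
    ENNReal.ofReal ((Ideal.absNorm I : ℝ) ^ (-s)), Finset.mul_sum]
  refine Finset.sum_congr rfl fun c _ => ?_
  have h1 : ∀ t : ℝ, ENNReal.ofReal (Real.exp (finrank ℚ K * s * t)) *
      thetaTailInt (J c) (t + idealShift (J c)) =
      ENNReal.ofReal (Real.exp (-(finrank ℚ K * s * idealShift (J c)))) *
      (fun t => ENNReal.ofReal (Real.exp (finrank ℚ K * s * t)) * thetaTailInt (J c) t)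
        (t + idealShift (J c)) := fun t => by
    rw [← mul_assoc, ← ENNReal.ofReal_mul (Real.exp_pos _).le, ← Real.exp_add]
    ring_nf
  simp_rw [h1]
  rw [lintegral_const_mul' _ _ ENNReal.ofReal_ne_top, lintegral_add_right_eq_self
    (fun t => ENNReal.ofReal (Real.exp (finrank ℚ K * s * t)) * thetaTailInt (J c) t), hC _ s hs,
    exp_finrank_mul_idealShift, ← ENNReal.tsum_mul_left, ← ENNReal.tsum_mul_left,
    ← ENNReal.tsum_mul_left]
  refine tsum_congr fun I => ?_
  have hd := (sqrtDisc_pos K).le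
  have hJ0 := absNorm_pos (J c)
  have hA := (archFactor_pos (K := K) hs).le
  rw [← ENNReal.ofReal_toReal hC1, ENNReal.toReal_ofReal ENNReal.toReal_nonneg,
    ← ENNReal.ofReal_mul ENNReal.toReal_nonneg, ← ENNReal.ofReal_mul (by positivity),
    ← ENNReal.ofReal_mul (by positivity), ← ENNReal.ofReal_mul (by positivity)]
  congr 1
  rw [Real.mul_rpow hd hJ0.le, Real.mul_rpow (by positivity) hJ0.le, Real.rpow_neg hJ0.le]
  have := (Real.rpow_pos_of_pos hJ0 s).ne'
  field_simp

theorem exists_heckePair_Λ (K : Type*) [Field K] [NumberField K] :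
    ∃ C : ℝ, 0 < C ∧ ∀ (J : IdealClasses K → (FractionalIdeal (𝓞 K)⁰ K)ˣ), IsClassReps J →
      ∀ s : ℝ, 1 < s →
        (Summable fun I : {I : Ideal (𝓞 K) // I ≠ ⊥} => (Ideal.absNorm I.1 : ℝ) ^ (-s)) ∧
        (heckePair J).Λ (finrank ℚ K * s) = ((C * archFactor K s * sqrtDisc K ^ s *
          ∑' I : {I : Ideal (𝓞 K) // I ≠ ⊥}, (Ideal.absNorm I.1 : ℝ) ^ (-s) : ℝ) : ℂ) := by
  obtain ⟨C, hC0, hC⟩ := exists_lintegral_sum_thetaTailInt K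
  refine ⟨C, hC0, fun J hJ s hs => ?_⟩
  have hs0 : 0 < s := by linarith
  have hn := finrank_pos_real (K := K)
  have h1 : (heckePair J).k < ((finrank ℚ K * s : ℂ)).re := by
    have : ((finrank ℚ K * s : ℂ)).re = finrank ℚ K * s := by simp
    rw [this]
    change (finrank ℚ K : ℝ) < _
    nlinarith
  obtain ⟨h2, h3⟩ := (heckePair J).hasMellin h1
  let G : ℝ → ℝ := fun t => ∑ c, Real.exp (finrank ℚ K * s * t) *
    (thetaTailInt (J c) (t + idealShift (J c))).toReal
  have hG : ∀ t : ℝ, Real.exp t • (((Real.exp t : ℝ) : ℂ) ^ ((finrank ℚ K * s : ℂ) - 1) •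
      ((heckePair J).f (Real.exp t) - (heckePair J).f₀)) = ((G t : ℝ) : ℂ) := fun t => by
    have e1 : (heckePair J).f (Real.exp t) - (heckePair J).f₀ = ((∑ c,
        (thetaTailInt (J c) (t + idealShift (J c))).toReal : ℝ) : ℂ) := by
      change ((∑ c, heckeInt (J c) (Real.exp t) : ℝ) : ℂ) -
        ((∑ _c : IdealClasses K, (volume (unitDomain K)).toReal : ℝ) : ℂ) = _
      rw [← Complex.ofReal_sub, ← Finset.sum_sub_distrib]
      simp only [heckeInt_eq, add_sub_cancel_left, Real.log_exp]
    have e2 : ((Real.exp t : ℝ) : ℂ) ^ ((finrank ℚ K * s : ℂ) - 1) =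
        ((Real.exp (t * (finrank ℚ K * s - 1)) : ℝ) : ℂ) := by
      rw [Real.exp_mul, Complex.ofReal_cpow (Real.exp_pos t).le]
      push_cast
      rfl
    rw [e1, e2, Complex.real_smul, smul_eq_mul, ← Complex.ofReal_mul, ← Complex.ofReal_mul,
      ← mul_assoc, ← Real.exp_add, Finset.mul_sum]
    congr 1
    refine Finset.sum_congr rfl fun c _ => ?_
    ring_nf
  have hG0 : ∀ t, 0 ≤ G t := fun t => Finset.sum_nonneg fun c _ =>
    mul_nonneg (Real.exp_pos _).le ENNReal.toReal_nonneg
  have h4 : Integrable G := by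
    have := (integrable_comp_exp _).mp h2
    simp only [hG] at this
    exact this.re
  have h5 : ∫⁻ t, ENNReal.ofReal (G t) = ENNReal.ofReal (C * archFactor K s * sqrtDisc K ^ s) *
      ∑' I : {I : Ideal (𝓞 K) // I ≠ ⊥}, ENNReal.ofReal ((Ideal.absNorm I.1 : ℝ) ^ (-s)) := by
    rw [← hC J hJ s hs0]
    refine lintegral_congr fun t => ?_
    rw [ENNReal.ofReal_sum_of_nonneg fun c _ =>
      mul_nonneg (Real.exp_pos _).le ENNReal.toReal_nonneg]
    refine Finset.sum_congr rfl fun c _ => ?_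
    rw [ENNReal.ofReal_mul (Real.exp_pos _).le, ENNReal.ofReal_toReal (thetaTailInt_ne_top _ _)]
  have hD : 0 < C * archFactor K s * sqrtDisc K ^ s :=
    mul_pos (mul_pos hC0 (archFactor_pos hs0)) (Real.rpow_pos_of_pos (sqrtDisc_pos K) s)
  have h6 : ∑' I : {I : Ideal (𝓞 K) // I ≠ ⊥},
      ENNReal.ofReal ((Ideal.absNorm I.1 : ℝ) ^ (-s)) ≠ ∞ := by
    intro h
    rw [h, ENNReal.mul_top (ENNReal.ofReal_pos.mpr hD).ne'] at h5
    exact (h4.lintegral_lt_top).ne h5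
  have h7 : Summable fun I : {I : Ideal (𝓞 K) // I ≠ ⊥} => (Ideal.absNorm I.1 : ℝ) ^ (-s) := by
    have := ENNReal.summable_toReal h6
    simpa only [ENNReal.toReal_ofReal (Real.rpow_nonneg (Nat.cast_nonneg _) _)] using this
  refine ⟨h7, ?_⟩
  rw [← h3, mellin, integral_comp_exp]
  simp only [hG]
  rw [integral_complex_ofReal, integral_eq_lintegral_of_nonneg_ae (ae_of_all _ hG0)
    h4.aestronglyMeasurable, h5, ENNReal.toReal_mul, ENNReal.toReal_ofReal hD.le,
    ENNReal.tsum_toReal_eq fun I => ENNReal.ofReal_ne_top]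
  simp only [ENNReal.toReal_ofReal (Real.rpow_nonneg (Nat.cast_nonneg _) _)]

end

end ExplicitFormula

namespace ExplicitFormula

open MeasureTheory Filter Topology
open NumberField NumberField.Units NumberField.Units.dirichletUnitTheorem nonZeroDivisors Module
open scoped ENNReal Classical

variable {K : Type*} [Field K] [NumberField K]

section

theorem eqOn_real_ray {f g : ℂ → ℂ} {U : Set ℂ} (hf : AnalyticOnNhd ℂ f U)
    (hg : AnalyticOnNhd ℂ g U) (hU : IsPreconnected U) {a : ℝ} (ha : (a : ℂ) ∈ U)
    (h : ∀ x : ℝ, a < x → f x = g x) : Set.EqOn f g U := by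
  refine hf.eqOn_of_preconnected_of_frequently_eq hg hU ha ?_
  have h1 : Tendsto (fun x : ℝ => (x : ℂ)) (𝓝[>] a) (𝓝[≠] (a : ℂ)) := by
    refine tendsto_nhdsWithin_of_tendsto_nhds_of_eventually_within _
      (Complex.continuous_ofReal.tendsto a |>.mono_left nhdsWithin_le_nhds) ?_
    filter_upwards [self_mem_nhdsWithin] with x hx
    exact fun h => (ne_of_gt hx) (Complex.ofReal_injective h)
  refine h1.frequently (Eventually.frequently ?_)
  filter_upwards [self_mem_nhdsWithin] with x hx using h x hx

theorem norm_Λ_le (J : IdealClasses K → (FractionalIdeal (𝓞 K)⁰ K)ˣ) {s : ℂ}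
    (hs : finrank ℚ K < s.re) :
    ‖(heckePair J).Λ s‖ ≤ ‖(heckePair J).Λ (s.re : ℂ)‖ := by
  obtain ⟨h1, h2⟩ := (heckePair J).hasMellin (s := s) hs
  obtain ⟨h3, h4⟩ := (heckePair J).hasMellin (s := (s.re : ℂ)) (by rwa [Complex.ofReal_re])
  rw [← h2, ← h4, mellin, mellin]
  have e : ∀ X, (heckePair J).f X - (heckePair J).f₀ =
      ((∑ c, (thetaTailInt (J c) (Real.log X + idealShift (J c))).toReal : ℝ) : ℂ) := fun X => by
    change ((∑ c, heckeInt (J c) X : ℝ) : ℂ) -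
      ((∑ _c : IdealClasses K, (volume (unitDomain K)).toReal : ℝ) : ℂ) = _
    rw [← Complex.ofReal_sub, ← Finset.sum_sub_distrib]
    simp only [heckeInt_eq, add_sub_cancel_left]
  have e2 : ∫ t : ℝ in Set.Ioi 0, (t : ℂ) ^ ((s.re : ℂ) - 1) •
      ((heckePair J).f t - (heckePair J).f₀) = ((∫ t : ℝ in Set.Ioi 0, t ^ (s.re - 1) *
        ∑ c, (thetaTailInt (J c) (Real.log t + idealShift (J c))).toReal : ℝ) : ℂ) := by
    rw [← integral_complex_ofReal]
    refine setIntegral_congr_fun measurableSet_Ioi fun t ht => ?_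
    simp only [e]
    rw [smul_eq_mul, Complex.ofReal_mul, Complex.ofReal_cpow (le_of_lt ht)]
    push_cast
    rfl
  rw [e2, Complex.norm_real]
  refine (norm_integral_le_integral_norm _).trans (le_trans (le_of_eq ?_) (le_abs_self _))
  refine setIntegral_congr_fun measurableSet_Ioi fun t ht => ?_
  simp only [e]
  rw [norm_smul, Complex.norm_cpow_eq_rpow_re_of_pos ht, Complex.norm_real, Real.norm_of_nonneg
    (Finset.sum_nonneg fun c _ => ENNReal.toReal_nonneg)]
  simp

theorem exists_norm_mellin_le {f : ℝ → ℂ} (a b : ℝ) (ha : MellinConvergent f a)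
    (hb : MellinConvergent f b) :
    ∃ C, ∀ s : ℂ, a ≤ s.re → s.re ≤ b → ‖mellin f s‖ ≤ C := by
  refine ⟨(∫ t in Set.Ioi (0 : ℝ), ‖(t : ℂ) ^ ((a : ℂ) - 1) • f t‖) +
    ∫ t in Set.Ioi (0 : ℝ), ‖(t : ℂ) ^ ((b : ℂ) - 1) • f t‖, fun s h1 h2 => ?_⟩
  rw [mellin, ← integral_add ha.norm hb.norm]
  refine norm_integral_le_of_norm_le (ha.norm.add hb.norm) ?_
  refine (ae_restrict_iff' measurableSet_Ioi).mpr (ae_of_all _ fun t (ht : 0 < t) => ?_)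
  simp only [norm_smul, Complex.norm_cpow_eq_rpow_re_of_pos ht, ← add_mul]
  refine mul_le_mul_of_nonneg_right ?_ (norm_nonneg _)
  simp only [Complex.sub_re, Complex.one_re, Complex.ofReal_re]
  rcases le_total t 1 with h | h
  · exact (Real.rpow_le_rpow_of_exponent_ge ht h (by linarith)).trans
      (le_add_of_nonneg_right (Real.rpow_nonneg ht.le _))
  · exact (Real.rpow_le_rpow_of_exponent_le h (by linarith)).trans
      (le_add_of_nonneg_left (Real.rpow_nonneg ht.le _))

theorem symm_Λ₀_heckePair {J : IdealClasses K → (FractionalIdeal (𝓞 K)⁰ K)ˣ}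
    (hJ : IsClassReps J) : (heckePair J).symm.Λ₀ = (heckePair J).Λ₀ := by
  obtain ⟨C, hC0, hC⟩ := exists_heckePair_Λ K
  have hn := finrank_pos_real (K := K)
  suffices h : Set.EqOn (heckePair J).symm.Λ₀ (heckePair J).Λ₀ Set.univ from
    funext fun s => h (Set.mem_univ s)
  refine eqOn_real_ray (a := finrank ℚ K) (fun z _ =>
    (heckePair J).symm.differentiable_Λ₀.analyticAt z)
    (fun z _ => (heckePair J).differentiable_Λ₀.analyticAt z)
    isPreconnected_univ (Set.mem_univ _) fun x hx => ?_
  rw [WeakFEPair.Λ₀_eq, WeakFEPair.Λ₀_eq]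
  have h1 : (heckePair J).symm.Λ x = (heckePair J).Λ x := by
    have h2 : (heckePair J).symm.Λ x = (heckePair fun c => dualIdeal (J c)).Λ x := by
      rw [← ((heckePair J).symm.hasMellin (s := (x : ℂ)) (by rwa [Complex.ofReal_re])).2,
        ← ((heckePair fun c => dualIdeal (J c)).hasMellin (s := (x : ℂ)) (by rwa [Complex.ofReal_re])).2]
      rfl
    have h3 : (x : ℂ) = finrank ℚ K * ((x / finrank ℚ K : ℝ) : ℂ) := by
      have : (finrank ℚ K : ℂ) ≠ 0 := by exact_mod_cast hn.ne'
      push_cast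
      field_simp
    have h4 : 1 < x / finrank ℚ K := by rwa [one_lt_div hn]
    rw [h2, h3, (hC J hJ _ h4).2, (hC _ hJ.dual _ h4).2]
  rw [h1]
  simp [WeakFEPair.symm, heckePair]

variable (K) in
/-- The completed zeta function of `K`, normalized to be entire. -/
noncomputable def xiFun (s : ℂ) : ℂ :=
  finrank ℚ K * (s * (s - 1)) * (heckePair (Quotient.out : IdealClasses K → _)).Λ₀
    (finrank ℚ K * s) + (heckePair (Quotient.out : IdealClasses K → _)).f₀

theorem differentiable_xiFun : Differentiable ℂ (xiFun K) := by
  have := (heckePair (Quotient.out : IdealClasses K → _)).differentiable_Λ₀.comp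
    (differentiable_id.const_mul (finrank ℚ K : ℂ))
  refine (Differentiable.mul (by fun_prop) this).add_const _

theorem xiFun_one_sub (s : ℂ) : xiFun K (1 - s) = xiFun K s := by
  have h := (heckePair (Quotient.out : IdealClasses K → _)).functional_equation₀ (finrank ℚ K * s)
  rw [symm_Λ₀_heckePair isClassReps_out] at h
  have h1 : ((heckePair (Quotient.out : IdealClasses K → _)).k : ℂ) - finrank ℚ K * s =
      finrank ℚ K * (1 - s) := by
    change ((finrank ℚ K : ℝ) : ℂ) - _ = _
    push_cast
    ring
  rw [h1] at h
  change _ = (1 : ℂ) • _ at h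
  rw [one_smul] at h
  rw [xiFun, xiFun, h]
  ring

theorem xiFun_one_ne_zero : xiFun K 1 ≠ 0 := by
  rw [xiFun]
  simp only [sub_self, mul_zero, zero_mul, zero_add]
  change ((∑ _c : IdealClasses K, (volume (unitDomain K)).toReal : ℝ) : ℂ) ≠ 0
  rw [Complex.ofReal_ne_zero]
  refine (Finset.sum_pos (fun c _ => ?_) ⟨1, Finset.mem_univ _⟩).ne'
  exact ENNReal.toReal_pos volume_unitDomain_ne_zero volume_unitDomain_lt_top.ne

theorem xiFun_eq {s : ℂ} (h0 : s ≠ 0) (h1 : s ≠ 1) :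
    xiFun K s = finrank ℚ K * (s * (s - 1)) *
      (heckePair (Quotient.out : IdealClasses K → _)).Λ (finrank ℚ K * s) := by
  rw [xiFun, WeakFEPair.Λ₀_eq]
  have hn : (finrank ℚ K : ℂ) ≠ 0 := by exact_mod_cast (finrank_pos_real (K := K)).ne'
  have h2 : s - 1 ≠ 0 := sub_ne_zero.mpr h1
  have h3 : 1 - s ≠ 0 := sub_ne_zero.mpr (Ne.symm h1)
  have e1 : (heckePair (Quotient.out : IdealClasses K → _)).g₀ =
    (heckePair (Quotient.out : IdealClasses K → _)).f₀ := rfl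
  have e2 : (heckePair (Quotient.out : IdealClasses K → _)).ε = 1 := rfl
  have e3 : ((heckePair (Quotient.out : IdealClasses K → _)).k : ℂ) = finrank ℚ K := by
    change ((finrank ℚ K : ℝ) : ℂ) = _
    simp
  rw [e1, e2, e3, smul_eq_mul, smul_eq_mul]
  have h4 : (finrank ℚ K : ℂ) - finrank ℚ K * s ≠ 0 := by
    rw [← mul_one_sub]
    exact mul_ne_zero hn h3
  rw [← mul_one_sub]
  field_simp
  ring

theorem exists_xiFun_mul_prod_inv_Gamma (K : Type*) [Field K] [NumberField K] :
    ∃ C : ℝ, 0 < C ∧ ∃ b : ℝ, ∀ Z : ℂ → ℂ, (∀ s : ℂ, s ≠ 1 → AnalyticAt ℂ Z s) →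
      (∀ s : ℂ, 1 < s.re →
        Z s = ∑' I : {I : Ideal (𝓞 K) // I ≠ ⊥}, (Ideal.absNorm I.1 : ℂ) ^ (-s)) →
      ∀ s : ℂ, s ≠ 1 → xiFun K s * ∏ w : InfinitePlace K, (Complex.Gamma (s * w.mult / 2))⁻¹ =
        C * Complex.exp (b * s) * (s * (s - 1)) * Z s := by
  obtain ⟨C, hC0, hC⟩ := exists_heckePair_Λ K
  have hn := finrank_pos_real (K := K)
  refine ⟨finrank ℚ K * C * ∏ _w : InfinitePlace K, (1 / 2 : ℝ), by positivity,
    Real.log (sqrtDisc K) + ∑ w : InfinitePlace K,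
      (-(w.mult : ℝ) / 2) * Real.log (Real.pi * w.mult), fun Z hZ hZval s hs => ?_⟩
  have hU : IsPreconnected ({1}ᶜ : Set ℂ) :=
    (isConnected_compl_singleton_of_one_lt_rank (by simp) 1).isPreconnected
  refine eqOn_real_ray (a := 2) (U := {1}ᶜ)
    (f := fun s => xiFun K s * ∏ w : InfinitePlace K, (Complex.Gamma (s * w.mult / 2))⁻¹)
    (g := fun s => ((finrank ℚ K * C * ∏ _w : InfinitePlace K, (1 / 2 : ℝ) : ℝ) : ℂ) *
      Complex.exp (((Real.log (sqrtDisc K) + ∑ w : InfinitePlace K,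
      (-(w.mult : ℝ) / 2) * Real.log (Real.pi * w.mult) : ℝ) : ℂ) * s) * (s * (s - 1)) * Z s)
    ?_ ?_ hU (by simp) (fun x hx => ?_) hs
  · refine fun z _ => Differentiable.analyticAt ?_ z
    refine differentiable_xiFun.mul ?_
    refine Differentiable.fun_finsetProd fun w _ => ?_
    exact Complex.differentiable_one_div_Gamma.comp
      ((differentiable_id.mul_const _).div_const _)
  · intro z hz
    have h1 : AnalyticAt ℂ (fun s : ℂ => ((finrank ℚ K * C * ∏ _w : InfinitePlace K,
        (1 / 2 : ℝ) : ℝ) : ℂ) * Complex.exp (((Real.log (sqrtDisc K) + ∑ w : InfinitePlace K,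
      (-(w.mult : ℝ) / 2) * Real.log (Real.pi * w.mult) : ℝ) : ℂ) * s) * (s * (s - 1))) z :=
      Differentiable.analyticAt (by fun_prop) z
    exact h1.mul (hZ z hz)
  · have hx1 : 1 < x := by linarith
    have hx0 : 0 < x := by linarith
    have hxc0 : (x : ℂ) ≠ 0 := by exact_mod_cast hx0.ne'
    have hxc1 : (x : ℂ) ≠ 1 := by exact_mod_cast hx1.ne'
    have e1 : Z x = ((∑' I : {I : Ideal (𝓞 K) // I ≠ ⊥}, (Ideal.absNorm I.1 : ℝ) ^ (-x) : ℝ) : ℂ)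
        := by
      rw [hZval x (by simpa using hx1), Complex.ofReal_tsum]
      refine tsum_congr fun I => ?_
      rw [Complex.ofReal_cpow (Nat.cast_nonneg _)]
      push_cast
      rfl
    have e2 : archFactor K x * sqrtDisc K ^ x * ∏ w : InfinitePlace K,
        (Real.Gamma (x * w.mult / 2))⁻¹ = (∏ _w : InfinitePlace K, (1 / 2 : ℝ)) *
        Real.exp ((Real.log (sqrtDisc K) + ∑ w : InfinitePlace K,
          (-(w.mult : ℝ) / 2) * Real.log (Real.pi * w.mult)) * x) := by
      rw [add_mul, Real.exp_add, Finset.sum_mul, Real.exp_sum,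
        ← Real.rpow_def_of_pos (sqrtDisc_pos K), archFactor, mul_right_comm,
        ← Finset.prod_mul_distrib, mul_left_comm, ← Finset.prod_mul_distrib, mul_comm]
      congr 1
      refine Finset.prod_congr rfl fun w _ => ?_
      have hw : (0 : ℝ) < w.mult := by exact_mod_cast w.mult_pos
      have := (Real.Gamma_pos_of_pos (show 0 < x * w.mult / 2 by positivity)).ne'
      rw [mul_assoc, mul_assoc, mul_inv_cancel₀ this, mul_one, mul_comm,
        Real.rpow_def_of_pos (by positivity)]
      ring_nf
    have e3 : ∏ w : InfinitePlace K, (Complex.Gamma ((x : ℂ) * w.mult / 2))⁻¹ =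
        ((∏ w : InfinitePlace K, (Real.Gamma (x * w.mult / 2))⁻¹ : ℝ) : ℂ) := by
      push_cast
      refine Finset.prod_congr rfl fun w _ => ?_
      rw [← Complex.Gamma_ofReal]
      push_cast
      rfl
    simp only [xiFun_eq hxc0 hxc1, (hC _ isClassReps_out x hx1).2, e1, e3]
    have e4 := congrArg (fun r : ℝ => (r : ℂ)) e2
    push_cast at e4 ⊢
    linear_combination (finrank ℚ K * C * (x * (x - 1)) *
      ∑' I : {I : Ideal (𝓞 K) // I ≠ ⊥}, (((Ideal.absNorm I.1 : ℝ) ^ (-x) : ℝ) : ℂ)) * e4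

theorem Gamma_le_exp {x : ℝ} (hx : 2 ≤ x) :
    Real.Gamma x ≤ Real.exp (2 * (1 + x) ^ (3 / 2 : ℝ)) := by
  have h1 : (2 : ℝ) ≤ ⌈x⌉₊ + 1 := by linarith [Nat.le_ceil x]
  have h2 : Real.Gamma x ≤ Real.Gamma (⌈x⌉₊ + 1) :=
    Real.Gamma_strictMonoOn_Ici.monotoneOn hx h1 (by linarith [Nat.le_ceil x])
  have h3 : (⌈x⌉₊ : ℝ) ≤ 1 + x := by linarith [Nat.ceil_lt_add_one (show 0 ≤ x by linarith)]
  have h4 : (1 : ℝ) ≤ 1 + x := by linarith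
  have h5 : (0 : ℝ) < 1 + x := by linarith
  refine h2.trans ?_
  rw [Real.Gamma_nat_eq_factorial]
  calc ((⌈x⌉₊.factorial : ℕ) : ℝ) ≤ (⌈x⌉₊ : ℝ) ^ ⌈x⌉₊ := by exact_mod_cast Nat.factorial_le_pow _
    _ ≤ (1 + x) ^ ⌈x⌉₊ := by gcongr
    _ = (1 + x) ^ (⌈x⌉₊ : ℝ) := (Real.rpow_natCast _ _).symm
    _ ≤ (1 + x) ^ (1 + x) := Real.rpow_le_rpow_of_exponent_le h4 h3
    _ = Real.exp (Real.log (1 + x) * (1 + x)) := Real.rpow_def_of_pos h5 _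
    _ ≤ _ := by
      have h6 := Real.log_le_rpow_div h5.le (show (0 : ℝ) < 1 / 2 by norm_num)
      have h7 : (1 + x) ^ (3 / 2 : ℝ) = (1 + x) ^ (1 / 2 : ℝ) * (1 + x) := by
        rw [← Real.rpow_add_one h5.ne']
        norm_num
      rw [h7]
      refine Real.exp_le_exp.mpr ?_
      rw [← mul_assoc]
      refine mul_le_mul_of_nonneg_right ?_ h5.le
      linarith

theorem le_exp_mul_of_one_le (a : ℝ) {T : ℝ} (hT : 1 ≤ T) : a ≤ Real.exp (|a| * T) := by
  have h1 : a ≤ |a| := le_abs_self a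
  have h2 := Real.add_one_le_exp (|a| * T)
  nlinarith [abs_nonneg a]

theorem archFactor_le {s : ℝ} (hs : 4 ≤ s) :
    archFactor K s ≤ Real.exp (2 * Fintype.card (InfinitePlace K) * (1 + s) ^ (3 / 2 : ℝ)) := by
  have h0 : Real.exp (2 * Fintype.card (InfinitePlace K) * (1 + s) ^ (3 / 2 : ℝ)) =
      ∏ _w : InfinitePlace K, Real.exp (2 * (1 + s) ^ (3 / 2 : ℝ)) := by
    rw [Finset.prod_const, ← Real.exp_nat_mul, Finset.card_univ]
    ring_nf
  rw [h0, archFactor]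
  refine Finset.prod_le_prod (fun w _ => ?_) fun w _ => ?_
  · have hw : (0 : ℝ) < w.mult := by exact_mod_cast w.mult_pos
    have := Real.Gamma_nonneg_of_nonneg (show 0 ≤ s * w.mult / 2 by positivity)
    positivity
  · have hw : (1 : ℝ) ≤ w.mult := by exact_mod_cast w.one_le_mult
    have hw2 : (w.mult : ℝ) ≤ 2 := by
      rw [InfinitePlace.mult]
      split_ifs <;> norm_num
    have h1 : (2 : ℝ) ≤ s * w.mult / 2 := by nlinarith
    have h2 : s * w.mult / 2 ≤ s := by nlinarith
    have h3 : (Real.pi * w.mult) ^ (-(s * w.mult) / 2) ≤ 1 := by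
      refine Real.rpow_le_one_of_one_le_of_nonpos ?_ (by linarith)
      nlinarith [Real.pi_gt_three]
    have h4 := (Real.Gamma_pos_of_pos (show 0 < s * w.mult / 2 by linarith)).le
    have h5 : 0 ≤ (Real.pi * w.mult) ^ (-(s * w.mult) / 2) := by positivity
    calc _ ≤ 1 * 1 * Real.Gamma (s * w.mult / 2) := by
          refine mul_le_mul_of_nonneg_right ?_ h4
          exact mul_le_mul h3 (by norm_num) (by norm_num) zero_le_one
      _ ≤ Real.exp (2 * (1 + s * w.mult / 2) ^ (3 / 2 : ℝ)) := by
          rw [one_mul, one_mul]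
          exact Gamma_le_exp h1
      _ ≤ _ := by gcongr

theorem exists_norm_xiFun_le_of_four_le_re (K : Type*) [Field K] [NumberField K] :
    ∃ C : ℝ, ∀ s : ℂ, 4 ≤ s.re → ‖xiFun K s‖ ≤ Real.exp (C * (1 + ‖s‖) ^ (3 / 2 : ℝ)) := by
  obtain ⟨C, hC0, hC⟩ := exists_heckePair_Λ K
  have hn := finrank_pos_real (K := K)
  let A : ℝ := ∑' I : {I : Ideal (𝓞 K) // I ≠ ⊥}, (Ideal.absNorm I.1 : ℝ) ^ (-(4 : ℝ))
  let L : ℝ := Real.log (sqrtDisc K)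
  let r : ℕ := Fintype.card (InfinitePlace K)
  refine ⟨|(finrank ℚ K : ℝ)| + 2 + |C| + 2 * r + |L| + |A|, fun s hs => ?_⟩
  have hσ : s.re ≤ ‖s‖ := Complex.re_le_norm s
  have hT1 : 1 + ‖s‖ ≤ (1 + ‖s‖) ^ (3 / 2 : ℝ) := by
    conv_lhs => rw [← Real.rpow_one (1 + ‖s‖)]
    exact Real.rpow_le_rpow_of_exponent_le (by linarith) (by norm_num)
  have hre : ((finrank ℚ K : ℂ) * s).re = finrank ℚ K * s.re := by simp
  have h0 : s ≠ 0 := by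
    rintro rfl
    norm_num at hs
  have h1 : s ≠ 1 := by
    rintro rfl
    norm_num at hs
  have h2 := norm_Λ_le (K := K) Quotient.out (s := finrank ℚ K * s) (by rw [hre]; nlinarith)
  rw [hre, Complex.ofReal_mul, Complex.ofReal_natCast] at h2
  obtain ⟨h3, h4⟩ := hC _ isClassReps_out s.re (by linarith)
  have h5 : ∑' I : {I : Ideal (𝓞 K) // I ≠ ⊥}, (Ideal.absNorm I.1 : ℝ) ^ (-s.re) ≤ A := by
    refine h3.tsum_le_tsum (fun I => ?_) (hC _ isClassReps_out 4 (by norm_num)).1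
    refine Real.rpow_le_rpow_of_exponent_le ?_ (by linarith)
    exact_mod_cast Nat.one_le_iff_ne_zero.mpr (mt Ideal.absNorm_eq_zero_iff.mp I.2)
  have h6 : 0 ≤ ∑' I : {I : Ideal (𝓞 K) // I ≠ ⊥}, (Ideal.absNorm I.1 : ℝ) ^ (-s.re) :=
    tsum_nonneg fun I => by positivity
  have hA := (archFactor_pos (K := K) (show 0 < s.re by linarith)).le
  have hD : sqrtDisc K ^ s.re ≤ Real.exp (|L| * (1 + ‖s‖) ^ (3 / 2 : ℝ)) := by
    rw [Real.rpow_def_of_pos (sqrtDisc_pos K)]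
    refine Real.exp_le_exp.mpr ?_
    calc _ ≤ |L| * s.re := mul_le_mul_of_nonneg_right (le_abs_self _) (by linarith)
      _ ≤ _ := by
        have : s.re ≤ (1 + ‖s‖) ^ (3 / 2 : ℝ) := by linarith
        gcongr
  have hD0 := (Real.rpow_pos_of_pos (sqrtDisc_pos K) s.re).le
  generalize hT : (1 + ‖s‖) ^ (3 / 2 : ℝ) = T at *
  have hT0 : 1 ≤ T := by linarith [norm_nonneg s]
  have h7 : archFactor K s.re ≤ Real.exp (2 * r * T) := by
    refine (archFactor_le hs).trans (Real.exp_le_exp.mpr ?_)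
    rw [← hT]
    gcongr
  rw [xiFun_eq h0 h1, norm_mul]
  have h8 : ‖(finrank ℚ K * (s * (s - 1)) : ℂ)‖ ≤ Real.exp (|(finrank ℚ K : ℝ)| * T) *
      Real.exp (2 * T) := by
    rw [norm_mul, norm_mul, Complex.norm_natCast]
    refine mul_le_mul (le_exp_mul_of_one_le _ hT0) ?_ (by positivity) (Real.exp_pos _).le
    have h9 : ‖s‖ ≤ Real.exp T := by linarith [Real.add_one_le_exp T, norm_nonneg s]
    have h10 : ‖s - 1‖ ≤ Real.exp T := by
      have := norm_sub_le s 1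
      rw [norm_one] at this
      linarith [Real.add_one_le_exp T, norm_nonneg s]
    rw [two_mul, Real.exp_add]
    exact mul_le_mul h9 h10 (norm_nonneg _) (Real.exp_pos _).le
  have h11 : ‖(heckePair (Quotient.out : IdealClasses K → _)).Λ (finrank ℚ K * s)‖ ≤
      Real.exp (|C| * T) * Real.exp (2 * r * T) * Real.exp (|L| * T) * Real.exp (|A| * T) := by
    refine h2.trans ?_
    rw [h4, Complex.norm_real, Real.norm_of_nonneg (by positivity)]
    refine mul_le_mul (mul_le_mul (mul_le_mul (le_exp_mul_of_one_le _ hT0) h7 hA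
      (Real.exp_pos _).le) hD hD0 (by positivity)) (h5.trans (le_exp_mul_of_one_le _ hT0)) h6
      (by positivity)
  refine (mul_le_mul h8 h11 (norm_nonneg _) (by positivity)).trans (le_of_eq ?_)
  simp only [← Real.exp_add]
  ring_nf

theorem exists_norm_xiFun_le_of_abs_re_le (K : Type*) [Field K] [NumberField K] :
    ∃ C : ℝ, ∀ s : ℂ, -4 ≤ s.re → s.re ≤ 4 →
      ‖xiFun K s‖ ≤ Real.exp (C * (1 + ‖s‖) ^ (3 / 2 : ℝ)) := by
  let P := heckePair (Quotient.out : IdealClasses K → _)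
  obtain ⟨M, hM⟩ := exists_norm_mellin_le (f := P.f_modif) ((finrank ℚ K * (-4) : ℝ))
    ((finrank ℚ K * 4 : ℝ)) (P.isStrongFEPair_toStrongFEPair.hasMellin _).1
    (P.isStrongFEPair_toStrongFEPair.hasMellin _).1
  refine ⟨|finrank ℚ K * |M| + ‖P.f₀‖| + 2, fun s h1 h2 => ?_⟩
  have hT1 : 1 + ‖s‖ ≤ (1 + ‖s‖) ^ (3 / 2 : ℝ) := by
    conv_lhs => rw [← Real.rpow_one (1 + ‖s‖)]
    exact Real.rpow_le_rpow_of_exponent_le (by linarith [norm_nonneg s]) (by norm_num)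
  generalize (1 + ‖s‖) ^ (3 / 2 : ℝ) = T at *
  have hT0 : 1 ≤ T := by linarith [norm_nonneg s]
  have hre : ((finrank ℚ K : ℂ) * s).re = finrank ℚ K * s.re := by simp
  have h3 : ‖P.Λ₀ (finrank ℚ K * s)‖ ≤ |M| := by
    refine (hM _ ?_ ?_).trans (le_abs_self _) <;> rw [hre] <;> gcongr
  have h8 : ‖s * (s - 1)‖ ≤ Real.exp (2 * T) := by
    rw [norm_mul]
    have h9 : ‖s‖ ≤ Real.exp T := by linarith [Real.add_one_le_exp T, norm_nonneg s]
    have h10 : ‖s - 1‖ ≤ Real.exp T := by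
      have := norm_sub_le s 1
      rw [norm_one] at this
      linarith [Real.add_one_le_exp T, norm_nonneg s]
    rw [two_mul, Real.exp_add]
    exact mul_le_mul h9 h10 (norm_nonneg _) (Real.exp_pos _).le
  have h12 : (1 : ℝ) ≤ Real.exp (2 * T) := Real.one_le_exp (by linarith)
  calc ‖xiFun K s‖ ≤ ‖finrank ℚ K * (s * (s - 1)) * P.Λ₀ (finrank ℚ K * s)‖ + ‖P.f₀‖ :=
        norm_add_le _ _
    _ ≤ finrank ℚ K * Real.exp (2 * T) * |M| + Real.exp (2 * T) * ‖P.f₀‖ := by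
      rw [norm_mul, norm_mul, Complex.norm_natCast]
      refine add_le_add (by gcongr) (le_mul_of_one_le_left (norm_nonneg _) h12)
    _ = (finrank ℚ K * |M| + ‖P.f₀‖) * Real.exp (2 * T) := by ring
    _ ≤ Real.exp (|finrank ℚ K * |M| + ‖P.f₀‖| * T) * Real.exp (2 * T) := by
      gcongr
      exact le_exp_mul_of_one_le _ hT0
    _ = _ := by rw [← Real.exp_add, add_mul]

theorem exists_norm_xiFun_le (K : Type*) [Field K] [NumberField K] :
    ∃ C : ℝ, ∀ s : ℂ, ‖xiFun K s‖ ≤ Real.exp (C * (1 + ‖s‖) ^ (3 / 2 : ℝ)) := by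
  obtain ⟨C₁, h₁⟩ := exists_norm_xiFun_le_of_four_le_re K
  obtain ⟨C₂, h₂⟩ := exists_norm_xiFun_le_of_abs_re_le K
  refine ⟨4 * |C₁| + |C₂|, fun s => ?_⟩
  have hT0 : 0 ≤ (1 + ‖s‖) ^ (3 / 2 : ℝ) := by positivity
  rcases le_or_gt 4 s.re with h | h
  · refine (h₁ s h).trans (Real.exp_le_exp.mpr (mul_le_mul_of_nonneg_right ?_ hT0))
    linarith [le_abs_self C₁, abs_nonneg C₁, abs_nonneg C₂]
  rcases le_or_gt (-4) s.re with h' | h'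
  · refine (h₂ s h' h.le).trans (Real.exp_le_exp.mpr (mul_le_mul_of_nonneg_right ?_ hT0))
    linarith [le_abs_self C₂, abs_nonneg C₁]
  · rw [← xiFun_one_sub]
    refine (h₁ (1 - s) (by rw [Complex.sub_re, Complex.one_re]; linarith)).trans
      (Real.exp_le_exp.mpr ?_)
    have h3 : 1 + ‖1 - s‖ ≤ 2 * (1 + ‖s‖) := by
      have := norm_sub_le 1 s
      rw [norm_one] at this
      linarith [norm_nonneg s]
    have h4 : (1 + ‖1 - s‖) ^ (3 / 2 : ℝ) ≤ 4 * (1 + ‖s‖) ^ (3 / 2 : ℝ) := by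
      refine (Real.rpow_le_rpow (by positivity) h3 (by norm_num)).trans ?_
      rw [Real.mul_rpow (by norm_num) (by positivity)]
      refine mul_le_mul_of_nonneg_right ?_ hT0
      calc (2 : ℝ) ^ (3 / 2 : ℝ) ≤ 2 ^ (2 : ℝ) :=
            Real.rpow_le_rpow_of_exponent_le (by norm_num) (by norm_num)
        _ = 4 := by norm_num
    calc C₁ * (1 + ‖1 - s‖) ^ (3 / 2 : ℝ) ≤ |C₁| * (4 * (1 + ‖s‖) ^ (3 / 2 : ℝ)) :=
          mul_le_mul (le_abs_self _) h4 (by positivity) (abs_nonneg _)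
      _ ≤ _ := by nlinarith [abs_nonneg C₂]

end

end ExplicitFormula

namespace ExplicitFormula

open MeasureTheory Filter Topology

section

theorem norm_deriv_logDeriv_le {g : ℂ → ℂ} {R M : ℝ} (hR : 0 < R) (hM : 0 < M)
    (hg : DifferentiableOn ℂ g (Metric.ball 0 R)) (hg0 : ∀ z ∈ Metric.ball (0 : ℂ) R, g z ≠ 0)
    (hgM : ∀ z ∈ Metric.ball (0 : ℂ) R, ‖g z‖ ≤ ‖g 0‖ * Real.exp M) {z : ℂ} (hz : ‖z‖ ≤ R / 8) :
    ‖deriv (logDeriv g) z‖ ≤ 64 * M / R ^ 2 := by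
  have hO : IsOpen (Metric.ball (0 : ℂ) R) := Metric.isOpen_ball
  have h0 : (0 : ℂ) ∈ Metric.ball (0 : ℂ) R := Metric.mem_ball_self hR
  obtain ⟨F, hF⟩ := ((hg.deriv hO).div hg hg0).isExactOn_ball
  let h : ℂ → ℂ := fun w => F w - F 0
  have hh : ∀ w ∈ Metric.ball (0 : ℂ) R, HasDerivAt h (logDeriv g w) w := fun w hw =>
    (hF w hw).sub_const _
  have hconst : ∀ w ∈ Metric.ball (0 : ℂ) R, g w * Complex.exp (-h w) = g 0 := fun w hw => by
    have h1 : ∀ w ∈ Metric.ball (0 : ℂ) R,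
        HasDerivAt (fun w => g w * Complex.exp (-h w)) 0 w := fun w hw => by
      convert! ((hg.differentiableAt (hO.mem_nhds hw)).hasDerivAt).mul (hh w hw).neg.cexp using 1
      rw [logDeriv_apply]
      field_simp [hg0 w hw]
      ring
    have h2 := (convex_ball (0 : ℂ) R).is_const_of_fderivWithin_eq_zero
      (f := fun w => g w * Complex.exp (-h w)) (𝕜 := ℂ)
      (fun w hw => (h1 w hw).differentiableAt.differentiableWithinAt)
      (fun w hw => by
        rw [fderivWithin_of_isOpen hO hw, (h1 w hw).hasFDerivAt.fderiv]
        ext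
        simp) hw h0
    simpa [h] using h2
  have hre : ∀ w ∈ Metric.ball (0 : ℂ) R, (h w).re ≤ M := fun w hw => by
    have h1 : g w = g 0 * Complex.exp (h w) := by
      rw [← hconst w hw, mul_assoc, ← Complex.exp_add, neg_add_cancel, Complex.exp_zero, mul_one]
    have h2 := hgM w hw
    rw [h1, norm_mul, Complex.norm_exp] at h2
    exact Real.exp_le_exp.mp (le_of_mul_le_mul_left h2 (norm_pos_iff.mpr (hg0 0 h0)))
  have hhd : DifferentiableOn ℂ h (Metric.ball 0 R) := fun w hw =>
    (hh w hw).differentiableAt.differentiableWithinAt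
  have hbound : ∀ w ∈ Metric.sphere z (R / 4), ‖h w‖ ≤ 2 * M := fun w hw => by
    have h1 : ‖w‖ ≤ R / 2 := by
      have := norm_le_norm_add_norm_sub' w z
      rw [mem_sphere_iff_norm] at hw
      linarith
    have h2 := Complex.borelCaratheodory_zero hM hhd (fun w hw => hre w hw) hR
      (z := w) (by rw [mem_ball_zero_iff]; linarith) (by simp [h])
    refine h2.trans ?_
    rw [div_le_iff₀ (by linarith)]
    nlinarith
  have hsub : Metric.closedBall z (R / 4) ⊆ Metric.ball 0 R := fun w hw => by
    have := norm_le_norm_add_norm_sub' w z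
    rw [mem_closedBall_iff_norm] at hw
    rw [mem_ball_zero_iff]
    linarith
  have hcauchy := Complex.norm_iteratedDeriv_le_of_forall_mem_sphere_norm_le (c := z) 2
    (by linarith : 0 < R / 4) (hhd.mono hsub |>.diffContOnCl_ball (U := Metric.closedBall z (R / 4))
      subset_rfl) hbound
  have e : iteratedDeriv 2 h z = deriv (logDeriv g) z := by
    rw [iteratedDeriv_succ, iteratedDeriv_one]
    refine Filter.EventuallyEq.deriv_eq ?_
    filter_upwards [hO.mem_nhds (hsub (Metric.mem_closedBall_self (by linarith)))] with w hw
    exact (hh w hw).deriv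
  rw [e] at hcauchy
  refine hcauchy.trans (le_of_eq ?_)
  rw [Nat.factorial_two]
  field_simp
  norm_num

theorem exists_eq_prod_mul {f : ℂ → ℂ} (hf : Differentiable ℂ f) {z₀ : ℂ} (hf0 : f z₀ ≠ 0)
    (S : Finset ℂ) :
    ∃ g : ℂ → ℂ, Differentiable ℂ g ∧
      (∀ z, f z = (∏ ρ ∈ S, (z - ρ) ^ analyticOrderNatAt f ρ) * g z) ∧ ∀ ρ ∈ S, g ρ ≠ 0 := by
  classical
  induction S using Finset.induction_on with
  | empty => exact ⟨f, hf, fun z => by simp, by simp⟩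
  | insert a S ha ih =>
    obtain ⟨g, hg, hfg, hgS⟩ := ih
    have hord : analyticOrderAt f a ≠ ⊤ := by
      intro h
      have h1 := (AnalyticOnNhd.eq_of_eventuallyEq (f := f) (g := 0)
        (fun z _ => hf.analyticAt z) (fun z _ => analyticAt_const)
        (analyticOrderAt_eq_top.mp h))
      exact hf0 (congrFun h1 z₀)
    obtain ⟨u, hu, hu0, hfu⟩ := (hf.analyticAt a).analyticOrderAt_ne_top.mp hord
    let P : ℂ → ℂ := fun z => ∏ ρ ∈ S, (z - ρ) ^ analyticOrderNatAt f ρ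
    have hP : Differentiable ℂ P := Differentiable.fun_finsetProd fun ρ _ => by fun_prop
    have hPa : P a ≠ 0 := Finset.prod_ne_zero_iff.mpr fun ρ hρ => pow_ne_zero _
      (sub_ne_zero.mpr fun h => ha (h ▸ hρ))
    let m := analyticOrderNatAt f a
    let g' : ℂ → ℂ := Function.update (fun z => g z / (z - a) ^ m) a (u a / P a)
    have hg'a : g' a = u a / P a := Function.update_self ..
    have hg'z : ∀ z, z ≠ a → g' z = g z / (z - a) ^ m := fun z hz => Function.update_of_ne hz ..
    have hmul : ∀ z, z ≠ a → g z = (z - a) ^ m * g' z := fun z hz => by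
      rw [hg'z z hz, mul_div_cancel₀ _ (pow_ne_zero _ (sub_ne_zero.mpr hz))]
    have hloc : g' =ᶠ[𝓝 a] fun z => u z / P z := by
      filter_upwards [hfu, hP.continuous.continuousAt.eventually_ne hPa] with z hz hPz
      rcases eq_or_ne z a with rfl | hza
      · exact hg'a
      · rw [hg'z z hza]
        have h1 := pow_ne_zero m (sub_ne_zero.mpr hza)
        have h2 : P z * g z = (z - a) ^ m • u z := (hfg z).symm.trans hz
        rw [smul_eq_mul] at h2
        rw [div_eq_div_iff h1 hPz]
        linear_combination h2
    have hg' : Differentiable ℂ g' := fun z => by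
      rcases eq_or_ne z a with rfl | hza
      · exact (hu.differentiableAt.fun_div (hP z) hPa).congr_of_eventuallyEq hloc
      · refine DifferentiableAt.congr_of_eventuallyEq (f := fun z => g z / (z - a) ^ m) ?_ ?_
        · exact (hg z).fun_div (by fun_prop) (pow_ne_zero _ (sub_ne_zero.mpr hza))
        · filter_upwards [isOpen_ne.mem_nhds hza] with w hw using hg'z w hw
    refine ⟨g', hg', ?_, ?_⟩
    · have hc : f = fun z => (∏ ρ ∈ insert a S, (z - ρ) ^ analyticOrderNatAt f ρ) * g' z := by
        refine Continuous.ext_on (dense_compl_singleton a) hf.continuous ?_ fun z hz => ?_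
        · have : Differentiable ℂ fun z => ∏ ρ ∈ insert a S, (z - ρ) ^ analyticOrderNatAt f ρ :=
            Differentiable.fun_finsetProd fun ρ _ => by fun_prop
          exact this.continuous.mul hg'.continuous
        · simp only [Finset.prod_insert ha]
          rw [hfg z, hmul z hz]
          ring
      exact fun z => congrFun hc z
    · intro ρ hρ
      rcases Finset.mem_insert.mp hρ with rfl | hρ
      · rw [hg'a]
        exact div_ne_zero hu0 hPa
      · have hne : ρ ≠ a := fun h => ha (h ▸ hρ)
        rw [hg'z ρ hne]
        exact div_ne_zero (hgS ρ hρ) (pow_ne_zero _ (sub_ne_zero.mpr hne))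

theorem finite_zeros_closedBall {f : ℂ → ℂ} (hf : Differentiable ℂ f) {z₀ : ℂ} (hf0 : f z₀ ≠ 0)
    (R : ℝ) : {ρ : ℂ | f ρ = 0 ∧ ‖ρ‖ ≤ R}.Finite := by
  have h1 := (AnalyticOnNhd.preimage_zero_mem_codiscrete (x := z₀)
    (fun z _ => hf.analyticAt z : AnalyticOnNhd ℂ f Set.univ) hf0)
  rw [mem_codiscrete', ← Set.preimage_compl, compl_compl] at h1
  have hc : IsCompact {ρ : ℂ | f ρ = 0 ∧ ‖ρ‖ ≤ R} := by
    have h2 : {ρ : ℂ | f ρ = 0 ∧ ‖ρ‖ ≤ R} = Metric.closedBall 0 R ∩ f ⁻¹' {0} := by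
      ext
      simp [and_comm]
    rw [h2]
    exact (isCompact_closedBall 0 R).inter_right (isClosed_singleton.preimage hf.continuous)
  exact hc.finite (h1.2.mono fun ρ hρ => hρ.1)

theorem norm_quotient_le {f g : ℂ → ℂ} (hg : Differentiable ℂ g) {S : Finset ℂ} {m : ℂ → ℕ}
    (hfg : ∀ z, f z = (∏ ρ ∈ S, (z - ρ) ^ m ρ) * g z) (hf0 : f 0 ≠ 0) {R B : ℝ} (hR : 0 < R)
    (hS : ∀ ρ ∈ S, ‖ρ‖ ≤ R) (hB : ∀ z, ‖z‖ = 3 * R → ‖f z‖ ≤ B) {z : ℂ} (hz : ‖z‖ ≤ 3 * R) :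
    ‖g z‖ ≤ ‖g 0‖ * (B / ‖f 0‖) := by
  have hb : Bornology.IsBounded (Metric.ball (0 : ℂ) (3 * R)) := Metric.isBounded_ball
  refine Complex.norm_le_of_forall_mem_frontier_norm_le hb hg.diffContOnCl (fun w hw => ?_)
    (z := z) ?_
  · rw [frontier_ball _ (by positivity), mem_sphere_zero_iff_norm] at hw
    rw [← mul_div_assoc, le_div_iff₀ (norm_pos_iff.mpr hf0)]
    have h1 : ‖f 0‖ = (∏ ρ ∈ S, ‖ρ‖ ^ m ρ) * ‖g 0‖ := by
      rw [hfg 0, norm_mul, norm_prod]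
      simp
    have h2 : ‖f w‖ = (∏ ρ ∈ S, ‖w - ρ‖ ^ m ρ) * ‖g w‖ := by
      rw [hfg w, norm_mul, norm_prod]
      simp
    have h3 : ∏ ρ ∈ S, ‖ρ‖ ^ m ρ ≤ ∏ ρ ∈ S, ‖w - ρ‖ ^ m ρ := by
      refine Finset.prod_le_prod (fun ρ _ => by positivity) fun ρ hρ => ?_
      refine pow_le_pow_left₀ (norm_nonneg _) ?_ _
      have := norm_sub_norm_le w ρ
      linarith [hS ρ hρ]
    calc ‖g w‖ * ‖f 0‖ = (∏ ρ ∈ S, ‖ρ‖ ^ m ρ) * (‖g 0‖ * ‖g w‖) := by rw [h1]; ring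
      _ ≤ (∏ ρ ∈ S, ‖w - ρ‖ ^ m ρ) * (‖g 0‖ * ‖g w‖) := by gcongr
      _ = ‖g 0‖ * ‖f w‖ := by rw [h2]; ring
      _ ≤ _ := by gcongr; exact hB w hw
  · rw [closure_ball _ (by positivity), mem_closedBall_zero_iff]
    exact hz

theorem deriv_logDeriv_prod_mul {f g : ℂ → ℂ} (hg : Differentiable ℂ g) {S : Finset ℂ} {m : ℂ → ℕ}
    (hfg : ∀ z, f z = (∏ ρ ∈ S, (z - ρ) ^ m ρ) * g z) (hS : ∀ ρ ∈ S, f ρ = 0)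
    {z : ℂ} (hz : f z ≠ 0) :
    deriv (logDeriv f) z = -∑ ρ ∈ S, (m ρ : ℂ) / (z - ρ) ^ 2 + deriv (logDeriv g) z := by
  have hP : Differentiable ℂ fun z => ∏ ρ ∈ S, (z - ρ) ^ m ρ :=
    Differentiable.fun_finsetProd fun ρ _ => by fun_prop
  have hf : Differentiable ℂ f := by
    rw [funext hfg]
    exact hP.mul hg
  have hne : ∀ w, f w ≠ 0 → ∀ ρ ∈ S, w - ρ ≠ 0 := fun w hw ρ hρ h => hw (by
    rw [sub_eq_zero.mp h, hS ρ hρ])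
  have h1 : logDeriv f =ᶠ[𝓝 z] fun w => ∑ ρ ∈ S, (m ρ : ℂ) / (w - ρ) + logDeriv g w := by
    filter_upwards [hf.continuous.continuousAt.eventually_ne hz] with w hw
    have hgw : g w ≠ 0 := fun h => hw (by rw [hfg w, h, mul_zero])
    rw [funext hfg, logDeriv_mul w (Finset.prod_ne_zero_iff.mpr fun ρ hρ =>
      pow_ne_zero _ (hne w hw ρ hρ)) hgw hP.differentiableAt (hg w)]
    congr 1
    rw [logDeriv_prod (f := fun ρ w => (w - ρ) ^ m ρ) (fun ρ hρ => pow_ne_zero _ (hne w hw ρ hρ))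
      fun ρ _ => by fun_prop]
    refine Finset.sum_congr rfl fun ρ _ => ?_
    have h := logDeriv_fun_pow (f := fun w : ℂ => w - ρ) (x := w) (by fun_prop) (m ρ)
    rw [h, logDeriv_apply]
    simp [div_eq_mul_inv]
  rw [h1.deriv_eq]
  have hgz : g z ≠ 0 := fun h => hz (by rw [hfg z, h, mul_zero])
  have h2 : HasDerivAt (fun w => ∑ ρ ∈ S, (m ρ : ℂ) / (w - ρ))
      (∑ ρ ∈ S, -((m ρ : ℂ) / (z - ρ) ^ 2)) z := by
    refine HasDerivAt.fun_sum fun ρ hρ => ?_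
    have := (hasDerivAt_const z (m ρ : ℂ)).fun_div ((hasDerivAt_id z).sub_const ρ) (hne z hz ρ hρ)
    convert! this using 1
    simp [neg_div]
  have h3 : DifferentiableAt ℂ (logDeriv g) z :=
    ((hg.analyticAt z).deriv.differentiableAt).div (hg z) hgz
  rw [(h2.fun_add h3.hasDerivAt).deriv, Finset.sum_neg_distrib]

theorem two_pow_sum_mul_le {f g : ℂ → ℂ} (hg : Differentiable ℂ g) {S : Finset ℂ} {m : ℂ → ℕ}
    (hfg : ∀ z, f z = (∏ ρ ∈ S, (z - ρ) ^ m ρ) * g z) {R B : ℝ} (hR : 0 < R)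
    (hS : ∀ ρ ∈ S, ‖ρ‖ ≤ R) (hB : ∀ z, ‖z‖ = 3 * R → ‖f z‖ ≤ B) :
    2 ^ (∑ ρ ∈ S, m ρ) * ‖f 0‖ ≤ B := by
  have hn : ∀ w, ‖f w‖ = (∏ ρ ∈ S, ‖w - ρ‖ ^ m ρ) * ‖g w‖ := fun w => by
    rw [hfg w, norm_mul, norm_prod]
    simp
  have h1 : ‖g 0‖ ≤ B / (2 * R) ^ (∑ ρ ∈ S, m ρ) := by
    refine Complex.norm_le_of_forall_mem_frontier_norm_le
      (Metric.isBounded_ball (x := (0 : ℂ)) (r := 3 * R)) hg.diffContOnCl (fun w hw => ?_)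
      (subset_closure (Metric.mem_ball_self (by positivity)))
    rw [frontier_ball _ (by positivity), mem_sphere_zero_iff_norm] at hw
    rw [le_div_iff₀ (by positivity), mul_comm]
    refine le_trans ?_ (hB w hw)
    rw [hn w, ← Finset.prod_pow_eq_pow_sum]
    gcongr with ρ hρ
    have := norm_sub_norm_le w ρ
    linarith [hS ρ hρ]
  have h2 : ‖f 0‖ ≤ R ^ (∑ ρ ∈ S, m ρ) * ‖g 0‖ := by
    rw [hn 0, ← Finset.prod_pow_eq_pow_sum]
    gcongr with ρ hρ
    simpa using hS ρ hρ
  rw [le_div_iff₀ (by positivity)] at h1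
  calc 2 ^ (∑ ρ ∈ S, m ρ) * ‖f 0‖ ≤ 2 ^ (∑ ρ ∈ S, m ρ) * (R ^ (∑ ρ ∈ S, m ρ) * ‖g 0‖) := by gcongr
    _ = ‖g 0‖ * (2 * R) ^ (∑ ρ ∈ S, m ρ) := by rw [mul_pow]; ring
    _ ≤ B := h1

/-- An entire function of order at most `3 / 2` is at most `exp (D * R ^ (3 / 2)) * ‖f 0‖` on the
circle of radius `3 * R`. -/
theorem exists_growth {f : ℂ → ℂ} (hf0 : f 0 ≠ 0) {C : ℝ}
    (hC : ∀ s, ‖f s‖ ≤ Real.exp (C * (1 + ‖s‖) ^ (3 / 2 : ℝ))) :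
    ∃ D : ℝ, 0 < D ∧ ∀ R : ℝ, 1 ≤ R → ∀ z : ℂ, ‖z‖ = 3 * R →
      ‖f z‖ ≤ Real.exp (D * R ^ (3 / 2 : ℝ)) * ‖f 0‖ := by
  refine ⟨8 * |C| + |Real.log ‖f 0‖| + 1, by positivity, fun R hR z hz => (hC z).trans ?_⟩
  have h0 : 0 < ‖f 0‖ := norm_pos_iff.mpr hf0
  nth_rewrite 2 [← Real.exp_log h0]
  rw [← Real.exp_add, Real.exp_le_exp]
  have h1 : (1 + ‖z‖) ^ (3 / 2 : ℝ) ≤ 8 * R ^ (3 / 2 : ℝ) := by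
    calc (1 + ‖z‖) ^ (3 / 2 : ℝ) ≤ (4 * R) ^ (3 / 2 : ℝ) := by gcongr; linarith
      _ = 8 * R ^ (3 / 2 : ℝ) := by
        rw [Real.mul_rpow (by norm_num) (by linarith), show (4 : ℝ) = 2 ^ (2 : ℝ) by norm_num,
          ← Real.rpow_mul (by norm_num)]
        norm_num
  have h2 : 1 ≤ R ^ (3 / 2 : ℝ) := Real.one_le_rpow hR (by norm_num)
  have h3 : C * (1 + ‖z‖) ^ (3 / 2 : ℝ) ≤ |C| * (8 * R ^ (3 / 2 : ℝ)) :=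
    mul_le_mul (le_abs_self C) h1 (by positivity) (abs_nonneg C)
  have h4 : |Real.log ‖f 0‖| ≤ |Real.log ‖f 0‖| * R ^ (3 / 2 : ℝ) :=
    le_mul_of_one_le_right (abs_nonneg _) h2
  nlinarith [neg_abs_le (Real.log ‖f 0‖)]

theorem sum_order_le {f : ℂ → ℂ} (hf : Differentiable ℂ f) (hf0 : f 0 ≠ 0) {D : ℝ}
    (hD : ∀ R : ℝ, 1 ≤ R → ∀ z : ℂ, ‖z‖ = 3 * R →
      ‖f z‖ ≤ Real.exp (D * R ^ (3 / 2 : ℝ)) * ‖f 0‖) {R : ℝ} (hR : 1 ≤ R) (S : Finset ℂ)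
    (hS : ∀ ρ ∈ S, ‖ρ‖ ≤ R) :
    (∑ ρ ∈ S, analyticOrderNatAt f ρ : ℝ) ≤ 2 * D * R ^ (3 / 2 : ℝ) := by
  obtain ⟨g, hg, hfg, -⟩ := exists_eq_prod_mul hf hf0 S
  have h1 := two_pow_sum_mul_le hg hfg (by linarith) hS (hD R hR)
  have h2 := le_of_mul_le_mul_right h1 (norm_pos_iff.mpr hf0)
  have h3 := Real.log_le_log (by positivity) h2
  rw [Real.log_exp, Real.log_pow] at h3
  push_cast at h3
  have h4 := Real.log_two_gt_d9
  have h5 : (0 : ℝ) ≤ ∑ ρ ∈ S, (analyticOrderNatAt f ρ : ℝ) := by positivity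
  nlinarith

theorem one_div_sq_le_sum {x : ℝ} (hx : 0 ≤ x) :
    ∃ N : ℕ, ∀ n, N ≤ n →
      1 / (1 + x) ^ 2 ≤ ∑ k ∈ Finset.range n, if x ≤ 2 ^ k then 4 * (1 / 4 : ℝ) ^ k else 0 := by
  classical
  have hex : ∃ k : ℕ, x ≤ 2 ^ k := by
    obtain ⟨k, hk⟩ := pow_unbounded_of_one_lt x (one_lt_two)
    exact ⟨k, hk.le⟩
  refine ⟨Nat.find hex + 1, fun n hn => ?_⟩
  have h1 : 1 / (1 + x) ^ 2 ≤ 4 * (1 / 4 : ℝ) ^ Nat.find hex := by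
    rcases hk : Nat.find hex with _ | j
    · rw [pow_zero, div_le_iff₀ (by positivity)]
      nlinarith
    · have hj : ¬ x ≤ 2 ^ j := Nat.find_min hex (by omega)
      have h2 : (1 / 4 : ℝ) ^ j = 1 / (2 ^ j) ^ 2 := by
        rw [← pow_mul, mul_comm, pow_mul, one_div, one_div, inv_pow]
        norm_num
      rw [pow_succ (1 / 4 : ℝ), h2, show 4 * (1 / ((2 : ℝ) ^ j) ^ 2 * (1 / 4)) = 1 / (2 ^ j) ^ 2 by ring]
      push Not at hj
      gcongr
      linarith
  refine h1.trans ?_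
  have h2 := Finset.single_le_sum
    (f := fun k : ℕ => if x ≤ 2 ^ k then 4 * (1 / 4 : ℝ) ^ k else 0)
    (fun k _ => by positivity) (Finset.mem_range.mpr (by omega : Nat.find hex < n))
  simpa only [if_pos (Nat.find_spec hex)] using h2

theorem summable_order_div_sq {f : ℂ → ℂ} (hf : Differentiable ℂ f) (hf0 : f 0 ≠ 0) {C : ℝ}
    (hC : ∀ s, ‖f s‖ ≤ Real.exp (C * (1 + ‖s‖) ^ (3 / 2 : ℝ))) :
    Summable fun ρ : {ρ : ℂ // f ρ = 0} => (analyticOrderNatAt f ρ.1 : ℝ) / (1 + ‖ρ.1‖) ^ 2 := by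
  classical
  obtain ⟨D, hD0, hD⟩ := exists_growth hf0 hC
  let r : ℝ := 2 ^ (3 / 2 : ℝ) / 4
  have hr0 : 0 ≤ r := by positivity
  have hr1 : r < 1 := by
    have : (2 : ℝ) ^ (3 / 2 : ℝ) < 2 ^ (2 : ℝ) :=
      Real.rpow_lt_rpow_of_exponent_lt (by norm_num) (by norm_num)
    norm_num at this
    rw [div_lt_one (by norm_num)]
    exact_mod_cast this
  refine summable_of_sum_le (c := 8 * D * ∑' k, r ^ k) (fun ρ => by positivity) fun T => ?_
  choose N hN using fun ρ : {ρ : ℂ // f ρ = 0} => one_div_sq_le_sum (norm_nonneg ρ.1)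
  let n := T.sup N
  calc ∑ ρ ∈ T, (analyticOrderNatAt f ρ.1 : ℝ) / (1 + ‖ρ.1‖) ^ 2
      ≤ ∑ ρ ∈ T, ∑ k ∈ Finset.range n, (analyticOrderNatAt f ρ.1 : ℝ) *
          (if ‖ρ.1‖ ≤ 2 ^ k then 4 * (1 / 4 : ℝ) ^ k else 0) := by
        refine Finset.sum_le_sum fun ρ hρ => ?_
        rw [← Finset.mul_sum, div_eq_mul_one_div]
        gcongr
        exact hN ρ n (Finset.le_sup hρ)
    _ = ∑ k ∈ Finset.range n, 4 * (1 / 4 : ℝ) ^ k *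
          ∑ ρ ∈ (T.map (Function.Embedding.subtype _)).filter (fun ρ => ‖ρ‖ ≤ 2 ^ k),
            (analyticOrderNatAt f ρ : ℝ) := by
        rw [Finset.sum_comm]
        refine Finset.sum_congr rfl fun k _ => ?_
        rw [Finset.sum_filter, Finset.sum_map, Finset.mul_sum]
        refine Finset.sum_congr rfl fun ρ _ => ?_
        simp only [Function.Embedding.subtype_apply, mul_ite, mul_zero]
        by_cases h : ‖ρ.1‖ ≤ 2 ^ k
        · simp only [h, if_true]
          ring
        · simp only [h, if_false, mul_zero]
    _ ≤ ∑ k ∈ Finset.range n, 8 * D * r ^ k := by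
        refine Finset.sum_le_sum fun k _ => ?_
        have h1 := sum_order_le hf hf0 hD (R := 2 ^ k) (one_le_pow₀ one_le_two)
          ((T.map (Function.Embedding.subtype _)).filter (fun ρ => ‖ρ‖ ≤ 2 ^ k))
          (fun ρ hρ => (Finset.mem_filter.mp hρ).2)
        have h2 : ((2 : ℝ) ^ k) ^ (3 / 2 : ℝ) = (2 ^ (3 / 2 : ℝ)) ^ k := by
          rw [← Real.rpow_natCast, ← Real.rpow_mul (by norm_num), mul_comm,
            Real.rpow_mul (by norm_num), Real.rpow_natCast]
        calc _ ≤ 4 * (1 / 4 : ℝ) ^ k * (2 * D * (2 ^ k) ^ (3 / 2 : ℝ)) := by gcongr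
          _ = 8 * D * r ^ k := by
            rw [h2, show r = 2 ^ (3 / 2 : ℝ) * (1 / 4) by simp only [r]; ring, mul_pow]
            ring
    _ ≤ 8 * D * ∑' k, r ^ k := by
        rw [← Finset.mul_sum]
        gcongr
        exact (summable_geometric_of_lt_one hr0 hr1).sum_le_tsum _ fun _ _ => by positivity

/-- The partial fraction expansion of `(f' / f)'` for an entire function of order at most
`3 / 2`. -/
theorem hasSum_deriv_logDeriv {f : ℂ → ℂ} (hf : Differentiable ℂ f) (hf0 : f 0 ≠ 0) {C : ℝ}
    (hC : ∀ s, ‖f s‖ ≤ Real.exp (C * (1 + ‖s‖) ^ (3 / 2 : ℝ))) {z : ℂ} (hz : f z ≠ 0) :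
    HasSum (fun ρ : {ρ : ℂ // f ρ = 0} => (analyticOrderNatAt f ρ.1 : ℂ) / (z - ρ.1) ^ 2)
      (-deriv (logDeriv f) z) := by
  classical
  obtain ⟨D, hD0, hD⟩ := exists_growth hf0 hC
  have hfin := fun R => finite_zeros_closedBall hf hf0 R
  let T : ℕ → Finset {ρ : ℂ // f ρ = 0} := fun n => (hfin n).toFinset.subtype _
  have hTmem : ∀ n ρ, ρ ∈ T n ↔ ‖ρ.1‖ ≤ n := fun n ρ => by simp [T, ρ.2]
  have hT : Tendsto T atTop atTop := by
    refine tendsto_atTop_finset_of_monotone (fun a b hab ρ => ?_) fun ρ => ?_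
    · rw [hTmem, hTmem]
      exact fun h => h.trans (by exact_mod_cast hab)
    · obtain ⟨n, hn⟩ := exists_nat_ge ‖ρ.1‖
      exact ⟨n, (hTmem n ρ).mpr hn⟩
  have hsum : Summable fun ρ : {ρ : ℂ // f ρ = 0} =>
      (analyticOrderNatAt f ρ.1 : ℂ) / (z - ρ.1) ^ 2 := by
    refine Summable.of_norm_bounded_eventually
      ((summable_order_div_sq hf hf0 hC).mul_left 4) ?_
    obtain ⟨n, hn⟩ := exists_nat_ge (1 + 2 * ‖z‖)
    refine (T n).finite_toSet.subset fun ρ hρ => ?_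
    by_contra hcon
    refine hρ ?_
    change ‖_‖ ≤ _
    rw [Finset.mem_coe, hTmem, not_le] at hcon
    have h1 := norm_sub_norm_le ρ.1 z
    rw [norm_sub_rev] at h1
    rw [norm_div, norm_pow, Complex.norm_natCast, ← mul_div_assoc, mul_comm (4 : ℝ), mul_div_assoc]
    rw [div_eq_mul_one_div]
    refine mul_le_mul_of_nonneg_left ?_ (by positivity)
    have h2 : (1 + ‖ρ.1‖) / 2 ≤ ‖z - ρ.1‖ := by linarith
    rw [div_le_div_iff₀ (pow_pos (lt_of_lt_of_le (by positivity) h2) 2) (by positivity)]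
    nlinarith [norm_nonneg ρ.1]
  have key : Tendsto (fun n => ∑ ρ ∈ T n, (analyticOrderNatAt f ρ.1 : ℂ) / (z - ρ.1) ^ 2) atTop
      (𝓝 (-deriv (logDeriv f) z)) := by
    rw [tendsto_iff_norm_sub_tendsto_zero]
    have hlim : Tendsto (fun n : ℕ => 64 * D * ((n : ℝ) ^ (1 / 2 : ℝ))⁻¹) atTop (𝓝 0) := by
      rw [← mul_zero (64 * D)]
      exact (((tendsto_rpow_atTop (by norm_num)).comp
        tendsto_natCast_atTop_atTop).inv_tendsto_atTop).const_mul _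
    refine squeeze_zero' (Eventually.of_forall fun _ => norm_nonneg _) ?_ hlim
    obtain ⟨n₀, hn₀⟩ := exists_nat_ge (8 * ‖z‖ + 1)
    filter_upwards [eventually_ge_atTop n₀] with n hn
    have hnR : 8 * ‖z‖ + 1 ≤ (n : ℝ) := hn₀.trans (by exact_mod_cast hn)
    have hn1 : (1 : ℝ) ≤ n := by linarith [norm_nonneg z]
    have hn0 : (0 : ℝ) < n := by linarith
    let S := (hfin n).toFinset
    have hSmem : ∀ ρ, ρ ∈ S ↔ f ρ = 0 ∧ ‖ρ‖ ≤ n := fun ρ => by simp [S]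
    obtain ⟨g, hg, hfg, hgS⟩ := exists_eq_prod_mul hf hf0 S
    have hgne : ∀ w ∈ Metric.ball (0 : ℂ) n, g w ≠ 0 := fun w hw h => by
      refine hgS w ((hSmem w).mpr ⟨by rw [hfg w, h, mul_zero], ?_⟩) h
      exact (mem_ball_zero_iff.mp hw).le
    have hbd : ∀ w ∈ Metric.ball (0 : ℂ) n,
        ‖g w‖ ≤ ‖g 0‖ * Real.exp (D * (n : ℝ) ^ (3 / 2 : ℝ)) := fun w hw => by
      have := norm_quotient_le hg hfg hf0 hn0 (fun ρ hρ => ((hSmem ρ).mp hρ).2) (hD n hn1)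
        (z := w) (by linarith [mem_ball_zero_iff.mp hw])
      rwa [mul_div_cancel_right₀ _ (norm_ne_zero_iff.mpr hf0)] at this
    have h1 := norm_deriv_logDeriv_le hn0 (by positivity) hg.differentiableOn hgne hbd
      (z := z) (by linarith)
    have h2 := deriv_logDeriv_prod_mul hg hfg (fun ρ hρ => ((hSmem ρ).mp hρ).1) hz
    have h3 : ∑ ρ ∈ T n, (analyticOrderNatAt f ρ.1 : ℂ) / (z - ρ.1) ^ 2 =
        ∑ ρ ∈ S, (analyticOrderNatAt f ρ : ℂ) / (z - ρ) ^ 2 :=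
      Finset.sum_subtype_of_mem (fun ρ => (analyticOrderNatAt f ρ : ℂ) / (z - ρ) ^ 2)
        fun ρ hρ => ((hSmem ρ).mp hρ).1
    rw [h3, h2, sub_neg_eq_add, add_comm, add_assoc, add_comm, add_assoc, add_neg_cancel, add_zero]
    refine h1.trans (le_of_eq ?_)
    have h4 : (n : ℝ) ^ 2 = (n : ℝ) ^ (3 / 2 : ℝ) * (n : ℝ) ^ (1 / 2 : ℝ) := by
      rw [← Real.rpow_add hn0, ← Real.rpow_natCast]
      norm_num
    rw [h4]
    have h5 : (n : ℝ) ^ (3 / 2 : ℝ) ≠ 0 := (Real.rpow_pos_of_pos hn0 _).ne'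
    have h6 : (n : ℝ) ^ (1 / 2 : ℝ) ≠ 0 := (Real.rpow_pos_of_pos hn0 _).ne'
    field_simp
  have := hsum.hasSum.comp hT
  rw [← tendsto_nhds_unique this key]
  exact hsum.hasSum

end

end ExplicitFormula

namespace ExplicitFormula

open MeasureTheory Filter Topology

section

theorem norm_Gamma_le {s : ℂ} (hs : 0 < s.re) : ‖Complex.Gamma s‖ ≤ Real.Gamma s.re := by
  rw [Complex.Gamma_eq_integral hs, Complex.GammaIntegral, Real.Gamma_eq_integral hs]
  refine (norm_integral_le_integral_norm _).trans (le_of_eq ?_)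
  refine setIntegral_congr_fun measurableSet_Ioi fun x hx => ?_
  simp only [norm_mul, Complex.norm_real, Real.norm_eq_abs, Real.abs_exp]
  rw [Complex.norm_cpow_eq_rpow_re_of_pos hx]
  simp

theorem Gamma_add_nat_le {x : ℝ} (hx : 0 < x) (r : ℕ) :
    Real.Gamma (x + r) ≤ Real.Gamma x * (x + r) ^ r := by
  suffices h : ∀ k : ℕ, k ≤ r → Real.Gamma (x + k) ≤ Real.Gamma x * (x + r) ^ k from h r le_rfl
  intro k
  induction k with
  | zero => simp
  | succ k ih =>
    intro hk
    have h1 := ih (by omega)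
    have h2 : (k : ℝ) ≤ r := by exact_mod_cast (by omega : k ≤ r)
    have h3 : 0 < Real.Gamma x := Real.Gamma_pos_of_pos hx
    push_cast
    rw [← add_assoc, Real.Gamma_add_one (by positivity)]
    calc (x + k) * Real.Gamma (x + k) ≤ (x + r) * (Real.Gamma x * (x + r) ^ k) := by gcongr
      _ = Real.Gamma x * (x + r) ^ (k + 1) := by ring

theorem norm_deriv_digamma_add_sq_le {s : ℂ} {r : ℕ} (hr : 2 ≤ r) (hs : ‖s‖ ≤ r / 8) :
    ‖deriv Complex.digamma (s + (r : ℂ) ^ 2)‖ ≤ 256 * (r + 1 : ℝ) ^ (1 / 2 : ℝ) / r := by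
  have hr' : (2 : ℝ) ≤ r := by exact_mod_cast hr
  have hr0 : (0 : ℝ) < r := by linarith
  let g : ℂ → ℂ := fun z => Complex.Gamma (z + (r : ℂ) ^ 2)
  have hre : ∀ z : ℂ, (z + (r : ℂ) ^ 2).re = z.re + r ^ 2 := fun z => by
    rw [Complex.add_re, ← Nat.cast_pow, Complex.natCast_re]
    push_cast
    rfl
  have hpos : ∀ z ∈ Metric.ball (0 : ℂ) r, 2 ≤ (z + (r : ℂ) ^ 2).re ∧
      (z + (r : ℂ) ^ 2).re ≤ r ^ 2 + r := fun z hz => by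
    have h1 := Complex.abs_re_le_norm z
    rw [mem_ball_zero_iff] at hz
    rw [hre]
    constructor <;> nlinarith [abs_le.mp (h1.trans hz.le)]
  have hd : ∀ z ∈ Metric.ball (0 : ℂ) r, DifferentiableAt ℂ g z := fun z hz => by
    refine (Complex.differentiableAt_Gamma _ fun m hm => ?_).comp z (by fun_prop)
    have := (hpos z hz).1
    rw [hm, Complex.neg_re, Complex.natCast_re] at this
    linarith [(Nat.cast_nonneg m : (0 : ℝ) ≤ m)]
  have hM : (0 : ℝ) < r * (4 * (r + 1 : ℝ) ^ (1 / 2 : ℝ)) := by positivity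
  have hbd : ∀ z ∈ Metric.ball (0 : ℂ) r,
      ‖g z‖ ≤ ‖g 0‖ * Real.exp (r * (4 * (r + 1 : ℝ) ^ (1 / 2 : ℝ))) := fun z hz => by
    obtain ⟨h1, h2⟩ := hpos z hz
    have h3 : ‖g 0‖ = Real.Gamma (r ^ 2) := by
      simp only [g, zero_add]
      rw [show ((r : ℂ) ^ 2) = (((r : ℝ) ^ 2 : ℝ) : ℂ) by push_cast; rfl, Complex.Gamma_ofReal,
        Complex.norm_real, Real.norm_of_nonneg (Real.Gamma_pos_of_pos (by positivity)).le]
    have h4 : ((r : ℝ) ^ 2 + r) ≤ Real.exp (4 * (r + 1 : ℝ) ^ (1 / 2 : ℝ)) := by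
      have h5 : Real.log (r + 1) ≤ 2 * (r + 1 : ℝ) ^ (1 / 2 : ℝ) := by
        have := Real.log_le_rpow_div (x := r + 1) (ε := 1 / 2) (by linarith) (by norm_num)
        linarith
      calc (r : ℝ) ^ 2 + r ≤ (r + 1) ^ 2 := by nlinarith
        _ = Real.exp (2 * Real.log (r + 1)) := by
          rw [mul_comm, Real.exp_mul, Real.exp_log (by linarith)]
          norm_num
        _ ≤ _ := Real.exp_le_exp.mpr (by linarith)
    rw [h3]
    calc ‖g z‖ ≤ Real.Gamma (z + (r : ℂ) ^ 2).re := norm_Gamma_le (by linarith)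
      _ ≤ Real.Gamma (r ^ 2 + r) := Real.Gamma_strictMonoOn_Ici.monotoneOn h1 (h1.trans h2) h2
      _ ≤ Real.Gamma (r ^ 2) * (r ^ 2 + r) ^ r := Gamma_add_nat_le (by positivity) r
      _ ≤ Real.Gamma (r ^ 2) * (Real.exp (4 * (r + 1 : ℝ) ^ (1 / 2 : ℝ))) ^ r := by
        have := Real.Gamma_pos_of_pos (by positivity : (0 : ℝ) < (r : ℝ) ^ 2)
        gcongr
      _ = _ := by rw [← Real.exp_nat_mul]
  have key := norm_deriv_logDeriv_le hr0 hM (fun z hz => (hd z hz).differentiableWithinAt)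
    (fun z hz => Complex.Gamma_ne_zero_of_re_pos (by linarith [(hpos z hz).1])) hbd hs
  have e : logDeriv g = fun z => Complex.digamma (z + (r : ℂ) ^ 2) := by
    funext z
    rw [Complex.digamma_def, logDeriv_apply, logDeriv_apply, deriv_comp_add_const]
  rw [e, deriv_comp_add_const] at key
  refine key.trans (le_of_eq ?_)
  field_simp
  ring

theorem differentiableAt_digamma {s : ℂ} (hs : 0 < s.re) :
    DifferentiableAt ℂ Complex.digamma s := by
  have hd : ∀ z ∈ {z : ℂ | 0 < z.re}, DifferentiableAt ℂ Complex.Gamma z := fun z hz =>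
    Complex.differentiableAt_Gamma z fun m hm => by
      have h : 0 < z.re := hz
      rw [hm, Complex.neg_re, Complex.natCast_re] at h
      linarith [(Nat.cast_nonneg m : (0 : ℝ) ≤ m)]
  have ho : IsOpen {z : ℂ | 0 < z.re} := isOpen_lt continuous_const Complex.continuous_re
  have hO : DifferentiableOn ℂ Complex.Gamma {z : ℂ | 0 < z.re} := fun z hz =>
    (hd z hz).differentiableWithinAt
  exact ((hO.deriv ho).differentiableAt (ho.mem_nhds hs)).div (hd s hs)
    (Complex.Gamma_ne_zero_of_re_pos hs)

theorem deriv_digamma_eq_sum {s : ℂ} (hs : 0 < s.re) (N : ℕ) :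
    deriv Complex.digamma s =
      ∑ n ∈ Finset.range N, 1 / (s + n) ^ 2 + deriv Complex.digamma (s + N) := by
  induction N with
  | zero => simp
  | succ N ih =>
    have hN : 0 < (s + N).re := by
      rw [Complex.add_re, Complex.natCast_re]
      positivity
    have h0 : s + N ≠ 0 := fun h => by simp [h] at hN
    have h1 : (fun w => Complex.digamma (w + 1)) =ᶠ[𝓝 (s + N)]
        fun w => Complex.digamma w + w⁻¹ := by
      filter_upwards [(isOpen_lt continuous_const Complex.continuous_re).mem_nhds hN] with w hw
      refine Complex.digamma_apply_add_one w fun m hm => ?_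
      have h : 0 < w.re := hw
      rw [hm, Complex.neg_re, Complex.natCast_re] at h
      linarith [(Nat.cast_nonneg m : (0 : ℝ) ≤ m)]
    have h2 := h1.deriv_eq
    rw [deriv_comp_add_const, deriv_fun_add (differentiableAt_digamma hN)
      (differentiableAt_inv h0), deriv_inv] at h2
    rw [ih, Finset.sum_range_succ]
    push_cast
    rw [← add_assoc, h2]
    ring

theorem summable_one_div_add_nat_sq {s : ℂ} (hs : 0 < s.re) :
    Summable fun n : ℕ => ‖1 / (s + n) ^ 2‖ := by
  refine Summable.of_norm_bounded_eventually_nat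
    (g := fun n : ℕ => 1 / (n : ℝ) ^ 2) (Real.summable_one_div_nat_pow.mpr one_lt_two) ?_
  filter_upwards [eventually_gt_atTop 0] with n hn
  have hn' : (0 : ℝ) < n := by exact_mod_cast hn
  rw [norm_norm, norm_div, norm_one, norm_pow]
  gcongr
  refine le_trans ?_ (Complex.re_le_norm _)
  simp [hs.le]

theorem hasSum_deriv_digamma {s : ℂ} (hs : 0 < s.re) :
    HasSum (fun n : ℕ => 1 / (s + n) ^ 2) (deriv Complex.digamma s) := by
  have hsum := (summable_one_div_add_nat_sq hs).of_norm
  have h1 := hsum.hasSum.tendsto_sum_nat.comp (tendsto_pow_atTop two_ne_zero)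
  have h2 : Tendsto (fun r : ℕ => ∑ n ∈ Finset.range (r ^ 2), 1 / (s + n) ^ 2) atTop
      (𝓝 (deriv Complex.digamma s)) := by
    rw [tendsto_iff_norm_sub_tendsto_zero]
    have hlim : Tendsto (fun r : ℕ => 512 * ((r : ℝ) ^ (1 / 2 : ℝ))⁻¹) atTop (𝓝 0) := by
      rw [← mul_zero (512 : ℝ)]
      exact (((tendsto_rpow_atTop (by norm_num)).comp
        tendsto_natCast_atTop_atTop).inv_tendsto_atTop).const_mul _
    refine squeeze_zero' (Eventually.of_forall fun _ => norm_nonneg _) ?_ hlim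
    obtain ⟨n₀, hn₀⟩ := exists_nat_ge (8 * ‖s‖ + 2)
    filter_upwards [eventually_ge_atTop n₀] with r hr
    have hr1 : 8 * ‖s‖ + 2 ≤ (r : ℝ) := hn₀.trans (by exact_mod_cast hr)
    have hr2 : (2 : ℝ) ≤ r := by linarith [norm_nonneg s]
    have hr0 : (0 : ℝ) < r := by linarith
    rw [deriv_digamma_eq_sum hs (r ^ 2), sub_add_cancel_left, norm_neg]
    push_cast
    refine (norm_deriv_digamma_add_sq_le (by exact_mod_cast hr2) (by linarith)).trans ?_
    have h4 : (r : ℝ) = (r : ℝ) ^ (1 / 2 : ℝ) * (r : ℝ) ^ (1 / 2 : ℝ) := by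
      rw [← Real.rpow_add hr0]
      norm_num
    have h5 : (r + 1 : ℝ) ^ (1 / 2 : ℝ) ≤ 2 * (r : ℝ) ^ (1 / 2 : ℝ) := by
      calc (r + 1 : ℝ) ^ (1 / 2 : ℝ) ≤ (4 * r) ^ (1 / 2 : ℝ) := by gcongr; linarith
        _ = 2 * (r : ℝ) ^ (1 / 2 : ℝ) := by
          rw [Real.mul_rpow (by norm_num) hr0.le, show (4 : ℝ) = 2 ^ (2 : ℝ) by norm_num,
            ← Real.rpow_mul (by norm_num)]
          norm_num
    have h6 : (0 : ℝ) < (r : ℝ) ^ (1 / 2 : ℝ) := Real.rpow_pos_of_pos hr0 _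
    rw [div_le_iff₀ hr0]
    calc 256 * (r + 1 : ℝ) ^ (1 / 2 : ℝ) ≤ 256 * (2 * (r : ℝ) ^ (1 / 2 : ℝ)) := by gcongr
      _ = 512 * ((r : ℝ) ^ (1 / 2 : ℝ))⁻¹ * ((r : ℝ) ^ (1 / 2 : ℝ) * (r : ℝ) ^ (1 / 2 : ℝ)) := by
        field_simp
        norm_num
      _ = _ := by rw [← h4]
  rw [← tendsto_nhds_unique h1 h2]
  exact hsum.hasSum

end

end ExplicitFormula

namespace ExplicitFormula

open MeasureTheory Filter Topology
open NumberField NumberField.Units NumberField.Units.dirichletUnitTheorem nonZeroDivisors Module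
open scoped ENNReal Classical

variable {K : Type*} [Field K] [NumberField K]

noncomputable section

/-- Nonzero ideals of the ring of integers. -/
abbrev NonzeroIdeal (K : Type*) [Field K] := {I : Ideal (𝓞 K) // I ≠ ⊥}

/-- Finite places, as nonzero prime ideals of the ring of integers. -/
abbrev FinitePlace' (K : Type*) [Field K] := {p : Ideal (𝓞 K) // p ≠ ⊥ ∧ p.IsPrime}

/-- The logarithm of the absolute norm of an ideal. -/
def logNorm (I : Ideal (𝓞 K)) : ℝ := Real.log (Ideal.absNorm I)

theorem absNorm_ne_zero' {I : Ideal (𝓞 K)} (hI : I ≠ ⊥) : Ideal.absNorm I ≠ 0 :=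
  Ideal.absNorm_eq_zero_iff.not.mpr hI

theorem logNorm_nonneg (I : Ideal (𝓞 K)) : 0 ≤ logNorm I := Real.log_natCast_nonneg _

theorem logNorm_mul {I J : Ideal (𝓞 K)} (hI : I ≠ ⊥) (hJ : J ≠ ⊥) :
    logNorm (I * J) = logNorm I + logNorm J := by
  rw [logNorm, map_mul, Nat.cast_mul, Real.log_mul]
  · rfl
  · exact_mod_cast absNorm_ne_zero' hI
  · exact_mod_cast absNorm_ne_zero' hJ

theorem logNorm_pow (I : Ideal (𝓞 K)) (n : ℕ) : logNorm (I ^ n) = n * logNorm I := by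
  rw [logNorm, map_pow, Nat.cast_pow, Real.log_pow]
  rfl

theorem log_two_le_logNorm (p : FinitePlace' K) : Real.log 2 ≤ logNorm p.1 := by
  refine Real.log_le_log (by norm_num) ?_
  have h1 := absNorm_ne_zero' p.2.1
  have h2 : Ideal.absNorm p.1 ≠ 1 := Ideal.absNorm_eq_one_iff.not.mpr p.2.2.ne_top
  exact_mod_cast (by omega : 2 ≤ Ideal.absNorm p.1)

theorem logNorm_pos (p : FinitePlace' K) : 0 < logNorm p.1 :=
  (Real.log_pos one_lt_two).trans_le (log_two_le_logNorm p)

theorem absNorm_cpow_neg {I : Ideal (𝓞 K)} (hI : I ≠ ⊥) (s : ℂ) :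
    (Ideal.absNorm I : ℂ) ^ (-s) = Complex.exp (-(logNorm I : ℂ) * s) := by
  rw [Complex.cpow_def_of_ne_zero (by exact_mod_cast absNorm_ne_zero' hI), logNorm,
    Complex.natCast_log]
  ring_nf

theorem norm_exp_neg_mul (L : ℝ) (s : ℂ) : ‖Complex.exp (-(L : ℂ) * s)‖ = Real.exp (-L * s.re) := by
  rw [Complex.norm_exp, ← Complex.ofReal_neg, Complex.re_ofReal_mul]

theorem summable_exp_neg_logNorm {σ : ℝ} (hσ : 1 < σ) :
    Summable fun I : NonzeroIdeal K => Real.exp (-logNorm I.1 * σ) := by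
  obtain ⟨C, -, hC⟩ := exists_heckePair_Λ K
  convert! (hC _ isClassReps_out σ hσ).1 using 2 with I
  rw [Real.rpow_def_of_pos (by exact_mod_cast Nat.pos_of_ne_zero (absNorm_ne_zero' I.2)), logNorm]
  ring_nf

theorem summable_norm_exp_neg_logNorm {s : ℂ} (hs : 1 < s.re) :
    Summable fun I : NonzeroIdeal K => ‖Complex.exp (-(logNorm I.1 : ℂ) * s)‖ := by
  simp only [norm_exp_neg_mul]
  exact summable_exp_neg_logNorm hs

/-- The characterization of the Dedekind zeta function on its half-plane of absolute convergence. -/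
def IsZeta (K : Type*) [Field K] [NumberField K] (Z : ℂ → ℂ) : Prop :=
  ∀ s : ℂ, 1 < s.re → Z s = ∑' I : NonzeroIdeal K, (Ideal.absNorm I.1 : ℂ) ^ (-s)

theorem IsZeta.hasSum {Z : ℂ → ℂ} (hZ : IsZeta K Z) {s : ℂ} (hs : 1 < s.re) :
    HasSum (fun I : NonzeroIdeal K => Complex.exp (-(logNorm I.1 : ℂ) * s)) (Z s) := by
  rw [hZ s hs]
  have h : ∀ I : NonzeroIdeal K, (Ideal.absNorm I.1 : ℂ) ^ (-s) =
      Complex.exp (-(logNorm I.1 : ℂ) * s) := fun I => absNorm_cpow_neg I.2 s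
  simp only [h]
  exact (summable_norm_exp_neg_logNorm hs).of_norm.hasSum

theorem isOpen_re_gt (a : ℝ) : IsOpen {s : ℂ | a < s.re} :=
  isOpen_lt continuous_const Complex.continuous_re

theorem IsZeta.hasSum_deriv {Z : ℂ → ℂ} (hZ : IsZeta K Z) {s : ℂ} (hs : 1 < s.re) :
    HasSum (fun I : NonzeroIdeal K => (logNorm I.1 : ℂ) * Complex.exp (-(logNorm I.1 : ℂ) * s))
      (-deriv Z s) := by
  obtain ⟨σ, h1, h2⟩ := exists_between hs
  have h := Complex.hasSum_deriv_of_summable_norm (ι := NonzeroIdeal K)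
    (F := fun I s => Complex.exp (-(logNorm I.1 : ℂ) * s)) (U := {s : ℂ | σ < s.re}) (z := s)
    (summable_exp_neg_logNorm h1) (fun I => by fun_prop) (isOpen_re_gt σ) (fun I w hw => by
      rw [norm_exp_neg_mul]
      refine Real.exp_le_exp.mpr ?_
      have hw' : σ < w.re := hw
      nlinarith [logNorm_nonneg I.1]) h2
  have e : (fun w : ℂ => ∑' I : NonzeroIdeal K, Complex.exp (-(logNorm I.1 : ℂ) * w)) =ᶠ[𝓝 s]
      Z := by
    filter_upwards [(isOpen_re_gt 1).mem_nhds hs] with w hw using (hZ.hasSum hw).tsum_eq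
  rw [e.deriv_eq] at h
  convert! h.neg using 2 with I
  rw [((hasDerivAt_id' s).const_mul (-(logNorm I.1 : ℂ))).cexp.deriv]
  ring

theorem pow_dvd_iff_lt_count (p : FinitePlace' K) {I : Ideal (𝓞 K)} (hI : I ≠ ⊥) (j : ℕ) :
    p.1 ^ (j + 1) ∣ I ↔ j < (UniqueFactorizationMonoid.normalizedFactors I).count p.1 := by
  have hp : Prime p.1 := Ideal.prime_of_isPrime p.2.1 p.2.2
  rw [pow_dvd_iff_le_emultiplicity,
    UniqueFactorizationMonoid.le_emultiplicity_iff_replicate_le_normalizedFactors hp.irreducible hI,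
    normalize_eq, ← Multiset.le_count_iff_replicate_le, Nat.succ_le_iff]

theorem hasSum_logNorm (I : NonzeroIdeal K) :
    HasSum (fun x : FinitePlace' K × ℕ => if x.1.1 ^ (x.2 + 1) ∣ I.1 then logNorm x.1.1 else 0)
      (logNorm I.1) := by
  set s := UniqueFactorizationMonoid.normalizedFactors I.1 with hs
  have hmem : ∀ q ∈ s, q ≠ ⊥ ∧ q.IsPrime := fun q hq =>
    ⟨(UniqueFactorizationMonoid.prime_of_normalized_factor q hq).ne_zero,
      Ideal.isPrime_of_prime (UniqueFactorizationMonoid.prime_of_normalized_factor q hq)⟩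
  let F : Finset (FinitePlace' K × ℕ) :=
    (s.toFinset.subtype fun p => p ≠ ⊥ ∧ p.IsPrime) ×ˢ Finset.range (Multiset.card s)
  have h0 : ∀ x ∉ F, (if x.1.1 ^ (x.2 + 1) ∣ I.1 then logNorm x.1.1 else 0) = 0 := fun x hx => by
    refine if_neg fun h => hx ?_
    rw [pow_dvd_iff_lt_count x.1 I.2] at h
    refine Finset.mem_product.mpr ⟨?_, ?_⟩
    · rw [Finset.mem_subtype, Multiset.mem_toFinset]
      exact Multiset.count_pos.mp (Nat.zero_lt_of_lt h)
    · exact Finset.mem_range.mpr (h.trans_le (Multiset.count_le_card _ _))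
  have h1 : ∑ x ∈ F, (if x.1.1 ^ (x.2 + 1) ∣ I.1 then logNorm x.1.1 else 0) = logNorm I.1 := by
    have hin : ∀ p : FinitePlace' K, ∑ j ∈ Finset.range (Multiset.card s),
        (if p.1 ^ (j + 1) ∣ I.1 then logNorm p.1 else 0) = s.count p.1 * logNorm p.1 := fun p => by
      simp only [pow_dvd_iff_lt_count p I.2, ← hs]
      rw [← Finset.sum_filter, Finset.sum_const, nsmul_eq_mul]
      congr 2
      rw [show (Finset.range (Multiset.card s)).filter (fun j => j < s.count p.1) =
        Finset.range (s.count p.1) from ?_, Finset.card_range]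
      ext j
      have := Multiset.count_le_card p.1 s
      simp only [Finset.mem_filter, Finset.mem_range]
      omega
    rw [Finset.sum_product]
    simp only [hin]
    rw [Finset.sum_subtype_of_mem (fun p => (s.count p : ℝ) * logNorm p)
      fun q hq => hmem q (Multiset.mem_toFinset.mp hq)]
    have h2 : Ideal.absNorm I.1 = ∏ q ∈ s.toFinset, Ideal.absNorm q ^ s.count q := by
      conv_lhs => rw [← Ideal.prod_normalizedFactors_eq_self I.2]
      rw [map_multiset_prod, Finset.prod_multiset_map_count]
    rw [logNorm, h2, Nat.cast_prod, Real.log_prod]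
    · refine Finset.sum_congr rfl fun q _ => ?_
      rw [Nat.cast_pow, Real.log_pow]
      rfl
    · intro q hq
      have := absNorm_ne_zero' (hmem q (Multiset.mem_toFinset.mp hq)).1
      exact_mod_cast pow_ne_zero _ this
  rw [← h1]
  exact hasSum_sum_of_ne_finset_zero h0

/-- The length `(j + 1) * log N𝔭` attached to the prime power `𝔭 ^ (j + 1)`. -/
def primeLength (x : FinitePlace' K × ℕ) : ℝ := ((x.2 : ℝ) + 1) * logNorm x.1.1

theorem primeLength_eq (x : FinitePlace' K × ℕ) :
    primeLength x = logNorm (x.1.1 ^ (x.2 + 1)) := by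
  rw [logNorm_pow, primeLength]
  push_cast
  rfl

/-- The nonzero ideal `𝔭 ^ (j + 1)`. -/
def primePower (x : FinitePlace' K × ℕ) : NonzeroIdeal K :=
  ⟨x.1.1 ^ (x.2 + 1), pow_ne_zero _ x.1.2.1⟩

theorem primePower_injective : Function.Injective (primePower (K := K)) := by
  rintro ⟨p, j⟩ ⟨q, k⟩ h
  have h1 : p.1 ^ (j + 1) = q.1 ^ (k + 1) := congrArg Subtype.val h
  have hp : Prime p.1 := Ideal.prime_of_isPrime p.2.1 p.2.2
  have hq : Prime q.1 := Ideal.prime_of_isPrime q.2.1 q.2.2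
  have h2 : p.1 ∣ q.1 := hp.dvd_of_dvd_pow (h1 ▸ dvd_pow_self _ (Nat.succ_ne_zero j))
  have h3 : p.1 = q.1 := associated_iff_eq.mp (hp.dvd_prime_iff_associated hq |>.mp h2)
  have h4 : p = q := Subtype.ext h3
  subst h4
  have h5 := congrArg logNorm h1
  rw [logNorm_pow, logNorm_pow] at h5
  have h6 := mul_right_cancel₀ (logNorm_pos p).ne' h5
  have h7 : j + 1 = k + 1 := by exact_mod_cast h6
  rw [Nat.succ.inj h7]

theorem summable_logNorm_mul_exp {σ : ℝ} (hσ : 1 < σ) (n : ℕ) :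
    Summable fun I : NonzeroIdeal K => logNorm I.1 ^ n * Real.exp (-logNorm I.1 * σ) := by
  obtain ⟨τ, h1, h2⟩ := exists_between hσ
  have hd : 0 < σ - τ := by linarith
  refine Summable.of_nonneg_of_le (fun I => ?_) (fun I => ?_)
    ((summable_exp_neg_logNorm (K := K) h1).mul_left ((Nat.factorial n : ℝ) / (σ - τ) ^ n))
  · have := logNorm_nonneg I.1
    positivity
  · have h3 := logNorm_nonneg I.1
    have h4 := Real.pow_div_factorial_le_exp (logNorm I.1 * (σ - τ)) (by positivity) n
    rw [div_le_iff₀ (by positivity), mul_pow] at h4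
    have h5 : Real.exp (-logNorm I.1 * τ) =
        Real.exp (logNorm I.1 * (σ - τ)) * Real.exp (-logNorm I.1 * σ) := by
      rw [← Real.exp_add]
      ring_nf
    rw [h5, div_mul_eq_mul_div, le_div_iff₀ (by positivity)]
    calc logNorm I.1 ^ n * Real.exp (-logNorm I.1 * σ) * (σ - τ) ^ n
        = (logNorm I.1 ^ n * (σ - τ) ^ n) * Real.exp (-logNorm I.1 * σ) := by ring
      _ ≤ (Real.exp (logNorm I.1 * (σ - τ)) * n.factorial) * Real.exp (-logNorm I.1 * σ) := by
        gcongr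
      _ = _ := by ring

theorem summable_primeLength {σ : ℝ} (hσ : 1 < σ) (n : ℕ) :
    Summable fun x : FinitePlace' K × ℕ =>
      logNorm x.1.1 * primeLength x ^ n * Real.exp (-primeLength x * σ) := by
  refine Summable.of_nonneg_of_le (fun x => ?_) (fun x => ?_)
    ((summable_logNorm_mul_exp (K := K) hσ (n + 1)).comp_injective primePower_injective)
  · have h1 := logNorm_nonneg x.1.1
    have h2 : 0 ≤ primeLength x := by
      rw [primeLength]
      positivity
    positivity
  · have h1 := logNorm_nonneg x.1.1
    have h3 : logNorm x.1.1 ≤ primeLength x := by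
      rw [primeLength]
      nlinarith [(Nat.cast_nonneg x.2 : (0 : ℝ) ≤ x.2)]
    have h2 : 0 ≤ primeLength x := h1.trans h3
    change _ ≤ logNorm (x.1.1 ^ (x.2 + 1)) ^ (n + 1) * Real.exp (-logNorm (x.1.1 ^ (x.2 + 1)) * σ)
    rw [← primeLength_eq, pow_succ']
    gcongr

/-- Multiplication of an ideal by a prime power, remembering the prime power. -/
def mulPrimePower (y : (FinitePlace' K × ℕ) × NonzeroIdeal K) :
    NonzeroIdeal K × (FinitePlace' K × ℕ) :=
  (⟨(primePower y.1).1 * y.2.1, mul_ne_zero (primePower y.1).2 y.2.2⟩, y.1)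

theorem mulPrimePower_injective : Function.Injective (mulPrimePower (K := K)) := by
  rintro ⟨x, J⟩ ⟨x', J'⟩ h
  have h1 : x = x' := congrArg Prod.snd h
  subst h1
  have h2 : (primePower x).1 * J.1 = (primePower x).1 * J'.1 :=
    Subtype.ext_iff.mp (congrArg Prod.fst h)
  exact Prod.ext rfl (Subtype.ext (mul_left_cancel₀ (primePower x).2 h2))

/-- The von Mangoldt weight of the prime power `x` as a divisor of the ideal `I`. -/
def divisorWeight (y : NonzeroIdeal K × (FinitePlace' K × ℕ)) : ℝ :=
  if y.2.1.1 ^ (y.2.2 + 1) ∣ y.1.1 then logNorm y.2.1.1 else 0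

theorem divisorWeight_eq_zero {y : NonzeroIdeal K × (FinitePlace' K × ℕ)}
    (hy : y ∉ Set.range mulPrimePower) : divisorWeight y = 0 := by
  refine if_neg ?_
  rintro ⟨J, hJ⟩
  have hJ0 : J ≠ ⊥ := by
    rintro rfl
    rw [Ideal.mul_bot] at hJ
    exact y.1.2 hJ
  exact hy ⟨(y.2, ⟨J, hJ0⟩), Prod.ext (Subtype.ext hJ.symm) rfl⟩

theorem divisorWeight_mulPrimePower (y : (FinitePlace' K × ℕ) × NonzeroIdeal K) :
    divisorWeight (mulPrimePower y) = logNorm y.1.1.1 :=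
  if_pos (Dvd.intro _ rfl)

theorem logNorm_mulPrimePower (y : (FinitePlace' K × ℕ) × NonzeroIdeal K) :
    logNorm (mulPrimePower y).1.1 = primeLength y.1 + logNorm y.2.1 := by
  rw [primeLength_eq]
  exact logNorm_mul (primePower y.1).2 y.2.2

theorem hasSum_divisorWeight (I : NonzeroIdeal K) :
    HasSum (fun x => divisorWeight (I, x)) (logNorm I.1) :=
  hasSum_logNorm I

theorem hasSum_mul_of_summable_norm {ι ι' : Type*} {f : ι → ℂ} {g : ι' → ℂ} {a b : ℂ}
    (hf : HasSum f a) (hg : HasSum g b) (hf' : Summable fun i => ‖f i‖)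
    (hg' : Summable fun i => ‖g i‖) : HasSum (fun x : ι × ι' => f x.1 * g x.2) (a * b) :=
  hf.mul hg (summable_mul_of_summable_norm hf' hg')

/-- The logarithmic derivative of the Dedekind zeta function, up to sign. -/
theorem IsZeta.hasSum_mangoldt {Z : ℂ → ℂ} (hZ : IsZeta K Z) {s : ℂ} (hs : 1 < s.re) :
    ∃ L : ℂ, HasSum (fun x : FinitePlace' K × ℕ =>
      (logNorm x.1.1 : ℂ) * Complex.exp (-(primeLength x : ℂ) * s)) L ∧ -deriv Z s = L * Z s := by
  have hn : Summable fun x : FinitePlace' K × ℕ =>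
      ‖(logNorm x.1.1 : ℂ) * Complex.exp (-(primeLength x : ℂ) * s)‖ := by
    convert! summable_primeLength (K := K) hs 0 using 2 with x
    rw [norm_mul, norm_exp_neg_mul, Complex.norm_real, Real.norm_of_nonneg (logNorm_nonneg _),
      pow_zero, mul_one]
  refine ⟨_, hn.of_norm.hasSum, ?_⟩
  have hprod := hasSum_mul_of_summable_norm hn.of_norm.hasSum (hZ.hasSum hs) hn
    (summable_norm_exp_neg_logNorm hs)
  let G : NonzeroIdeal K × (FinitePlace' K × ℕ) → ℂ := fun y =>
    (divisorWeight y : ℂ) * Complex.exp (-(logNorm y.1.1 : ℂ) * s)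
  have hG0 : ∀ y ∉ Set.range mulPrimePower, G y = 0 := fun y hy => by
    simp only [G]
    rw [divisorWeight_eq_zero hy, Complex.ofReal_zero, zero_mul]
  have hGg : (fun y => (logNorm y.1.1.1 : ℂ) * Complex.exp (-(primeLength y.1 : ℂ) * s) *
      Complex.exp (-(logNorm y.2.1 : ℂ) * s)) = G ∘ mulPrimePower := by
    funext y
    rw [Function.comp_apply, show G (mulPrimePower y) = _ * _ from rfl, logNorm_mulPrimePower,
      divisorWeight_mulPrimePower, mul_assoc, ← Complex.exp_add]
    push_cast
    ring_nf
  rw [hGg] at hprod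
  have h1 := (mulPrimePower_injective.hasSum_iff hG0).mp hprod
  have h2 := h1.prod_fiberwise fun I => (Complex.hasSum_ofReal.mpr (hasSum_divisorWeight I)).mul_right
    (Complex.exp (-(logNorm I.1 : ℂ) * s))
  exact (hZ.hasSum_deriv hs).unique h2

end

end ExplicitFormula

namespace ExplicitFormula

open MeasureTheory Filter Topology
open NumberField NumberField.Units NumberField.Units.dirichletUnitTheorem nonZeroDivisors Module
open scoped ENNReal Classical

variable {K : Type*} [Field K] [NumberField K]

noncomputable section

theorem tendsto_sub_mul_logDeriv {f u : ℂ → ℂ} {a : ℂ} {n : ℤ} (hu : AnalyticAt ℂ u a)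
    (hu0 : u a ≠ 0) (h : ∀ᶠ z in 𝓝[≠] a, f z = (z - a) ^ n * u z) :
    Tendsto (fun z => (z - a) * logDeriv f z) (𝓝[≠] a) (𝓝 n) := by
  have h1 : Tendsto (fun z => (n : ℂ) + (z - a) * logDeriv u z) (𝓝[≠] a) (𝓝 n) := by
    have h2 : ContinuousAt (fun z => (n : ℂ) + (z - a) * logDeriv u z) a := by
      have : ContinuousAt (logDeriv u) a := hu.deriv.continuousAt.div hu.continuousAt hu0
      fun_prop
    have h3 := h2.tendsto.mono_left (nhdsWithin_le_nhds (s := {a}ᶜ))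
    simpa using h3
  refine h1.congr' ?_
  have h4 : ∀ᶠ z in 𝓝[≠] a, AnalyticAt ℂ u z ∧ u z ≠ 0 :=
    (hu.eventually_analyticAt.and (hu.continuousAt.eventually_ne hu0)).filter_mono
      nhdsWithin_le_nhds
  filter_upwards [eventually_eventually_nhdsWithin.mpr h, h4, self_mem_nhdsWithin]
    with z hz hz4 hza
  have hza' : z - a ≠ 0 := sub_ne_zero.mpr hza
  have e : f =ᶠ[𝓝 z] fun z => (z - a) ^ n * u z := by
    have : 𝓝[≠] a ≤ 𝓝[≠] a := le_rfl
    rw [IsOpen.nhdsWithin_eq isOpen_compl_singleton hza] at hz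
    exact hz
  have hl : logDeriv f z = logDeriv (fun z => (z - a) ^ n * u z) z := by
    rw [logDeriv_apply, logDeriv_apply, e.deriv_eq, e.eq_of_nhds]
  have hd : DifferentiableAt ℂ (fun z : ℂ => z - a) z := by fun_prop
  rw [hl, logDeriv_mul (f := fun z => (z - a) ^ n) (g := u) z (zpow_ne_zero n hza') hz4.2 (hd.zpow (Or.inl hza'))
    hz4.1.differentiableAt]
  have h5 := logDeriv_fun_zpow (f := fun z : ℂ => z - a) (x := z) hd n
  rw [h5, logDeriv_apply, logDeriv_apply, deriv_sub_const, deriv_id'', mul_add]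
  congr 1
  field_simp

theorem tendsto_add_mul_I (t : ℝ) :
    Tendsto (fun σ : ℝ => (σ : ℂ) + t * Complex.I) (𝓝[>] 1) (𝓝[≠] (1 + t * Complex.I)) := by
  refine tendsto_nhdsWithin_of_tendsto_nhds_of_eventually_within _ ?_ ?_
  · have : Continuous fun σ : ℝ => (σ : ℂ) + t * Complex.I := by fun_prop
    have h := (this.tendsto 1).mono_left (nhdsWithin_le_nhds (s := Set.Ioi 1))
    simpa using h
  · filter_upwards [self_mem_nhdsWithin] with σ hσ h
    have h1 : (σ : ℂ) = 1 := add_right_cancel h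
    have h2 : σ = 1 := by exact_mod_cast h1
    exact (Set.mem_Ioi.mp hσ).ne' h2

/-- The Dirichlet series of `-ζ_K' / ζ_K`. -/
def mangoldtSum (K : Type*) [Field K] [NumberField K] (s : ℂ) : ℂ :=
  ∑' x : FinitePlace' K × ℕ, (logNorm x.1.1 : ℂ) * Complex.exp (-(primeLength x : ℂ) * s)

theorem primeLength_nonneg (x : FinitePlace' K × ℕ) : 0 ≤ primeLength x := by
  have := logNorm_nonneg x.1.1
  rw [primeLength]
  positivity

theorem norm_mangoldt_term (x : FinitePlace' K × ℕ) (s : ℂ) :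
    ‖(logNorm x.1.1 : ℂ) * Complex.exp (-(primeLength x : ℂ) * s)‖ =
      logNorm x.1.1 * primeLength x ^ 0 * Real.exp (-primeLength x * s.re) := by
  rw [norm_mul, norm_exp_neg_mul, Complex.norm_real, Real.norm_of_nonneg (logNorm_nonneg _),
    pow_zero, mul_one]

theorem summable_mangoldt {s : ℂ} (hs : 1 < s.re) : Summable fun x : FinitePlace' K × ℕ =>
    (logNorm x.1.1 : ℂ) * Complex.exp (-(primeLength x : ℂ) * s) := by
  refine Summable.of_norm ?_
  simp only [norm_mangoldt_term]
  exact summable_primeLength hs 0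

theorem norm_mangoldtSum_le {σ : ℝ} (hσ : 1 < σ) {s : ℂ} (hs : σ ≤ s.re) :
    ‖mangoldtSum K s‖ ≤ ∑' x : FinitePlace' K × ℕ,
      logNorm x.1.1 * primeLength x ^ 0 * Real.exp (-primeLength x * σ) := by
  refine tsum_of_norm_bounded (summable_primeLength hσ 0).hasSum fun x => ?_
  rw [norm_mangoldt_term]
  have h1 := logNorm_nonneg x.1.1
  have h2 := primeLength_nonneg x
  refine mul_le_mul_of_nonneg_left (Real.exp_le_exp.mpr (by nlinarith)) (by positivity)

theorem hasSum_deriv_mangoldtSum {s : ℂ} (hs : 1 < s.re) :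
    HasSum (fun x : FinitePlace' K × ℕ => (logNorm x.1.1 : ℂ) * (primeLength x : ℂ) *
      Complex.exp (-(primeLength x : ℂ) * s)) (-deriv (mangoldtSum K) s) := by
  obtain ⟨σ, h1, h2⟩ := exists_between hs
  have h := Complex.hasSum_deriv_of_summable_norm (ι := FinitePlace' K × ℕ)
    (F := fun x s => (logNorm x.1.1 : ℂ) * Complex.exp (-(primeLength x : ℂ) * s))
    (U := {s : ℂ | σ < s.re}) (z := s)
    (summable_primeLength h1 0) (fun I => by fun_prop) (isOpen_re_gt σ) (fun x w hw => by
      rw [norm_mangoldt_term]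
      have h1 := logNorm_nonneg x.1.1
      have h2 := primeLength_nonneg x
      have hw' : σ < w.re := hw
      refine mul_le_mul_of_nonneg_left (Real.exp_le_exp.mpr (by nlinarith)) (by positivity)) h2
  convert! h.neg using 2 with x
  rw [(((hasDerivAt_id' s).const_mul (-(primeLength x : ℂ))).cexp.const_mul _).deriv]
  ring

theorem IsZeta.neg_deriv {Z : ℂ → ℂ} (hZ : IsZeta K Z) {s : ℂ} (hs : 1 < s.re) :
    -deriv Z s = mangoldtSum K s * Z s := by
  obtain ⟨L, h1, h2⟩ := hZ.hasSum_mangoldt hs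
  rw [h2, mangoldtSum, h1.tsum_eq]

theorem IsZeta.logDeriv_eq {Z : ℂ → ℂ} (hZ : IsZeta K Z) {s : ℂ} (hs : 1 < s.re) (h0 : Z s ≠ 0) :
    logDeriv Z s = -mangoldtSum K s := by
  rw [logDeriv_apply, div_eq_iff h0, neg_mul, ← hZ.neg_deriv hs, neg_neg]

theorem IsZeta.apply_two_ne_zero {Z : ℂ → ℂ} (hZ : IsZeta K Z) : Z 2 ≠ 0 := by
  have h1 : (1 : ℝ) < (2 : ℂ).re := by norm_num
  have h2 := hZ.hasSum h1
  have h3 := Complex.hasSum_re h2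
  intro h
  rw [h, Complex.zero_re] at h3
  have hre : ∀ I : NonzeroIdeal K, (Complex.exp (-(logNorm I.1 : ℂ) * 2)).re =
      Real.exp (-logNorm I.1 * 2) := fun I => by
    rw [show (-(logNorm I.1 : ℂ) * 2) = ((-logNorm I.1 * 2 : ℝ) : ℂ) by push_cast; ring,
      ← Complex.ofReal_exp, Complex.ofReal_re]
  simp only [hre] at h3
  have h4 := (hasSum_zero_iff_of_nonneg fun I => (Real.exp_pos _).le).mp h3
  have h5 := congrFun h4 ⟨⊤, top_ne_bot⟩
  exact (Real.exp_pos _).ne' h5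

theorem IsZeta.exists_factor {Z : ℂ → ℂ} (hZ : IsZeta K Z) (hZa : ∀ s ≠ 1, AnalyticAt ℂ Z s)
    {a : ℂ} (ha : a ≠ 1) : ∃ (n : ℕ) (u : ℂ → ℂ), AnalyticAt ℂ u a ∧ u a ≠ 0 ∧
      ∀ᶠ z in 𝓝 a, Z z = (z - a) ^ n * u z := by
  have hord : analyticOrderAt Z a ≠ ⊤ := fun h => by
    have hpre : IsPreconnected ({1}ᶜ : Set ℂ) :=
      (isConnected_compl_singleton_of_one_lt_rank (by simp) 1).isPreconnected
    have h1 := AnalyticOnNhd.eqOn_zero_of_preconnected_of_eventuallyEq_zero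
      (f := Z) (U := {1}ᶜ) (fun z hz => hZa z hz) hpre ha (analyticOrderAt_eq_top.mp h)
    exact hZ.apply_two_ne_zero (h1 (by norm_num : (2 : ℂ) ∈ ({1}ᶜ : Set ℂ)))
  obtain ⟨u, hu, hu0, h⟩ := (hZa a ha).analyticOrderAt_ne_top.mp hord
  exact ⟨_, u, hu, hu0, h⟩

theorem factor_tendsto {Z u : ℂ → ℂ} {a : ℂ} {n : ℕ} (hu : AnalyticAt ℂ u a) (hu0 : u a ≠ 0)
    (h : ∀ᶠ z in 𝓝 a, Z z = (z - a) ^ n * u z) :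
    Tendsto (fun z => (z - a) * logDeriv Z z) (𝓝[≠] a) (𝓝 n) := by
  have := tendsto_sub_mul_logDeriv (n := n) hu hu0 (h.filter_mono nhdsWithin_le_nhds)
  exact_mod_cast this

theorem IsZeta.ne_zero_of_one_lt {Z : ℂ → ℂ} (hZ : IsZeta K Z) (hZa : ∀ s ≠ 1, AnalyticAt ℂ Z s)
    {a : ℂ} (ha : 1 < a.re) : Z a ≠ 0 := by
  have ha1 : a ≠ 1 := fun h => by simp [h] at ha
  obtain ⟨n, u, hu, hu0, h⟩ := hZ.exists_factor hZa ha1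
  obtain ⟨σ, h1, h2⟩ := exists_between ha
  have hne : ∀ᶠ z in 𝓝[≠] a, Z z ≠ 0 := by
    filter_upwards [h.filter_mono nhdsWithin_le_nhds, self_mem_nhdsWithin,
      (hu.continuousAt.eventually_ne hu0).filter_mono nhdsWithin_le_nhds] with z hz hza hzu
    rw [hz]
    exact mul_ne_zero (pow_ne_zero _ (sub_ne_zero.mpr hza)) hzu
  have hlim := factor_tendsto hu hu0 h
  have h0 : Tendsto (fun z => (z - a) * logDeriv Z z) (𝓝[≠] a) (𝓝 0) := by
    have hsub : Tendsto (fun z : ℂ => ‖z - a‖ * ∑' x : FinitePlace' K × ℕ,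
        logNorm x.1.1 * primeLength x ^ 0 * Real.exp (-primeLength x * σ)) (𝓝[≠] a) (𝓝 0) := by
      have : Continuous fun z : ℂ => ‖z - a‖ * ∑' x : FinitePlace' K × ℕ,
        logNorm x.1.1 * primeLength x ^ 0 * Real.exp (-primeLength x * σ) := by fun_prop
      have h := (this.tendsto a).mono_left (nhdsWithin_le_nhds (s := {a}ᶜ))
      simpa using h
    refine squeeze_zero_norm' ?_ hsub
    filter_upwards [hne, ((isOpen_re_gt σ).mem_nhds h2 : _ ∈ 𝓝 a) |> mem_nhdsWithin_of_mem_nhds]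
      with z hz hzσ
    rw [hZ.logDeriv_eq (h1.trans hzσ) hz, norm_mul, norm_neg]
    gcongr
    exact norm_mangoldtSum_le h1 (le_of_lt hzσ)
  have hn : (n : ℂ) = 0 := tendsto_nhds_unique hlim h0
  have hn0 : n = 0 := by exact_mod_cast hn
  have := h.self_of_nhds
  rw [this, hn0, pow_zero, one_mul]
  exact hu0

theorem mangoldtSum_three_four_one {σ : ℝ} (hσ : 1 < σ) (t : ℝ) :
    0 ≤ (3 * mangoldtSum K (σ + (0 : ℝ) * Complex.I) + 4 * mangoldtSum K (σ + t * Complex.I) +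
      mangoldtSum K (σ + (2 * t : ℝ) * Complex.I)).re := by
  have hs : ∀ y : ℝ, (1 : ℝ) < ((σ : ℂ) + y * Complex.I).re := fun y => by simpa using hσ
  have h := (((summable_mangoldt (K := K) (hs 0)).hasSum.mul_left 3).add
    ((summable_mangoldt (hs t)).hasSum.mul_left 4)).add (summable_mangoldt (hs (2 * t))).hasSum
  refine (Complex.hasSum_re h).nonneg fun x => ?_
  have hre : ∀ y : ℝ, ((logNorm x.1.1 : ℂ) *
      Complex.exp (-(primeLength x : ℂ) * (σ + y * Complex.I))).re =
      logNorm x.1.1 * Real.exp (-primeLength x * σ) * Real.cos (primeLength x * y) := fun y => by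
    rw [Complex.re_ofReal_mul, Complex.exp_re]
    simp
    ring
  have h3 : ((3 : ℂ) * ((logNorm x.1.1 : ℂ) *
      Complex.exp (-(primeLength x : ℂ) * (σ + (0 : ℝ) * Complex.I)))).re =
      3 * (logNorm x.1.1 * Real.exp (-primeLength x * σ)) := by
    rw [show (3 : ℂ) = ((3 : ℝ) : ℂ) by norm_num, Complex.re_ofReal_mul, hre]
    simp
  have h4 : ((4 : ℂ) * ((logNorm x.1.1 : ℂ) *
      Complex.exp (-(primeLength x : ℂ) * (σ + t * Complex.I)))).re =
      4 * (logNorm x.1.1 * Real.exp (-primeLength x * σ) * Real.cos (primeLength x * t)) := by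
    rw [show (4 : ℂ) = ((4 : ℝ) : ℂ) by norm_num, Complex.re_ofReal_mul, hre]
  rw [Complex.add_re, Complex.add_re, h3, h4, hre (2 * t),
    show primeLength x * (2 * t) = 2 * (primeLength x * t) by ring, Real.cos_two_mul]
  have h5 : 0 ≤ logNorm x.1.1 * Real.exp (-primeLength x * σ) :=
    mul_nonneg (logNorm_nonneg _) (Real.exp_pos _).le
  nlinarith [mul_nonneg h5 (sq_nonneg (1 + Real.cos (primeLength x * t)))]

/-- The product of the Gamma factors, inverted. -/
def invGammaFactor (K : Type*) [Field K] [NumberField K] (s : ℂ) : ℂ :=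
  ∏ w : InfinitePlace K, (Complex.Gamma (s * w.mult / 2))⁻¹

theorem differentiable_invGammaFactor : Differentiable ℂ (invGammaFactor K) :=
  Differentiable.fun_finsetProd fun w _ =>
    Complex.differentiable_one_div_Gamma.comp (by fun_prop : Differentiable ℂ
      fun s : ℂ => s * w.mult / 2)

theorem re_mul_mult_pos {K : Type*} [Field K] {s : ℂ} (hs : 0 < s.re) (w : InfinitePlace K) :
    0 < (s * w.mult / 2).re := by
  rw [mul_div_assoc, show (w.mult : ℂ) / 2 = ((w.mult / 2 : ℝ) : ℂ) by push_cast; rfl,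
    Complex.re_mul_ofReal]
  have : (0 : ℝ) < w.mult := by exact_mod_cast InfinitePlace.mult_pos
  positivity

theorem invGammaFactor_ne_zero {s : ℂ} (hs : 0 < s.re) : invGammaFactor K s ≠ 0 :=
  Finset.prod_ne_zero_iff.mpr fun w _ =>
    inv_ne_zero (Complex.Gamma_ne_zero_of_re_pos (re_mul_mult_pos hs w))

theorem IsZeta.tendsto_one {Z : ℂ → ℂ} (hZ : IsZeta K Z) (hZa : ∀ s ≠ 1, AnalyticAt ℂ Z s) :
    Tendsto (fun z => (z - 1) * logDeriv Z z) (𝓝[≠] 1) (𝓝 (-1)) := by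
  obtain ⟨C, hC, b, h⟩ := exists_xiFun_mul_prod_inv_Gamma K
  have hC' : (C : ℂ) ≠ 0 := by exact_mod_cast hC.ne'
  let u : ℂ → ℂ := fun s => xiFun K s * invGammaFactor K s / (C * Complex.exp (b * s) * s)
  have h1 : (C : ℂ) * Complex.exp (b * 1) * 1 ≠ 0 := by simp [hC']
  have hu : AnalyticAt ℂ u 1 := by
    refine (((differentiable_xiFun.analyticAt 1).mul
      (differentiable_invGammaFactor.analyticAt 1)).div ?_ h1)
    have : Differentiable ℂ fun s : ℂ => (C : ℂ) * Complex.exp (b * s) * s := by fun_prop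
    exact this.analyticAt 1
  have hu0 : u 1 ≠ 0 :=
    div_ne_zero (mul_ne_zero xiFun_one_ne_zero (invGammaFactor_ne_zero (by norm_num))) h1
  have := tendsto_sub_mul_logDeriv (f := Z) (n := -1) hu hu0 ?_
  · simpa using this
  · filter_upwards [self_mem_nhdsWithin,
      (continuousAt_id.eventually_ne (one_ne_zero (α := ℂ))).filter_mono nhdsWithin_le_nhds]
      with z hz hz0
    have h2 := h Z hZa hZ z hz
    have hz1 : z - 1 ≠ 0 := sub_ne_zero.mpr hz
    have hz0' : z ≠ 0 := hz0
    have he := Complex.exp_ne_zero (b * z)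
    simp only [u]
    rw [invGammaFactor, h2, zpow_neg_one]
    field_simp

theorem IsZeta.ne_zero_of_re_eq_one {Z : ℂ → ℂ} (hZ : IsZeta K Z)
    (hZa : ∀ s ≠ 1, AnalyticAt ℂ Z s) {t : ℝ} (ht : t ≠ 0) : Z (1 + t * Complex.I) ≠ 0 := by
  have hne : ∀ y : ℝ, y ≠ 0 → (1 : ℂ) + y * Complex.I ≠ 1 := fun y hy h => by
    have := congrArg Complex.im h
    simp at this
    exact hy this
  obtain ⟨n, u, hu, hu0, h⟩ := hZ.exists_factor hZa (hne t ht)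
  obtain ⟨n', u', hu', hu0', h'⟩ := hZ.exists_factor hZa
    (hne (2 * t) (mul_ne_zero two_ne_zero ht))
  have l1 := (factor_tendsto hu hu0 h).comp (tendsto_add_mul_I t)
  have l2 := (factor_tendsto hu' hu0' h').comp (tendsto_add_mul_I (2 * t))
  have l0 : Tendsto _ _ _ := (hZ.tendsto_one hZa).comp (by simpa using tendsto_add_mul_I 0 :
    Tendsto (fun σ : ℝ => (σ : ℂ) + (0 : ℝ) * Complex.I) (𝓝[>] 1) (𝓝[≠] (1 : ℂ)))
  have l := Complex.continuous_re.tendsto _ |>.comp (((l0.const_mul 3).add (l1.const_mul 4)).add l2)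
  have hle : (3 * (-1) + 4 * (n : ℂ) + n').re ≤ 0 := by
    refine le_of_tendsto l ?_
    filter_upwards [self_mem_nhdsWithin] with σ hσ
    have hσ' : 1 < σ := hσ
    have hld : ∀ y : ℝ, logDeriv Z (σ + y * Complex.I) = -mangoldtSum K (σ + y * Complex.I) :=
      fun y => by
        have hs : (1 : ℝ) < ((σ : ℂ) + y * Complex.I).re := by simpa using hσ'
        exact hZ.logDeriv_eq hs (hZ.ne_zero_of_one_lt hZa hs)
    have h3 := mangoldtSum_three_four_one (K := K) hσ' t
    simp only [Function.comp_apply, hld]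
    have e : 3 * (((σ : ℂ) + (0 : ℝ) * Complex.I - 1) *
        -mangoldtSum K (σ + (0 : ℝ) * Complex.I)) +
        4 * (((σ : ℂ) + t * Complex.I - (1 + t * Complex.I)) *
          -mangoldtSum K (σ + t * Complex.I)) +
        ((σ : ℂ) + (2 * t : ℝ) * Complex.I - (1 + (2 * t : ℝ) * Complex.I)) *
          -mangoldtSum K (σ + (2 * t : ℝ) * Complex.I) =
        ((-(σ - 1) : ℝ) : ℂ) * (3 * mangoldtSum K (σ + (0 : ℝ) * Complex.I) +
          4 * mangoldtSum K (σ + t * Complex.I) + mangoldtSum K (σ + (2 * t : ℝ) * Complex.I)) := by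
      push_cast
      ring
    rw [e, Complex.re_ofReal_mul]
    nlinarith
  have hn : n = 0 := by
    have e : (3 * (-1) + 4 * (n : ℂ) + n').re = 3 * (-1) + 4 * (n : ℝ) + n' := by simp
    rw [e] at hle
    by_contra hn
    have : (1 : ℝ) ≤ n := by exact_mod_cast Nat.one_le_iff_ne_zero.mpr hn
    linarith [(Nat.cast_nonneg n' : (0 : ℝ) ≤ n')]
  rw [h.self_of_nhds, hn, pow_zero, one_mul]
  exact hu0

end

end ExplicitFormula

namespace ExplicitFormula

open MeasureTheory Filter Topology
open NumberField NumberField.Units NumberField.Units.dirichletUnitTheorem nonZeroDivisors Module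
open scoped ENNReal Classical

variable {K : Type*} [Field K] [NumberField K]

noncomputable section

theorem IsZeta.ne_zero_of_one_le {Z : ℂ → ℂ} (hZ : IsZeta K Z) (hZa : ∀ s ≠ 1, AnalyticAt ℂ Z s)
    {s : ℂ} (hs : 1 ≤ s.re) (hs1 : s ≠ 1) : Z s ≠ 0 := by
  rcases hs.lt_or_eq with h | h
  · exact hZ.ne_zero_of_one_lt hZa h
  · have e : s = 1 + s.im * Complex.I := Complex.ext (by simp [← h]) (by simp)
    have hi : s.im ≠ 0 := fun h0 => hs1 (by rw [e, h0]; simp)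
    rw [e]
    exact hZ.ne_zero_of_re_eq_one hZa hi

theorem exists_xiFun_mul_invGammaFactor (K : Type*) [Field K] [NumberField K] :
    ∃ C b : ℂ, C ≠ 0 ∧ ∀ Z, IsZeta K Z → (∀ s ≠ 1, AnalyticAt ℂ Z s) → ∀ s ≠ 1,
      xiFun K s * invGammaFactor K s = C * Complex.exp (b * s) * (s * (s - 1)) * Z s := by
  obtain ⟨C, hC, b, h⟩ := exists_xiFun_mul_prod_inv_Gamma K
  exact ⟨C, b, by exact_mod_cast hC.ne', fun Z hZ hZa s hs => h Z hZa hZ s hs⟩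

theorem ne_zero_and_ne_one_of_strip {s : ℂ} (h0 : 0 < s.re) (h1 : s.re < 1) : s ≠ 0 ∧ s ≠ 1 :=
  ⟨fun h => by simp [h] at h0, fun h => by simp [h] at h1⟩

theorem IsZeta.xiFun_ne_zero {Z : ℂ → ℂ} (hZ : IsZeta K Z) (hZa : ∀ s ≠ 1, AnalyticAt ℂ Z s)
    {s : ℂ} (hs : 1 ≤ s.re) : xiFun K s ≠ 0 := by
  by_cases hs1 : s = 1
  · rw [hs1]
    exact xiFun_one_ne_zero
  obtain ⟨C, b, hC, h⟩ := exists_xiFun_mul_invGammaFactor K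
  have hs0 : s ≠ 0 := fun h => by norm_num [h] at hs
  have h1 := h Z hZ hZa s hs1
  intro h2
  rw [h2, zero_mul] at h1
  exact mul_ne_zero (mul_ne_zero (mul_ne_zero hC (Complex.exp_ne_zero _))
    (mul_ne_zero hs0 (sub_ne_zero.mpr hs1))) (hZ.ne_zero_of_one_le hZa hs hs1) h1.symm

theorem IsZeta.xiFun_eq_zero_iff {Z : ℂ → ℂ} (hZ : IsZeta K Z)
    (hZa : ∀ s ≠ 1, AnalyticAt ℂ Z s) (s : ℂ) :
    xiFun K s = 0 ↔ 0 < s.re ∧ s.re < 1 ∧ Z s = 0 := by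
  obtain ⟨C, b, hC, h⟩ := exists_xiFun_mul_invGammaFactor K
  constructor
  · intro hs
    have h1 : s.re < 1 := by
      by_contra! h1
      exact hZ.xiFun_ne_zero hZa h1 hs
    have h0 : 0 < s.re := by
      by_contra! h0
      refine hZ.xiFun_ne_zero (s := 1 - s) hZa (by simpa using h0) ?_
      rw [xiFun_one_sub, hs]
    obtain ⟨hs0, hs1⟩ := ne_zero_and_ne_one_of_strip h0 h1
    refine ⟨h0, h1, ?_⟩
    have h2 := h Z hZ hZa s hs1
    rw [hs, zero_mul, eq_comm] at h2
    exact (mul_eq_zero.mp h2).resolve_left (mul_ne_zero (mul_ne_zero hC (Complex.exp_ne_zero _))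
      (mul_ne_zero hs0 (sub_ne_zero.mpr hs1)))
  · rintro ⟨h0, h1, hs⟩
    obtain ⟨hs0, hs1⟩ := ne_zero_and_ne_one_of_strip h0 h1
    have h2 := h Z hZ hZa s hs1
    rw [hs, mul_zero] at h2
    exact (mul_eq_zero.mp h2).resolve_right (invGammaFactor_ne_zero h0)

theorem IsZeta.analyticOrderNatAt_xiFun {Z : ℂ → ℂ} (hZ : IsZeta K Z)
    (hZa : ∀ s ≠ 1, AnalyticAt ℂ Z s) {s : ℂ} (h0 : 0 < s.re) (h1 : s.re < 1) {n : ℕ}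
    {g : ℂ → ℂ} (hg : AnalyticAt ℂ g s) (hgs : g s ≠ 0)
    (hZs : ∀ᶠ z in 𝓝 s, Z z = (z - s) ^ n * g z) : analyticOrderNatAt (xiFun K) s = n := by
  obtain ⟨C, b, hC, h⟩ := exists_xiFun_mul_invGammaFactor K
  obtain ⟨hs0, hs1⟩ := ne_zero_and_ne_one_of_strip h0 h1
  have hG := invGammaFactor_ne_zero (K := K) h0
  have hord : analyticOrderAt (xiFun K) s = n := by
    rw [(differentiable_xiFun.analyticAt s).analyticOrderAt_eq_natCast]
    refine ⟨fun z => C * Complex.exp (b * z) * (z * (z - 1)) / invGammaFactor K z * g z,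
      ?_, ?_, ?_⟩
    · have : Differentiable ℂ fun z => C * Complex.exp (b * z) * (z * (z - 1)) := by fun_prop
      exact ((this.analyticAt s).div (differentiable_invGammaFactor.analyticAt s) hG).mul hg
    · exact mul_ne_zero (div_ne_zero (mul_ne_zero (mul_ne_zero hC (Complex.exp_ne_zero _))
        (mul_ne_zero hs0 (sub_ne_zero.mpr hs1))) hG) hgs
    · filter_upwards [hZs, continuousAt_id.eventually_ne hs1,
        differentiable_invGammaFactor.continuous.continuousAt.eventually_ne hG] with z hz hz1 hzG
      have h2 := h Z hZ hZa z hz1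
      rw [hz] at h2
      rw [smul_eq_mul, div_mul_eq_mul_div, mul_div_assoc', eq_div_iff hzG, h2]
      ring
  rw [analyticOrderNatAt, hord, ENat.toNat_natCast]

theorem logDeriv_invGammaFactor {s : ℂ} (hs : 0 < s.re) :
    logDeriv (invGammaFactor K) s =
      -∑ w : InfinitePlace K, (w.mult / 2 : ℂ) * Complex.digamma (s * w.mult / 2) := by
  have hG : ∀ w : InfinitePlace K, DifferentiableAt ℂ Complex.Gamma (s * w.mult / 2) := fun w =>
    Complex.differentiableAt_Gamma _ fun m h => by
      have h1 := re_mul_mult_pos hs w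
      rw [h, Complex.neg_re, Complex.natCast_re] at h1
      linarith [(Nat.cast_nonneg m : (0 : ℝ) ≤ m)]
  have hl : ∀ w : InfinitePlace K, HasDerivAt (fun s : ℂ => s * w.mult / 2) (w.mult / 2 : ℂ) s :=
    fun w => by simpa using ((hasDerivAt_id' s).mul_const (w.mult : ℂ)).div_const 2
  have h1 : invGammaFactor K = fun s => ∏ w : InfinitePlace K,
      (fun (w : InfinitePlace K) (s : ℂ) => (Complex.Gamma (s * w.mult / 2))⁻¹) w s := rfl
  rw [h1, logDeriv_prod (f := fun (w : InfinitePlace K) (s : ℂ) =>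
      (Complex.Gamma (s * w.mult / 2))⁻¹), ← Finset.sum_neg_distrib]
  · refine Finset.sum_congr rfl fun w _ => ?_
    have h2 := (hG w).hasDerivAt.comp s (hl w)
    have h3 := h2.inv (Complex.Gamma_ne_zero_of_re_pos (re_mul_mult_pos hs w))
    have h4 := Complex.Gamma_ne_zero_of_re_pos (re_mul_mult_pos hs w)
    rw [logDeriv_apply, Complex.digamma_def, logDeriv_apply]
    have h5 : deriv (fun s : ℂ => (Complex.Gamma (s * w.mult / 2))⁻¹) s = _ := h3.deriv
    rw [h5]
    simp only [Function.comp_apply]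
    field_simp
  · exact fun w _ => inv_ne_zero (Complex.Gamma_ne_zero_of_re_pos (re_mul_mult_pos hs w))
  · intro w _
    exact (((hG w).hasDerivAt.comp s (hl w)).inv
      (Complex.Gamma_ne_zero_of_re_pos (re_mul_mult_pos hs w))).differentiableAt

theorem IsZeta.exists_logDeriv_xiFun {Z : ℂ → ℂ} (hZ : IsZeta K Z)
    (hZa : ∀ s ≠ 1, AnalyticAt ℂ Z s) : ∃ b : ℂ, ∀ s : ℂ, 1 < s.re → logDeriv (xiFun K) s =
      b + s⁻¹ + (s - 1)⁻¹ + logDeriv Z s +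
        ∑ w : InfinitePlace K, (w.mult / 2 : ℂ) * Complex.digamma (s * w.mult / 2) := by
  obtain ⟨C, b, hC, h⟩ := exists_xiFun_mul_invGammaFactor K
  refine ⟨b, fun s hs => ?_⟩
  have hs0 : s ≠ 0 := fun h => by norm_num [h] at hs
  have hs1 : s ≠ 1 := fun h => by simp [h] at hs
  have hs1' := sub_ne_zero.mpr hs1
  have hpos : 0 < s.re := by linarith
  have hG := invGammaFactor_ne_zero (K := K) hpos
  have hZs := hZ.ne_zero_of_one_lt hZa hs
  have hx := hZ.xiFun_ne_zero hZa hs.le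
  have he := Complex.exp_ne_zero (b * s)
  have hev : (fun z => xiFun K z * invGammaFactor K z) =ᶠ[𝓝 s]
      fun z => C * Complex.exp (b * z) * (z * (z - 1)) * Z z := by
    filter_upwards [continuousAt_id.eventually_ne hs1] with z hz
    exact h Z hZ hZa z hz
  have h1 : logDeriv (fun z => xiFun K z * invGammaFactor K z) s =
      logDeriv (fun z => C * Complex.exp (b * z) * (z * (z - 1)) * Z z) s := by
    rw [logDeriv_apply, logDeriv_apply, hev.deriv_eq, hev.eq_of_nhds]
  have hd : Differentiable ℂ fun z => C * Complex.exp (b * z) * (z * (z - 1)) := by fun_prop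
  rw [logDeriv_mul (f := xiFun K) (g := invGammaFactor K) s hx hG (differentiable_xiFun s)
    (differentiable_invGammaFactor s), logDeriv_invGammaFactor hpos,
    logDeriv_mul (f := fun z => C * Complex.exp (b * z) * (z * (z - 1))) (g := Z) s
      (by positivity) hZs (hd s) (hZa s hs1).differentiableAt] at h1
  have h2 : logDeriv (fun z => C * Complex.exp (b * z) * (z * (z - 1))) s =
      b + s⁻¹ + (s - 1)⁻¹ := by
    have h3 := ((((hasDerivAt_id' s).const_mul b).cexp.const_mul C).fun_mul
      ((hasDerivAt_id' s).fun_mul ((hasDerivAt_id' s).sub_const 1)))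
    rw [logDeriv_apply, h3.deriv]
    field_simp
    ring
  rw [h2] at h1
  linear_combination h1

/-- The Mittag-Leffler expansion of `(ξ'/ξ)'` compared with the Euler product. -/
theorem IsZeta.deriv_logDeriv_xiFun {Z : ℂ → ℂ} (hZ : IsZeta K Z)
    (hZa : ∀ s ≠ 1, AnalyticAt ℂ Z s) {s : ℂ} (hs : 1 < s.re) :
    -deriv (logDeriv (xiFun K)) s = 1 / s ^ 2 + 1 / (s - 1) ^ 2 - -deriv (mangoldtSum K) s -
      ∑ w : InfinitePlace K, (w.mult / 2 : ℂ) ^ 2 * deriv Complex.digamma (s * w.mult / 2) := by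
  obtain ⟨b, h⟩ := hZ.exists_logDeriv_xiFun hZa
  have hs0 : s ≠ 0 := fun h => by norm_num [h] at hs
  have hs1 : s ≠ 1 := fun h => by simp [h] at hs
  have hs1' := sub_ne_zero.mpr hs1
  have hpos : 0 < s.re := by linarith
  have hopen := (isOpen_re_gt 1).mem_nhds hs
  have hZs := hZ.ne_zero_of_one_lt hZa hs
  have hev : logDeriv (xiFun K) =ᶠ[𝓝 s] fun s => b + s⁻¹ + (s - 1)⁻¹ + logDeriv Z s +
        ∑ w : InfinitePlace K, (w.mult / 2 : ℂ) * Complex.digamma (s * w.mult / 2) := by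
    filter_upwards [hopen] with z hz
    exact h z hz
  have hevZ : logDeriv Z =ᶠ[𝓝 s] fun s => -mangoldtSum K s := by
    filter_upwards [hopen] with z hz
    exact hZ.logDeriv_eq hz (hZ.ne_zero_of_one_lt hZa hz)
  have hdZ : HasDerivAt (logDeriv Z) (-deriv (mangoldtSum K) s) s := by
    have h1 : DifferentiableAt ℂ (logDeriv Z) s :=
      (hZa s hs1).deriv.differentiableAt.div (hZa s hs1).differentiableAt hZs
    have h2 := h1.hasDerivAt
    rwa [hevZ.deriv_eq, deriv.fun_neg] at h2
  have hdG : ∀ w : InfinitePlace K, HasDerivAt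
      (fun s : ℂ => (w.mult / 2 : ℂ) * Complex.digamma (s * w.mult / 2))
      ((w.mult / 2 : ℂ) ^ 2 * deriv Complex.digamma (s * w.mult / 2)) s := fun w => by
    have hl : HasDerivAt (fun s : ℂ => s * w.mult / 2) (w.mult / 2 : ℂ) s := by
      simpa using ((hasDerivAt_id' s).mul_const (w.mult : ℂ)).div_const 2
    have := ((differentiableAt_digamma (re_mul_mult_pos hpos w)).hasDerivAt.comp s hl).const_mul
      (w.mult / 2 : ℂ)
    convert! this using 1
    ring
  have hsum := HasDerivAt.fun_sum (u := Finset.univ) fun w _ => hdG w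
  have hi := (hasDerivAt_id' s).fun_inv hs0
  have hi1 := ((hasDerivAt_id' s).sub_const 1).fun_inv hs1'
  rw [hev.deriv_eq, ((((hi.const_add b).fun_add hi1).fun_add hdZ).fun_add hsum).deriv]
  ring

/-- The step `λ_w` of the arithmetic progression of poles of the Gamma factor at `w`. -/
def poleStep (w : InfinitePlace K) : ℝ := 2 / w.mult

theorem poleStep_pos {K : Type*} [Field K] (w : InfinitePlace K) : 0 < poleStep w :=
  div_pos two_pos (by exact_mod_cast InfinitePlace.mult_pos)

theorem hasSum_poleStep {K : Type*} [Field K] (w : InfinitePlace K) {s : ℂ} (hs : 0 < s.re) :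
    HasSum (fun n : ℕ => 1 / (s - (-(poleStep w * n) : ℝ)) ^ 2)
      ((w.mult / 2 : ℂ) ^ 2 * deriv Complex.digamma (s * w.mult / 2)) := by
  have h := (hasSum_deriv_digamma (re_mul_mult_pos hs w)).mul_left ((w.mult / 2 : ℂ) ^ 2)
  convert! h using 2 with n
  have hm : (w.mult : ℂ) ≠ 0 := by exact_mod_cast (InfinitePlace.mult_pos (w := w)).ne'
  have e : s - (-(poleStep w * n) : ℝ) = (s * w.mult / 2 + n) / (w.mult / 2) := by
    rw [poleStep]
    push_cast
    field_simp
    ring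
  rw [e, div_pow, one_div_div, mul_one_div]

end

end ExplicitFormula

namespace ExplicitFormula

open MeasureTheory Filter Topology

noncomputable section

/-- Smooth compactly supported functions on the real line. -/
structure IsTest (φ : ℝ → ℂ) : Prop where
  smooth : ContDiff ℝ (⊤ : ℕ∞) φ
  compact : HasCompactSupport φ

/-- The two-sided Laplace transform `s ↦ ∫ e^{ts} φ(t) dt`. -/
def laplace (φ : ℝ → ℂ) (s : ℂ) : ℂ := ∫ t : ℝ, Complex.exp (t * s) * φ t

namespace IsTest

variable {φ : ℝ → ℂ}

theorem deriv (h : IsTest φ) : IsTest (deriv φ) :=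
  ⟨(contDiff_infty_iff_deriv.mp h.smooth).2, h.compact.deriv⟩

theorem integrable_mul (h : IsTest φ) {g : ℝ → ℂ} (hg : Continuous g) :
    Integrable fun t => g t * φ t :=
  (hg.mul h.smooth.continuous).integrable_of_hasCompactSupport h.compact.mul_left

theorem integrable (h : IsTest φ) : Integrable φ :=
  h.smooth.continuous.integrable_of_hasCompactSupport h.compact

theorem laplace_deriv (h : IsTest φ) (s : ℂ) : laplace (_root_.deriv φ) s = -(s * laplace φ s) := by
  have hd : ∀ t : ℝ, HasDerivAt (fun t : ℝ => Complex.exp (t * s)) (Complex.exp (t * s) * s) t :=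
    fun t => by
      have := ((hasDerivAt_id' (t : ℂ)).mul_const s).cexp.comp_ofReal
      simpa using this
  have hφ : ∀ t : ℝ, HasDerivAt φ (_root_.deriv φ t) t := fun t =>
    ((h.smooth.differentiable (by simp)) t).hasDerivAt
  have hc : Continuous fun t : ℝ => Complex.exp (t * s) := by fun_prop
  have := integral_mul_deriv_eq_deriv_mul_of_integrable (fun t _ => hd t) (fun t _ => hφ t)
    (h.deriv.integrable_mul hc)
    (h.integrable_mul (g := fun t : ℝ => Complex.exp (t * s) * s) (by fun_prop))
    (h.integrable_mul hc)
  rw [laplace, this, laplace, ← integral_const_mul]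
  congr 2
  ext t
  ring

theorem exists_norm_laplace_le (h : IsTest φ) (a b : ℝ) :
    ∃ C, ∀ s : ℂ, a ≤ s.re → s.re ≤ b → ‖laplace φ s‖ ≤ C := by
  refine ⟨∫ t : ℝ, (Real.exp (t * a) + Real.exp (t * b)) * ‖φ t‖, fun s ha hb => ?_⟩
  have hInt : Integrable fun t : ℝ => (Real.exp (t * a) + Real.exp (t * b)) * ‖φ t‖ := by
    have hc : Continuous fun t : ℝ => (Real.exp (t * a) + Real.exp (t * b)) * ‖φ t‖ :=
      (by fun_prop : Continuous fun t : ℝ => Real.exp (t * a) + Real.exp (t * b)).mul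
        h.smooth.continuous.norm
    exact hc.integrable_of_hasCompactSupport h.compact.norm.mul_left
  refine norm_integral_le_of_norm_le hInt (.of_forall fun t => ?_)
  rw [norm_mul, Complex.norm_exp, Complex.re_ofReal_mul]
  gcongr
  rcases le_total 0 t with ht | ht
  · have := Real.exp_le_exp.mpr (mul_le_mul_of_nonneg_left hb ht)
    linarith [Real.exp_pos (t * a)]
  · have := Real.exp_le_exp.mpr (mul_le_mul_of_nonpos_left ha ht)
    linarith [Real.exp_pos (t * b)]

theorem exists_norm_pow_mul_laplace_le (a b : ℝ) (n : ℕ) : ∀ {φ : ℝ → ℂ}, IsTest φ →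
    ∃ C, ∀ s : ℂ, a ≤ s.re → s.re ≤ b → ‖laplace φ s‖ * ‖s‖ ^ n ≤ C := by
  induction n with
  | zero => simpa using fun {φ} (h : IsTest φ) => h.exists_norm_laplace_le a b
  | succ n ih =>
    intro φ h
    obtain ⟨C, hC⟩ := ih h.deriv
    refine ⟨C, fun s ha hb => ?_⟩
    have := hC s ha hb
    rw [h.laplace_deriv, norm_neg, norm_mul] at this
    calc _ = ‖s‖ * ‖laplace φ s‖ * ‖s‖ ^ n := by ring
      _ ≤ C := this

theorem exists_laplace_decay (h : IsTest φ) (a b : ℝ) (n : ℕ) :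
    ∃ C, ∀ s : ℂ, a ≤ s.re → s.re ≤ b → ‖laplace φ s‖ ≤ C / (2 + ‖s‖) ^ n := by
  obtain ⟨C, hC⟩ := exists_norm_pow_mul_laplace_le a b n h
  obtain ⟨D, hD⟩ := exists_norm_pow_mul_laplace_le a b 0 h
  refine ⟨2 ^ (n - 1) * (2 ^ n * D + C), fun s ha hb => ?_⟩
  rw [le_div_iff₀ (by positivity)]
  have h1 := hC s ha hb
  have h2 := hD s ha hb
  rw [pow_zero, mul_one] at h2
  calc ‖laplace φ s‖ * (2 + ‖s‖) ^ n
      ≤ ‖laplace φ s‖ * (2 ^ (n - 1) * (2 ^ n + ‖s‖ ^ n)) := by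
        gcongr
        exact add_pow_le (by norm_num) (norm_nonneg _) n
    _ = 2 ^ (n - 1) * (2 ^ n * ‖laplace φ s‖ + ‖laplace φ s‖ * ‖s‖ ^ n) := by ring
    _ ≤ _ := by gcongr

theorem continuous_laplace (h : IsTest φ) {ℓ : ℝ → ℂ} (hℓ : Continuous ℓ) :
    Continuous fun x => laplace φ (ℓ x) := by
  have : Continuous fun x => ∫ t in tsupport φ, Complex.exp (t * ℓ x) * φ t := by
    refine continuous_parametric_integral_of_continuous
      (f := fun (x t : ℝ) => Complex.exp (t * ℓ x) * φ t) ?_ h.compact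
    have := h.smooth.continuous
    unfold Function.uncurry
    fun_prop
  convert! this using 2 with x
  rw [laplace, setIntegral_eq_integral_of_forall_compl_eq_zero]
  intro t ht
  rw [image_eq_zero_of_notMem_tsupport ht, mul_zero]

end IsTest

/-- A parametrization of the vertical line `Re s = 2`. -/
def line (ξ : ℝ) : ℂ := 2 - 2 * Real.pi * ξ * Complex.I

theorem continuous_line : Continuous line := by
  unfold line
  fun_prop

theorem line_re (ξ : ℝ) : (line ξ).re = 2 := by simp [line]

theorem abs_le_norm_line (ξ : ℝ) : |ξ| ≤ ‖line ξ‖ := by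
  refine le_trans ?_ (Complex.abs_im_le_norm _)
  have : (line ξ).im = -(2 * Real.pi * ξ) := by simp [line]
  rw [this, abs_neg, abs_mul, abs_of_pos Real.two_pi_pos]
  nlinarith [Real.pi_gt_three, abs_nonneg ξ]

theorem IsTest.integrable_laplace_line {ψ : ℝ → ℂ} (h : IsTest ψ) {F : ℂ → ℂ} {D : ℝ}
    (hF : AEStronglyMeasurable fun ξ => F (line ξ))
    (hD : ∀ ξ, ‖F (line ξ)‖ ≤ D * (2 + ‖line ξ‖) ^ 2) :
    Integrable fun ξ => laplace ψ (line ξ) * F (line ξ) := by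
  obtain ⟨C, hC⟩ := h.exists_laplace_decay 2 2 4
  have h1 : Integrable fun ξ : ℝ => C * D * (1 + ‖ξ‖) ^ (-2 : ℝ) :=
    (integrable_one_add_norm (by simp)).const_mul _
  refine h1.mono' ((h.continuous_laplace continuous_line).aestronglyMeasurable.mul hF)
    (.of_forall fun ξ => ?_)
  have h2 := hC (line ξ) (line_re ξ).ge (line_re ξ).le
  have h3 := hD ξ
  have hD0 : 0 ≤ D := nonneg_of_mul_nonneg_left ((norm_nonneg _).trans h3) (by positivity)
  have hC0 : 0 ≤ C := by
    rw [le_div_iff₀ (by positivity)] at h2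
    exact le_trans (by positivity) h2
  have h4 : 1 + ‖ξ‖ ≤ 2 + ‖line ξ‖ := by
    have := abs_le_norm_line ξ
    rw [Real.norm_eq_abs]
    linarith
  calc _ ≤ C / (2 + ‖line ξ‖) ^ 4 * (D * (2 + ‖line ξ‖) ^ 2) := by
        rw [norm_mul]
        gcongr
    _ = C * D / (2 + ‖line ξ‖) ^ 2 := by field_simp
    _ ≤ C * D / (1 + ‖ξ‖) ^ 2 := by gcongr
    _ = _ := by
      rw [Real.rpow_neg (by positivity), div_eq_mul_inv]
      norm_cast

/-- `F` is integrable against the Laplace transform of `ψ` along `Re s = 2`, with integral `c`. -/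
def HasLineIntegral (ψ : ℝ → ℂ) (F : ℂ → ℂ) (c : ℂ) : Prop :=
  Integrable (fun ξ => laplace ψ (line ξ) * F (line ξ)) ∧
    ∫ ξ, laplace ψ (line ξ) * F (line ξ) = c

namespace HasLineIntegral

variable {ψ : ℝ → ℂ} {F G : ℂ → ℂ} {c d : ℂ}

theorem unique (h : HasLineIntegral ψ F c) (h' : HasLineIntegral ψ F d) : c = d :=
  h.2.symm.trans h'.2

theorem congr (h : HasLineIntegral ψ F c) (hFG : ∀ s : ℂ, s.re = 2 → F s = G s) :
    HasLineIntegral ψ G c := by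
  have : ∀ ξ, F (line ξ) = G (line ξ) := fun ξ => hFG _ (line_re ξ)
  simpa only [HasLineIntegral, this] using h

theorem add (h : HasLineIntegral ψ F c) (h' : HasLineIntegral ψ G d) :
    HasLineIntegral ψ (fun s => F s + G s) (c + d) := by
  simp only [HasLineIntegral, mul_add]
  exact ⟨h.1.add h'.1, by rw [integral_add h.1 h'.1, h.2, h'.2]⟩

theorem sub (h : HasLineIntegral ψ F c) (h' : HasLineIntegral ψ G d) :
    HasLineIntegral ψ (fun s => F s - G s) (c - d) := by
  simp only [HasLineIntegral, mul_sub]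
  exact ⟨h.1.sub h'.1, by rw [integral_sub h.1 h'.1, h.2, h'.2]⟩

theorem const_mul (h : HasLineIntegral ψ F c) (a : ℂ) :
    HasLineIntegral ψ (fun s => a * F s) (a * c) := by
  simp only [HasLineIntegral, mul_left_comm _ a]
  exact ⟨h.1.const_mul a, by rw [integral_const_mul, h.2]⟩

theorem sum {ι : Type*} {S : Finset ι} {F : ι → ℂ → ℂ} {c : ι → ℂ}
    (h : ∀ i ∈ S, HasLineIntegral ψ (F i) (c i)) :
    HasLineIntegral ψ (fun s => ∑ i ∈ S, F i s) (∑ i ∈ S, c i) := by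
  simp only [HasLineIntegral, Finset.mul_sum]
  exact ⟨integrable_finsetSum _ fun i hi => (h i hi).1, by
    rw [integral_finsetSum _ fun i hi => (h i hi).1]
    exact Finset.sum_congr rfl fun i hi => (h i hi).2⟩

theorem hasSum {ι : Type*} [Countable ι] (hψ : IsTest ψ) {f : ι → ℂ → ℂ} {c : ι → ℂ} {B : ι → ℝ}
    (h : ∀ i, HasLineIntegral ψ (f i) (c i))
    (hf : ∀ i, AEStronglyMeasurable fun ξ => f i (line ξ))
    (hB : ∀ i, ∀ s : ℂ, s.re = 2 → ‖f i s‖ ≤ B i * (2 + ‖s‖) ^ 2) (hBs : Summable B)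
    (hF : ∀ s : ℂ, s.re = 2 → HasSum (fun i => f i s) (F s)) :
    ∃ S, HasSum c S ∧ HasLineIntegral ψ F S := by
  have hsum : ∀ s : ℂ, s.re = 2 → ‖F s‖ ≤ (∑' i, B i) * (2 + ‖s‖) ^ 2 := fun s hs => by
    rw [← (hF s hs).tsum_eq]
    exact tsum_of_norm_bounded (hBs.hasSum.mul_right _) fun i => hB i s hs
  have hFm : AEStronglyMeasurable fun ξ => F (line ξ) := by
    refine aestronglyMeasurable_of_tendsto_ae (atTop : Filter (Finset ι))
      (f := fun S ξ => ∑ i ∈ S, f i (line ξ)) (fun S => ?_)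
      (.of_forall fun ξ => hF _ (line_re ξ))
    exact Finset.aestronglyMeasurable_fun_sum S fun i _ => hf i
  have hInt := hψ.integrable_laplace_line hFm fun ξ => hsum _ (line_re ξ)
  refine ⟨∫ ξ, laplace ψ (line ξ) * F (line ξ), ?_, hInt, rfl⟩
  have hg : Integrable fun ξ => laplace ψ (line ξ) * ((2 + ‖line ξ‖ : ℝ) : ℂ) ^ 2 := by
    refine hψ.integrable_laplace_line (F := fun s => ((2 + ‖s‖ : ℝ) : ℂ) ^ 2) (D := 1) ?_ ?_
    · have := continuous_line
      exact (by fun_prop : Continuous fun ξ => ((2 + ‖line ξ‖ : ℝ) : ℂ) ^ 2).aestronglyMeasurable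
    · intro ξ
      rw [norm_pow, Complex.norm_real, Real.norm_of_nonneg (by positivity), one_mul]
  have hle : ∀ i ξ, ‖laplace ψ (line ξ) * f i (line ξ)‖ ≤
      B i * ‖laplace ψ (line ξ) * ((2 + ‖line ξ‖ : ℝ) : ℂ) ^ 2‖ := fun i ξ => by
    rw [norm_mul, norm_mul, norm_pow, Complex.norm_real, Real.norm_of_nonneg (by positivity)]
    calc _ ≤ ‖laplace ψ (line ξ)‖ * (B i * (2 + ‖line ξ‖) ^ 2) := by
          gcongr
          exact hB i _ (line_re ξ)
      _ = _ := by ring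
  have key := hasSum_integral_of_summable_integral_norm (μ := volume)
    (F := fun i ξ => laplace ψ (line ξ) * f i (line ξ)) (fun i => (h i).1) (by
      refine Summable.of_nonneg_of_le (fun i => by positivity) (fun i => ?_)
        (hBs.mul_right (∫ ξ, ‖laplace ψ (line ξ) * ((2 + ‖line ξ‖ : ℝ) : ℂ) ^ 2‖))
      rw [← integral_const_mul]
      exact integral_mono (h i).1.norm (hg.norm.const_mul _) (hle i))
  convert! key using 1
  · ext i
    exact (h i).2.symm
  · congr 1
    ext ξ
    exact ((hF _ (line_re ξ)).mul_left _).tsum_eq.symm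

end HasLineIntegral

open FourierTransform in
theorem IsTest.hasLineIntegral_exp {ψ : ℝ → ℂ} (hψ : IsTest ψ) (x : ℝ) :
    HasLineIntegral ψ (fun s => Complex.exp (-(x : ℂ) * s)) (ψ x) := by
  have hc : Continuous fun t : ℝ => Complex.exp (2 * t) := by fun_prop
  let f : ℝ → ℂ := fun t => Complex.exp (2 * t) * ψ t
  have hf : Integrable f := hψ.integrable_mul hc
  have hfour : 𝓕 f = fun ξ => laplace ψ (line ξ) := by
    ext ξ
    rw [Real.fourier_real_eq_integral_exp_smul, laplace]
    congr 1
    ext t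
    simp only [f, smul_eq_mul]
    rw [← mul_assoc, ← Complex.exp_add, line]
    congr 2
    push_cast
    ring
  have hF : Integrable fun ξ => laplace ψ (line ξ) := by
    have := hψ.integrable_laplace_line (F := fun _ => 1) (D := 1) (by fun_prop) fun ξ => by
      rw [norm_one, one_mul]
      exact one_le_pow₀ (by linarith [norm_nonneg (line ξ)])
    simpa using this
  have hinv := hf.fourierInv_fourier_eq (by rwa [hfour])
    (v := x) (hc.mul hψ.smooth.continuous).continuousAt
  rw [hfour, Real.fourierInv_eq'] at hinv
  have e : ∀ ξ : ℝ, laplace ψ (line ξ) * Complex.exp (-(x : ℂ) * line ξ) =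
      Complex.exp (-(2 * x)) * (Complex.exp (((2 * Real.pi * inner ℝ ξ x : ℝ) : ℂ) * Complex.I) •
        laplace ψ (line ξ)) := fun ξ => by
    rw [smul_eq_mul, ← mul_assoc, ← Complex.exp_add, mul_comm]
    congr 2
    rw [line]
    simp
    ring
  constructor
  · refine hψ.integrable_laplace_line (F := fun s => Complex.exp (-(x : ℂ) * s))
      (D := Real.exp (-x * 2)) ?_ fun ξ => ?_
    · have := continuous_line
      exact (by fun_prop : Continuous fun ξ =>
        Complex.exp (-(x : ℂ) * line ξ)).aestronglyMeasurable
    · rw [Complex.norm_exp, neg_mul, Complex.neg_re, Complex.re_ofReal_mul, line_re, ← neg_mul]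
      exact le_mul_of_one_le_right (Real.exp_pos _).le
        (one_le_pow₀ (by linarith [norm_nonneg (line ξ)]))
  · simp only [e]
    rw [integral_const_mul, hinv]
    simp only [f]
    rw [← mul_assoc, ← Complex.exp_add, neg_add_cancel, Complex.exp_zero, one_mul]

theorem integrableOn_mul_exp_neg {x : ℝ} (hx : 0 < x) :
    IntegrableOn (fun t : ℝ => t * Real.exp (-x * t)) (Set.Ioi 0) := by
  have := integrableOn_rpow_mul_exp_neg_mul_rpow (s := 1) (p := 1) (by norm_num) one_pos hx
  simpa using this

theorem norm_mul_exp_neg {t : ℝ} (ht : 0 ≤ t) (z : ℂ) :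
    ‖(t : ℂ) * Complex.exp (-(t : ℂ) * z)‖ = t * Real.exp (-z.re * t) := by
  rw [norm_mul, Complex.norm_real, Real.norm_of_nonneg ht, Complex.norm_exp, neg_mul,
    Complex.neg_re, Complex.re_ofReal_mul]
  ring_nf

theorem integrableOn_mul_cexp_neg {z : ℂ} (hz : 0 < z.re) :
    IntegrableOn (fun t : ℝ => (t : ℂ) * Complex.exp (-(t : ℂ) * z)) (Set.Ioi 0) := by
  refine (integrableOn_mul_exp_neg hz).mono' ?_ ?_
  · exact (by fun_prop : Continuous fun t : ℝ =>
      (t : ℂ) * Complex.exp (-(t : ℂ) * z)).aestronglyMeasurable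
  · filter_upwards [ae_restrict_mem measurableSet_Ioi] with t ht
    exact (norm_mul_exp_neg (le_of_lt ht) z).le

theorem integral_mul_cexp_neg {z : ℂ} (hz : 0 < z.re) :
    ∫ t : ℝ in Set.Ioi 0, (t : ℂ) * Complex.exp (-(t : ℂ) * z) = 1 / z ^ 2 := by
  have hz0 : z ≠ 0 := fun h => by simp [h] at hz
  have hd : ∀ t : ℝ, HasDerivAt (fun t : ℝ => -((t : ℂ) / z + 1 / z ^ 2) *
      Complex.exp (-(t : ℂ) * z)) ((t : ℂ) * Complex.exp (-(t : ℂ) * z)) t := fun t => by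
    have h1 := ((((hasDerivAt_id' (t : ℂ)).div_const z).add_const (1 / z ^ 2)).fun_neg.fun_mul
      (((hasDerivAt_id' (t : ℂ)).fun_neg.mul_const z).cexp)).comp_ofReal
    convert! h1 using 1
    field_simp
    ring
  have hlim : Tendsto (fun t : ℝ => -((t : ℂ) / z + 1 / z ^ 2) *
      Complex.exp (-(t : ℂ) * z)) atTop (𝓝 0) := by
    have l1 := tendsto_rpow_mul_exp_neg_mul_atTop_nhds_zero 1 z.re hz
    have l0 := tendsto_rpow_mul_exp_neg_mul_atTop_nhds_zero 0 z.re hz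
    have l : Tendsto (fun t : ℝ => ‖z‖⁻¹ * (t ^ (1 : ℝ) * Real.exp (-z.re * t)) +
        (‖z‖ ^ 2)⁻¹ * (t ^ (0 : ℝ) * Real.exp (-z.re * t))) atTop (𝓝 0) := by
      simpa using (l1.const_mul ‖z‖⁻¹).add (l0.const_mul (‖z‖ ^ 2)⁻¹)
    refine squeeze_zero_norm' ?_ l
    filter_upwards [eventually_ge_atTop 0] with t ht
    have e : ‖Complex.exp (-(t : ℂ) * z)‖ = Real.exp (-z.re * t) := by
      rw [Complex.norm_exp, neg_mul, Complex.neg_re, Complex.re_ofReal_mul]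
      ring_nf
    have h1 : ‖(t : ℂ) / z + 1 / z ^ 2‖ ≤ ‖z‖⁻¹ * t + (‖z‖ ^ 2)⁻¹ := by
      refine (norm_add_le _ _).trans (le_of_eq ?_)
      rw [norm_div, norm_div, norm_pow, norm_one, Complex.norm_real, Real.norm_of_nonneg ht]
      ring
    rw [norm_mul, norm_neg, e, Real.rpow_one, Real.rpow_zero]
    calc _ ≤ (‖z‖⁻¹ * t + (‖z‖ ^ 2)⁻¹) * Real.exp (-z.re * t) := by gcongr
      _ = _ := by ring
  rw [integral_Ioi_of_hasDerivAt_of_tendsto' (fun t _ => hd t) (integrableOn_mul_cexp_neg hz) hlim]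
  simp

theorem hasLineIntegral_inv_sub_sq {φ ψ : ℝ → ℂ} (hψ : IsTest ψ) (hφ : ∀ t, φ t = t * ψ t)
    (hsupp : ∀ t ≤ 0, φ t = 0) {a : ℂ} (ha : a.re < 2) :
    HasLineIntegral ψ (fun s => 1 / (s - a) ^ 2) (laplace φ a) := by
  have hre : ∀ s : ℂ, s.re = 2 → 0 < (s - a).re := fun s hs => by
    rw [Complex.sub_re, hs]
    linarith
  have hne : ∀ ξ, line ξ - a ≠ 0 := fun ξ h => by
    have := hre _ (line_re ξ)
    rw [h, Complex.zero_re] at this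
    exact this.ne rfl
  have hcont : Continuous fun ξ => 1 / (line ξ - a) ^ 2 := by
    have := continuous_line
    exact continuous_const.div (by fun_prop) fun ξ => pow_ne_zero 2 (hne ξ)
  have h2a : 0 < 2 - a.re := by linarith
  have hInt : Integrable fun ξ => laplace ψ (line ξ) := by
    have := hψ.integrable_laplace_line (F := fun _ => 1) (D := 1) (by fun_prop) fun ξ => by
      rw [norm_one, one_mul]
      exact one_le_pow₀ (by linarith [norm_nonneg (line ξ)])
    simpa using this
  constructor
  · refine hψ.integrable_laplace_line (F := fun s => 1 / (s - a) ^ 2)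
      (D := 1 / (2 - a.re) ^ 2) hcont.aestronglyMeasurable fun ξ => ?_
    have h1 : 2 - a.re ≤ ‖line ξ - a‖ := by
      have := Complex.re_le_norm (line ξ - a)
      rwa [Complex.sub_re, line_re] at this
    rw [norm_div, norm_one, norm_pow]
    calc _ ≤ 1 / (2 - a.re) ^ 2 := by gcongr
      _ ≤ _ := le_mul_of_one_le_right (by positivity)
        (one_le_pow₀ (by linarith [norm_nonneg (line ξ)]))
  · have e1 : ∀ ξ, laplace ψ (line ξ) * (1 / (line ξ - a) ^ 2) = ∫ t : ℝ in Set.Ioi 0,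
        laplace ψ (line ξ) * ((t : ℂ) * Complex.exp (-(t : ℂ) * (line ξ - a))) := fun ξ => by
      rw [integral_const_mul, integral_mul_cexp_neg (hre _ (line_re ξ))]
    simp only [e1]
    rw [integral_integral_swap]
    · have e2 : ∀ t : ℝ, ∫ ξ, laplace ψ (line ξ) * ((t : ℂ) * Complex.exp (-(t : ℂ) *
          (line ξ - a))) = Complex.exp (t * a) * φ t := fun t => by
        have h1 : ∀ ξ, laplace ψ (line ξ) * ((t : ℂ) * Complex.exp (-(t : ℂ) *
            (line ξ - a))) = (t * Complex.exp (t * a)) *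
              (laplace ψ (line ξ) * Complex.exp (-(t : ℂ) * line ξ)) := fun ξ => by
          rw [mul_sub, sub_eq_add_neg, Complex.exp_add, ← neg_mul, neg_neg]
          ring
        simp only [h1]
        rw [integral_const_mul, (hψ.hasLineIntegral_exp t).2, hφ]
        ring
      simp only [e2]
      rw [laplace, setIntegral_eq_integral_of_forall_compl_eq_zero]
      intro t ht
      rw [hsupp t (not_lt.mp ht), mul_zero]
    · have hprod := hInt.norm.mul_prod (integrableOn_mul_exp_neg h2a)
      refine hprod.mono' ?_ ?_
      · refine Continuous.aestronglyMeasurable ?_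
        unfold Function.uncurry
        have h3 : Continuous fun x : ℝ × ℝ => laplace ψ (line x.1) :=
          (hψ.continuous_laplace continuous_line).comp continuous_fst
        have h4 : Continuous fun x : ℝ × ℝ => line x.1 := continuous_line.comp continuous_fst
        fun_prop
      · have : ∀ᵐ x : ℝ × ℝ ∂(volume.prod (volume.restrict (Set.Ioi 0))), x.2 ∈ Set.Ioi (0 : ℝ) :=
          (Measure.quasiMeasurePreserving_snd (μ := (volume : Measure ℝ))
            (ν := (volume : Measure ℝ).restrict (Set.Ioi 0))).ae
            (ae_restrict_mem measurableSet_Ioi)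
        filter_upwards [this] with x hx
        rw [Function.uncurry, norm_mul, norm_mul_exp_neg (le_of_lt hx), Complex.sub_re, line_re]

end

end ExplicitFormula

namespace ExplicitFormula

open MeasureTheory Filter Topology
open NumberField NumberField.Units NumberField.Units.dirichletUnitTheorem nonZeroDivisors Module
open scoped ENNReal Classical

noncomputable section

namespace IsTest

variable {φ : ℝ → ℂ}

theorem eventuallyEq_zero (h0 : 0 ∉ tsupport φ) : φ =ᶠ[𝓝 0] 0 :=
  notMem_tsupport_iff_eventuallyEq.mp h0

theorem div_id (h : IsTest φ) (h0 : 0 ∉ tsupport φ) : IsTest fun t => φ t / t := by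
  constructor
  · rw [contDiff_iff_contDiffAt]
    intro t
    by_cases ht : t = 0
    · rw [ht]
      refine (contDiffAt_const (c := (0 : ℂ))).congr_of_eventuallyEq ?_
      filter_upwards [eventuallyEq_zero h0] with t ht
      simp [ht]
    · have ht' : Complex.ofRealCLM t ≠ 0 := by simpa using ht
      simp only [div_eq_mul_inv]
      exact h.smooth.contDiffAt.mul (Complex.ofRealCLM.contDiff.contDiffAt.inv ht')
  · exact h.compact.mono' (subset_closure.trans' fun t ht hφ => ht (by simp [hφ]))

theorem integrable_mul_of_continuousAt (h : IsTest φ) (h0 : 0 ∉ tsupport φ) {g : ℝ → ℂ}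
    (hg : ∀ t ≠ 0, ContinuousAt g t) : Integrable fun t => φ t * g t := by
  refine Continuous.integrable_of_hasCompactSupport ?_ h.compact.mul_right
  rw [continuous_iff_continuousAt]
  intro t
  by_cases ht : t = 0
  · rw [ht]
    refine (continuousAt_const (y := (0 : ℂ))).congr ?_
    filter_upwards [eventuallyEq_zero h0] with t ht
    simp [ht]
  · exact h.smooth.continuous.continuousAt.mul (hg t ht)

theorem hasSum_laplace_progression (h : IsTest φ) (hs : tsupport φ ⊆ Set.Ioi 0) {l : ℝ}
    (hl : 0 < l) : HasSum (fun n : ℕ => laplace φ (-(l * n) : ℝ))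
      (∫ t in Set.Ioi (0 : ℝ), φ t * ((1 : ℂ) - Real.exp (-l * t))⁻¹) := by
  have h0 : (0 : ℝ) ∉ tsupport φ := fun h => lt_irrefl (0 : ℝ) (hs h)
  obtain ⟨δ, hδ, hball⟩ := Metric.eventually_nhds_iff.mp (eventuallyEq_zero h0)
  have hzero : ∀ t < δ, φ t = 0 := fun t ht => by
    rcases le_or_gt t 0 with h1 | h1
    · exact image_eq_zero_of_notMem_tsupport fun h2 => not_lt.mpr h1 (hs h2)
    · exact hball (by rwa [Real.dist_eq, sub_zero, abs_of_pos h1])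
  have hInt : ∀ n : ℕ, Integrable fun t : ℝ => Complex.exp (t * (-(l * n) : ℝ)) * φ t :=
    fun n => h.integrable_mul (by fun_prop)
  have hr : Real.exp (-l * δ) < 1 := by
    rw [Real.exp_lt_one_iff]
    nlinarith
  have hle : ∀ (n : ℕ) (t : ℝ), ‖Complex.exp (t * (-(l * n) : ℝ)) * φ t‖ ≤
      Real.exp (-l * δ) ^ n * ‖φ t‖ := fun n t => by
    rcases lt_or_ge t δ with ht | ht
    · simp [hzero t ht]
    · rw [norm_mul, ← Complex.ofReal_mul, Complex.norm_exp, Complex.ofReal_re, ← Real.exp_nat_mul]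
      refine mul_le_mul_of_nonneg_right (Real.exp_le_exp.mpr ?_) (norm_nonneg _)
      have : 0 ≤ l * n := by positivity
      nlinarith
  have key := hasSum_integral_of_summable_integral_norm hInt (by
    refine Summable.of_nonneg_of_le (fun i => by positivity) (fun n => ?_)
      ((summable_geometric_of_lt_one (Real.exp_pos _).le hr).mul_right (∫ t, ‖φ t‖))
    rw [← integral_const_mul]
    exact integral_mono (hInt n).norm (h.integrable.norm.const_mul _) (hle n))
  convert! key using 1
  rw [setIntegral_eq_integral_of_forall_compl_eq_zero fun t ht => by
    rw [hzero t ((not_lt.mp ht).trans_lt hδ), zero_mul]]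
  congr 1
  ext t
  rw [tsum_mul_right]
  rcases lt_or_ge t δ with ht | ht
  · simp [hzero t ht]
  · have e : ∀ n : ℕ, Complex.exp (t * (-(l * n) : ℝ)) = (Real.exp (-l * t) : ℂ) ^ n := fun n => by
      rw [← Complex.ofReal_mul, ← Complex.ofReal_exp, ← Complex.ofReal_pow, ← Real.exp_nat_mul]
      congr 2
      ring
    have h1 : Real.exp (-l * t) < 1 := by
      rw [Real.exp_lt_one_iff]
      nlinarith
    simp only [e]
    rw [tsum_geometric_of_norm_lt_one, mul_comm]
    rwa [Complex.norm_real, Real.norm_of_nonneg (Real.exp_pos _).le]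

theorem positivePart (h : IsTest φ) (h0 : 0 ∉ tsupport φ) :
    IsTest ((Set.Ioi 0).indicator φ) ∧ tsupport ((Set.Ioi 0).indicator φ) ⊆ Set.Ioi 0 := by
  have hev : (Set.Ioi 0).indicator φ =ᶠ[𝓝 0] 0 := by
    filter_upwards [eventuallyEq_zero h0] with t ht
    simp [Set.indicator_apply, ht]
  refine ⟨⟨?_, ?_⟩, fun t ht => ?_⟩
  · rw [contDiff_iff_contDiffAt]
    intro t
    rcases lt_trichotomy t 0 with ht | ht | ht
    · refine (contDiffAt_const (c := (0 : ℂ))).congr_of_eventuallyEq ?_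
      filter_upwards [eventually_lt_nhds ht] with u hu
      exact Set.indicator_of_notMem (not_lt.mpr hu.le) _
    · rw [ht]
      exact (contDiffAt_const (c := (0 : ℂ))).congr_of_eventuallyEq hev
    · refine h.smooth.contDiffAt.congr_of_eventuallyEq ?_
      filter_upwards [eventually_gt_nhds ht] with u hu
      exact Set.indicator_of_mem (Set.mem_Ioi.mpr hu) _
  · exact h.compact.mono' (subset_closure.trans' fun t ht hφ => ht (by simp [Set.indicator, hφ]))
  · by_contra htn
    rcases (le_of_not_gt htn : t ≤ 0).lt_or_eq with h1 | h1
    · refine notMem_tsupport_iff_eventuallyEq.mpr ?_ ht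
      filter_upwards [eventually_lt_nhds h1] with u hu
      exact Set.indicator_of_notMem (not_lt.mpr hu.le) _
    · rw [h1] at ht
      exact notMem_tsupport_iff_eventuallyEq.mpr hev ht

/-- The involution `φ(t) ↦ e^{-t} φ(-t)`, which corresponds to `s ↦ 1 - s`. -/
def _root_.ExplicitFormula.reflect (φ : ℝ → ℂ) (t : ℝ) : ℂ := Real.exp (-t) * φ (-t)

theorem reflect (h : IsTest φ) : IsTest (reflect φ) := by
  constructor
  · have h1 : ContDiff ℝ (⊤ : ℕ∞) fun t : ℝ => Real.exp (-t) := Real.contDiff_exp.comp contDiff_neg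
    exact (Complex.ofRealCLM.contDiff.comp h1).mul (h.smooth.comp contDiff_neg)
  · exact (h.compact.comp_homeomorph (Homeomorph.neg ℝ)).mul_left

theorem zero_notMem_tsupport_reflect (h0 : 0 ∉ tsupport φ) :
    0 ∉ tsupport (ExplicitFormula.reflect φ) := by
  rw [notMem_tsupport_iff_eventuallyEq]
  have h1 : Tendsto (fun t : ℝ => -t) (𝓝 0) (𝓝 0) := by simpa using (continuous_neg.tendsto (0 : ℝ))
  filter_upwards [h1.eventually (eventuallyEq_zero h0)] with t ht
  simp [ExplicitFormula.reflect, ht]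

end IsTest

theorem laplace_reflect (φ : ℝ → ℂ) (s : ℂ) : laplace (reflect φ) s = laplace φ (1 - s) := by
  rw [laplace, laplace, ← integral_neg_eq_self (fun t : ℝ => Complex.exp (t * (1 - s)) * φ t)]
  congr 1
  ext t
  rw [reflect, ← mul_assoc, Complex.ofReal_exp, ← Complex.exp_add]
  congr 2
  push_cast
  ring

theorem laplace_split {φ : ℝ → ℂ} (h : IsTest φ) (h0 : 0 ∉ tsupport φ) (s : ℂ) :
    laplace φ s = laplace ((Set.Ioi 0).indicator φ) s +
      laplace ((Set.Ioi 0).indicator (reflect φ)) (1 - s) := by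
  have h1 := (h.positivePart h0).1
  have h2 := (h.reflect.positivePart (IsTest.zero_notMem_tsupport_reflect h0)).1
  have e : laplace ((Set.Ioi 0).indicator (reflect φ)) (1 - s) =
      laplace (reflect ((Set.Ioi 0).indicator (reflect φ))) s := by rw [laplace_reflect]
  rw [e, laplace, laplace, laplace, ← integral_add (h1.integrable_mul (by fun_prop))
    (h2.reflect.integrable_mul (by fun_prop))]
  congr 1
  ext t
  rw [← mul_add]
  congr 1
  rcases lt_trichotomy t 0 with ht | ht | ht
  · rw [Set.indicator_of_notMem (s := Set.Ioi (0 : ℝ)) (not_lt.mpr ht.le), reflect,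
      Set.indicator_of_mem (Set.mem_Ioi.mpr (neg_pos.mpr ht)), reflect, ← mul_assoc,
      ← Complex.ofReal_mul, ← Real.exp_add]
    simp
  · have := (IsTest.eventuallyEq_zero h0).eq_of_nhds
    rw [ht, this]
    simp [reflect]
  · rw [Set.indicator_of_mem (Set.mem_Ioi.mpr ht), reflect,
      Set.indicator_of_notMem (by simpa using ht.le)]
    simp

variable {K : Type*} [Field K] [NumberField K]

theorem countable_zeros_xiFun {Z : ℂ → ℂ} (hZ : IsZeta K Z) (hZa : ∀ s ≠ 1, AnalyticAt ℂ Z s) :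
    Countable {ρ : ℂ // xiFun K ρ = 0} := by
  have h0 : xiFun K 0 ≠ 0 := fun h => by
    have := (hZ.xiFun_eq_zero_iff hZa 0).mp h
    simp at this
  have : {ρ : ℂ | xiFun K ρ = 0} = ⋃ n : ℕ, {ρ : ℂ | xiFun K ρ = 0 ∧ ‖ρ‖ ≤ n} := by
    ext ρ
    simp only [Set.mem_ofPred_eq, Set.mem_iUnion]
    exact ⟨fun h => (exists_nat_ge ‖ρ‖).imp fun n hn => ⟨h, hn⟩, fun ⟨_, h, _⟩ => h⟩
  have hc : {ρ : ℂ | xiFun K ρ = 0}.Countable := by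
    rw [this]
    exact Set.countable_iUnion fun n =>
      (finite_zeros_closedBall differentiable_xiFun h0 n).countable
  exact hc.to_subtype

theorem countable_finitePlace : Countable (FinitePlace' K × ℕ) := by
  have h := (summable_primeLength (K := K) (one_lt_two) 0).countable_support
  have e : (Function.support fun x : FinitePlace' K × ℕ => logNorm x.1.1 * primeLength x ^ 0 *
      Real.exp (-primeLength x * 2)) = Set.univ := by
    refine Set.eq_univ_of_forall fun x => ?_
    rw [Function.mem_support, pow_zero, mul_one]
    exact mul_ne_zero (logNorm_pos x.1).ne' (Real.exp_ne_zero _)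
  rw [e] at h
  exact Set.countable_univ_iff.mp h

theorem IsZeta.hasSum_zeros_positive {Z : ℂ → ℂ} (hZ : IsZeta K Z)
    (hZa : ∀ s ≠ 1, AnalyticAt ℂ Z s) {φ : ℝ → ℂ} (hφ : IsTest φ) (hs : tsupport φ ⊆ Set.Ioi 0) :
    ∃ S, HasSum (fun x : FinitePlace' K × ℕ => (logNorm x.1.1 : ℂ) * φ (primeLength x)) S ∧
      HasSum (fun ρ : {ρ : ℂ // xiFun K ρ = 0} =>
          (analyticOrderNatAt (xiFun K) ρ.1 : ℂ) * laplace φ ρ.1)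
        (laplace φ 0 + laplace φ 1 - S - ∑ w : InfinitePlace K,
          ∫ t in Set.Ioi (0 : ℝ), φ t * ((1 : ℂ) - Real.exp (-poleStep w * t))⁻¹) := by
  have := countable_zeros_xiFun hZ hZa
  have := countable_finitePlace (K := K)
  have h0 : (0 : ℝ) ∉ tsupport φ := fun h => lt_irrefl (0 : ℝ) (hs h)
  have hψ := hφ.div_id h0
  set ψ : ℝ → ℂ := fun t => φ t / t with hψdef
  have hnonpos : ∀ t ≤ 0, φ t = 0 := fun t ht =>
    image_eq_zero_of_notMem_tsupport fun h2 => not_lt.mpr ht (hs h2)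
  have hφψ : ∀ t : ℝ, φ t = t * ψ t := fun t => by
    by_cases ht : t = 0
    · rw [ht, hnonpos 0 le_rfl]
      simp
    · have : (t : ℂ) ≠ 0 := by exact_mod_cast ht
      simp only [hψdef]
      field_simp
  have hxi0 : xiFun K 0 ≠ 0 := fun h => by
    have := (hZ.xiFun_eq_zero_iff hZa 0).mp h
    simp at this
  obtain ⟨C, hC⟩ := exists_norm_xiFun_le K
  have hinv : ∀ a : ℂ, a.re < 2 → HasLineIntegral ψ (fun s => 1 / (s - a) ^ 2) (laplace φ a) :=
    fun a ha => hasLineIntegral_inv_sub_sq hψ hφψ hnonpos ha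
  have hmeas : ∀ a : ℂ, Measurable fun ξ => 1 / (line ξ - a) ^ 2 := fun a => by
    have := continuous_line.measurable
    fun_prop
  -- the zeros
  obtain ⟨A, hA, hA'⟩ := HasLineIntegral.hasSum hψ
    (f := fun (ρ : {ρ : ℂ // xiFun K ρ = 0}) s =>
      (analyticOrderNatAt (xiFun K) ρ.1 : ℂ) * (1 / (s - ρ.1) ^ 2))
    (c := fun ρ => (analyticOrderNatAt (xiFun K) ρ.1 : ℂ) * laplace φ ρ.1)
    (B := fun ρ => (analyticOrderNatAt (xiFun K) ρ.1 : ℝ) / (1 + ‖ρ.1‖) ^ 2)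
    (F := fun s => -deriv (logDeriv (xiFun K)) s)
    (fun ρ => (hinv ρ.1 (by linarith [((hZ.xiFun_eq_zero_iff hZa ρ.1).mp ρ.2).2.1])).const_mul _)
    (fun ρ => ((hmeas ρ.1).const_mul _).aestronglyMeasurable)
    (fun ρ s hs => by
      have h1 : 1 ≤ ‖s - ρ.1‖ := by
        refine le_trans ?_ (Complex.re_le_norm _)
        rw [Complex.sub_re, hs]
        linarith [((hZ.xiFun_eq_zero_iff hZa ρ.1).mp ρ.2).2.1]
      have h2 : 1 + ‖ρ.1‖ ≤ ‖s - ρ.1‖ * (2 + ‖s‖) := by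
        have h3 : ‖ρ.1‖ ≤ ‖s‖ + ‖s - ρ.1‖ := by
          simpa using norm_sub_le s (s - ρ.1)
        nlinarith [norm_nonneg s]
      rw [norm_mul, norm_div, norm_pow, norm_one, RCLike.norm_natCast, mul_one_div, div_mul_eq_mul_div]
      rw [div_le_div_iff₀ (by positivity) (by positivity), mul_assoc, ← mul_pow,
        mul_comm (2 + ‖s‖)]
      gcongr)
    (summable_order_div_sq differentiable_xiFun hxi0 hC)
    (fun s hs => by
      have := hasSum_deriv_logDeriv differentiable_xiFun hxi0 hC
        (hZ.xiFun_ne_zero (s := s) hZa (by linarith))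
      simpa only [mul_one_div] using this)
  -- the finite places
  obtain ⟨S, hS, hS'⟩ := HasLineIntegral.hasSum hψ
    (f := fun (x : FinitePlace' K × ℕ) s => (logNorm x.1.1 : ℂ) * (primeLength x : ℂ) *
      Complex.exp (-(primeLength x : ℂ) * s))
    (c := fun x => (logNorm x.1.1 : ℂ) * φ (primeLength x))
    (B := fun x => logNorm x.1.1 * primeLength x ^ 1 * Real.exp (-primeLength x * 2))
    (F := fun s => -deriv (mangoldtSum K) s)
    (fun x => by
      rw [hφψ, ← mul_assoc]
      exact (hψ.hasLineIntegral_exp _).const_mul _)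
    (fun x => by
      have := continuous_line
      exact (by fun_prop : Continuous fun ξ => (logNorm x.1.1 : ℂ) * (primeLength x : ℂ) *
        Complex.exp (-(primeLength x : ℂ) * line ξ)).aestronglyMeasurable)
    (fun x s hs => by
      have h1 := logNorm_nonneg x.1.1
      have h2 := primeLength_nonneg x
      rw [norm_mul, norm_mul, norm_exp_neg_mul, Complex.norm_real, Complex.norm_real,
        Real.norm_of_nonneg h1, Real.norm_of_nonneg h2, hs, pow_one]
      exact le_mul_of_one_le_right (by positivity)
        (one_le_pow₀ (by linarith [norm_nonneg s])))
    (summable_primeLength one_lt_two 1)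
    (fun s hs => hasSum_deriv_mangoldtSum (by linarith))
  -- the infinite places
  have hW : ∀ w : InfinitePlace K, HasLineIntegral ψ
      (fun s => (w.mult / 2 : ℂ) ^ 2 * deriv Complex.digamma (s * w.mult / 2))
      (∫ t in Set.Ioi (0 : ℝ), φ t * ((1 : ℂ) - Real.exp (-poleStep w * t))⁻¹) := fun w => by
    have hp := poleStep_pos w
    obtain ⟨T, hT, hT'⟩ := HasLineIntegral.hasSum hψ
      (f := fun (n : ℕ) s => 1 / (s - (-(poleStep w * n) : ℝ)) ^ 2)
      (c := fun n => laplace φ (-(poleStep w * n) : ℝ))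
      (B := fun n => ‖(w.mult / 2 : ℂ) ^ 2 * (1 / (2 * w.mult / 2 + n) ^ 2)‖)
      (F := fun s => (w.mult / 2 : ℂ) ^ 2 * deriv Complex.digamma (s * w.mult / 2))
      (fun n => hinv _ (by
        rw [Complex.ofReal_re]
        have : 0 ≤ poleStep w * n := by positivity
        linarith))
      (fun n => (hmeas _).aestronglyMeasurable)
      (fun n s hs => by
        have hm : (0 : ℝ) < w.mult := by exact_mod_cast InfinitePlace.mult_pos
        have e : (w.mult / 2 : ℂ) ^ 2 * (1 / (2 * w.mult / 2 + n) ^ 2) =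
            ((1 / (2 + poleStep w * n) ^ 2 : ℝ) : ℂ) := by
          have hm' : (w.mult : ℂ) ≠ 0 := by exact_mod_cast hm.ne'
          have h3 : (w.mult : ℂ) + n ≠ 0 := by
            have : (w.mult : ℝ) + n ≠ 0 := by positivity
            exact_mod_cast this
          rw [poleStep]
          push_cast
          rw [show (2 : ℂ) + 2 / w.mult * n = 2 * (w.mult + n) / w.mult by field_simp]
          field_simp
        have h1 : 2 + poleStep w * n ≤ ‖s - (-(poleStep w * n) : ℝ)‖ := by
          refine le_trans (le_of_eq ?_) (Complex.re_le_norm _)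
          rw [Complex.sub_re, hs, Complex.ofReal_re]
          ring
        rw [e, Complex.norm_real, Real.norm_of_nonneg (by positivity), norm_div, norm_one, norm_pow]
        calc _ ≤ 1 / (2 + poleStep w * n) ^ 2 := by gcongr
          _ ≤ _ := le_mul_of_one_le_right (by positivity)
            (one_le_pow₀ (by linarith [norm_nonneg s])))
      (by
        have := summable_one_div_add_nat_sq (re_mul_mult_pos (s := 2) (by norm_num) w)
        simpa only [norm_mul] using this.mul_left ‖(w.mult / 2 : ℂ) ^ 2‖)
      (fun s hs => hasSum_poleStep w (by linarith))
    rwa [hT.unique (hφ.hasSum_laplace_progression hs hp)] at hT'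
  have hall := (((hinv 0 (by norm_num)).add (hinv 1 (by norm_num))).sub hS').sub
    (HasLineIntegral.sum (S := Finset.univ) fun w _ => hW w)
  have hA'' := hA'.unique (hall.congr fun s hs => by
    rw [hZ.deriv_logDeriv_xiFun hZa (by linarith), sub_zero])
  exact ⟨S, hS, hA'' ▸ hA⟩

end

end ExplicitFormula

namespace ExplicitFormula

open MeasureTheory Filter Topology
open NumberField NumberField.Units NumberField.Units.dirichletUnitTheorem nonZeroDivisors Module
open scoped ENNReal Classical

noncomputable section

variable {K : Type*} [Field K] [NumberField K]

theorem finite_primeLength_le (R : ℝ) : {x : FinitePlace' K × ℕ | primeLength x ≤ R}.Finite := by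
  have h := (summable_primeLength (K := K) one_lt_two 0).tendsto_cofinite_zero
  have hc : 0 < Real.log 2 * Real.exp (-R * 2) :=
    mul_pos (Real.log_pos one_lt_two) (Real.exp_pos _)
  refine (eventually_cofinite.mp (h.eventually_lt_const hc)).subset fun x hx => ?_
  have hx' : primeLength x ≤ R := hx
  rw [Set.mem_ofPred_eq, not_lt, pow_zero, mul_one]
  exact mul_le_mul (log_two_le_logNorm x.1) (Real.exp_le_exp.mpr (by linarith))
    (Real.exp_pos _).le (logNorm_nonneg _)

theorem primeLength_pos (x : FinitePlace' K × ℕ) : 0 < primeLength x := by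
  have := logNorm_pos x.1
  rw [primeLength]
  positivity

theorem inv_absNorm_pow (p : FinitePlace' K) (k : ℕ) :
    ((Ideal.absNorm p.1 : ℂ) ^ (k + 1))⁻¹ = (Real.exp (-primeLength (p, k)) : ℂ) := by
  have h : (0 : ℝ) < Ideal.absNorm p.1 := by
    exact_mod_cast Nat.pos_of_ne_zero (absNorm_ne_zero' p.2.1)
  have h1 : Real.exp (-primeLength (p, k)) = ((Ideal.absNorm p.1 : ℝ) ^ (k + 1))⁻¹ := by
    rw [Real.exp_neg, primeLength, logNorm,
      show ((k : ℝ) + 1) = ((k + 1 : ℕ) : ℝ) by push_cast; rfl, Real.exp_nat_mul, Real.exp_log h]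
  rw [h1]
  push_cast
  rfl

theorem IsTest.exists_bound {φ : ℝ → ℂ} (h : IsTest φ) : ∃ R : ℝ, ∀ t, R < |t| → φ t = 0 := by
  obtain ⟨R, hR⟩ := h.compact.isBounded.subset_closedBall 0
  refine ⟨R, fun t ht => image_eq_zero_of_notMem_tsupport fun hm => ?_⟩
  have := hR hm
  rw [mem_closedBall_zero_iff, Real.norm_eq_abs] at this
  exact not_lt.mpr this ht

theorem analyticOrderNatAt_xiFun_one_sub (s : ℂ) :
    analyticOrderNatAt (xiFun K) (1 - s) = analyticOrderNatAt (xiFun K) s := by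
  have hg : AnalyticAt ℂ (fun z : ℂ => 1 - z) s := by fun_prop
  have hg' : deriv (fun z : ℂ => 1 - z) s ≠ 0 := by
    rw [((hasDerivAt_id' s).const_sub 1).deriv]
    norm_num
  have h := analyticOrderAt_comp_of_deriv_ne_zero (f := xiFun K) hg hg'
  have e : xiFun K ∘ (fun z : ℂ => 1 - z) = xiFun K := funext fun z => xiFun_one_sub z
  rw [e] at h
  rw [analyticOrderNatAt, analyticOrderNatAt, h]

/-- The functional equation as an involution of the set of nontrivial zeros. -/
def zeroReflection (K : Type*) [Field K] [NumberField K] :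
    {ρ : ℂ // xiFun K ρ = 0} ≃ {ρ : ℂ // xiFun K ρ = 0} where
  toFun ρ := ⟨1 - ρ.1, by rw [xiFun_one_sub, ρ.2]⟩
  invFun ρ := ⟨1 - ρ.1, by rw [xiFun_one_sub, ρ.2]⟩
  left_inv ρ := Subtype.ext (by simp)
  right_inv ρ := Subtype.ext (by simp)

theorem integral_Ioi_reflect (φ : ℝ → ℂ) (l : ℝ) :
    ∫ t in Set.Ioi (0 : ℝ), (Set.Ioi 0).indicator (reflect φ) t *
        ((1 : ℂ) - Real.exp (-l * t))⁻¹ =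
      ∫ t in Set.Iio (0 : ℝ), φ t * Real.exp t * ((1 : ℂ) - Real.exp (l * t))⁻¹ := by
  rw [← integral_Iic_eq_integral_Iio]
  have := integral_comp_neg_Ioi 0 fun t : ℝ =>
    φ t * Real.exp t * ((1 : ℂ) - Real.exp (l * t))⁻¹
  rw [neg_zero] at this
  rw [← this]
  refine setIntegral_congr_fun measurableSet_Ioi fun t ht => ?_
  simp only [Set.indicator_of_mem ht, reflect]
  rw [mul_neg, neg_mul]
  ring

/-- The explicit formula, in terms of the completed zeta function. -/
theorem IsZeta.hasSum_zeros {Z : ℂ → ℂ} (hZ : IsZeta K Z)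
    (hZa : ∀ s ≠ 1, AnalyticAt ℂ Z s) {φ : ℝ → ℂ} (hφ : IsTest φ) (h0 : 0 ∉ tsupport φ) :
    ∃ S, HasSum (fun x : FinitePlace' K × ℕ => (logNorm x.1.1 : ℂ) *
        (φ (primeLength x) + Real.exp (-primeLength x) * φ (-primeLength x))) S ∧
      HasSum (fun ρ : {ρ : ℂ // xiFun K ρ = 0} =>
          (analyticOrderNatAt (xiFun K) ρ.1 : ℂ) * laplace φ ρ.1)
        (laplace φ 0 + laplace φ 1 - S - ∑ w : InfinitePlace K,
          ((∫ t in Set.Ioi (0 : ℝ), φ t * ((1 : ℂ) - Real.exp (-poleStep w * t))⁻¹) +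
          ∫ t in Set.Iio (0 : ℝ), φ t * Real.exp t *
            ((1 : ℂ) - Real.exp (poleStep w * t))⁻¹)) := by
  have h1 := hφ.positivePart h0
  have h2 := hφ.reflect.positivePart (IsTest.zero_notMem_tsupport_reflect h0)
  obtain ⟨S, hS, hρ⟩ := hZ.hasSum_zeros_positive hZa h1.1 h1.2
  obtain ⟨S', hS', hρ'⟩ := hZ.hasSum_zeros_positive hZa h2.1 h2.2
  refine ⟨S + S', ?_, ?_⟩
  · convert! hS.add hS' using 2 with x
    have hx := Set.mem_Ioi.mpr (primeLength_pos x)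
    rw [Set.indicator_of_mem hx, Set.indicator_of_mem hx, reflect]
    ring
  · have hρ'' := (zeroReflection K).hasSum_iff.mpr hρ'
    convert! hρ.add hρ'' using 1
    · ext ρ
      simp only [Function.comp_apply, zeroReflection, Equiv.coe_fn_mk]
      rw [analyticOrderNatAt_xiFun_one_sub, laplace_split hφ h0, mul_add]
    · rw [Finset.sum_add_distrib, laplace_split hφ h0 0, laplace_split hφ h0 1, sub_zero, sub_self]
      have e1 : ∀ w : InfinitePlace K, ∫ t in Set.Ioi (0 : ℝ), (Set.Ioi 0).indicator φ t *
          ((1 : ℂ) - Real.exp (-poleStep w * t))⁻¹ =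
          ∫ t in Set.Ioi (0 : ℝ), φ t * ((1 : ℂ) - Real.exp (-poleStep w * t))⁻¹ := fun w =>
        setIntegral_congr_fun measurableSet_Ioi fun t ht => by
          simp only [Set.indicator_of_mem ht]
      simp only [e1, integral_Ioi_reflect]
      ring

theorem IsZeta.summable_zeros {Z : ℂ → ℂ} (hZ : IsZeta K Z)
    (hZa : ∀ s ≠ 1, AnalyticAt ℂ Z s) {φ : ℝ → ℂ} (hφ : IsTest φ) :
    Summable fun ρ : {ρ : ℂ // xiFun K ρ = 0} =>
      (analyticOrderNatAt (xiFun K) ρ.1 : ℝ) * ‖laplace φ ρ.1‖ := by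
  obtain ⟨C, hC⟩ := exists_norm_xiFun_le K
  obtain ⟨D, hD⟩ := hφ.exists_laplace_decay 0 1 2
  have hxi0 : xiFun K 0 ≠ 0 := fun h => by
    have := (hZ.xiFun_eq_zero_iff hZa 0).mp h
    simp at this
  refine Summable.of_nonneg_of_le (fun ρ => by positivity) (fun ρ => ?_)
    ((summable_order_div_sq differentiable_xiFun hxi0 hC).mul_right D)
  obtain ⟨hr0, hr1, -⟩ := (hZ.xiFun_eq_zero_iff hZa ρ.1).mp ρ.2
  have h1 := hD ρ.1 hr0.le hr1.le
  have hD0 : 0 ≤ D := by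
    rw [le_div_iff₀ (by positivity)] at h1
    exact le_trans (by positivity) h1
  calc _ ≤ (analyticOrderNatAt (xiFun K) ρ.1 : ℝ) * (D / (1 + ‖ρ.1‖) ^ 2) := by
        gcongr
        refine h1.trans ?_
        gcongr
        norm_num
    _ = _ := by ring

theorem continuousAt_inv_one_sub_exp {κ t : ℝ} (hκ : κ ≠ 0) (ht : t ≠ 0) :
    ContinuousAt (fun t : ℝ => ((1 : ℂ) - Real.exp (κ * t))⁻¹) t := by
  have hc : Continuous fun t : ℝ => (1 : ℂ) - Real.exp (κ * t) := by fun_prop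
  refine hc.continuousAt.inv₀ fun h => ?_
  have h1 : Real.exp (κ * t) = 1 := by exact_mod_cast (sub_eq_zero.mp h).symm
  rw [Real.exp_eq_one_iff] at h1
  exact mul_ne_zero hκ ht h1

end

end ExplicitFormula

open NumberField MeasureTheory

open ExplicitFormula in
/-- The "explicit formula" of analytic number theory (Theorem 4.1 of Deninger's
"Number theory and dynamical systems on foliated spaces") for a number field `K` and a
smooth compactly supported test function `φ : ℝ → ℂ` whose support does not contain `0`.
Here `Z` is the Dedekind zeta function of `K`, characterized as the function analytic on
`ℂ ∖ {1}` agreeing with the Dirichlet series `Σ_𝔞 (N𝔞)^{-s}` over the nonzero ideals of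
`𝓞 K` for `Re s > 1`; `m ρ` is the order of vanishing of `Z` at a nontrivial zero `ρ`
(characterized by `Z z = (z - ρ) ^ m ρ · g z` with `g` analytic, `g ρ ≠ 0`);
`Φ(s) = ∫ e^{ts} φ(t) dt`; `κ v = -2` for real and `-1` for complex infinite places; and
`W v = ∫_0^∞ φ(t)(1 - e^{κ_v t})⁻¹ dt + ∫_{-∞}^0 φ(t) e^t (1 - e^{-κ_v t})⁻¹ dt`.
Then all the series and integrals occurring converge absolutely and
`Φ(0) - Σ_ρ m(ρ)Φ(ρ) + Φ(1) = Σ_{𝔭∤∞} log N𝔭 (Σ_{k≥1} φ(k log N𝔭)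
  + Σ_{k≥1} N𝔭^{-k} φ(-k log N𝔭)) + Σ_{𝔭∣∞} W_𝔭(φ)`. -/
theorem explicit_formula_number_field
    (K : Type*) [Field K] [NumberField K]
    (Z : ℂ → ℂ)
    (hZ : ∀ s : ℂ, s ≠ 1 → AnalyticAt ℂ Z s)
    (hZval : ∀ s : ℂ, 1 < s.re →
      Z s = ∑' I : {I : Ideal (𝓞 K) // I ≠ ⊥}, (Ideal.absNorm I.1 : ℂ) ^ (-s))
    (m : ℂ → ℕ)
    (hm : ∀ ρ : ℂ, 0 < ρ.re → ρ.re < 1 → Z ρ = 0 →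
      ∃ g : ℂ → ℂ, AnalyticAt ℂ g ρ ∧ g ρ ≠ 0 ∧
        ∀ᶠ z in nhds ρ, Z z = (z - ρ) ^ m ρ * g z)
    (φ : ℝ → ℂ) (hφ : ContDiff ℝ (⊤ : ℕ∞) φ) (hφc : HasCompactSupport φ)
    (hφ0 : 0 ∉ tsupport φ)
    (Φ : ℂ → ℂ) (hΦ : ∀ s : ℂ, Φ s = ∫ t : ℝ, Complex.exp (t * s) * φ t)
    (κ : InfinitePlace K → ℝ)
    (hκ : ∀ v : InfinitePlace K,
      (v.IsReal → κ v = -2) ∧ (v.IsComplex → κ v = -1))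
    (W : InfinitePlace K → ℂ)
    (hW : ∀ v : InfinitePlace K,
      W v = (∫ t in Set.Ioi (0 : ℝ), φ t * ((1 : ℂ) - Real.exp (κ v * t))⁻¹)
          + (∫ t in Set.Iio (0 : ℝ), φ t * Real.exp t * ((1 : ℂ) - Real.exp (-(κ v) * t))⁻¹)) :
    -- absolute convergence of the sum over the nontrivial zeros
    (Summable fun ρ : {ρ : ℂ // 0 < ρ.re ∧ ρ.re < 1 ∧ Z ρ = 0} =>
      (m ρ.1 : ℝ) * ‖Φ ρ.1‖) ∧
    -- absolute convergence of the two series over `k ≥ 1` for each finite place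
    (∀ p : {p : Ideal (𝓞 K) // p ≠ ⊥ ∧ p.IsPrime},
      Summable (fun k : ℕ =>
        ‖φ (((k : ℝ) + 1) * Real.log (Ideal.absNorm p.1))‖) ∧
      Summable (fun k : ℕ =>
        ‖((Ideal.absNorm p.1 : ℂ) ^ (k + 1))⁻¹ *
          φ (-(((k : ℝ) + 1) * Real.log (Ideal.absNorm p.1)))‖)) ∧
    -- absolute convergence of the sum over the finite places
    (Summable fun p : {p : Ideal (𝓞 K) // p ≠ ⊥ ∧ p.IsPrime} =>
      ‖(Real.log (Ideal.absNorm p.1) : ℂ) *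
        ((∑' k : ℕ, φ (((k : ℝ) + 1) * Real.log (Ideal.absNorm p.1))) +
         (∑' k : ℕ, ((Ideal.absNorm p.1 : ℂ) ^ (k + 1))⁻¹ *
            φ (-(((k : ℝ) + 1) * Real.log (Ideal.absNorm p.1)))))‖) ∧
    -- absolute convergence of the archimedean integrals
    (∀ v : InfinitePlace K,
      IntegrableOn (fun t : ℝ => φ t * ((1 : ℂ) - Real.exp (κ v * t))⁻¹)
        (Set.Ioi (0 : ℝ)) ∧
      IntegrableOn (fun t : ℝ => φ t * Real.exp t * ((1 : ℂ) - Real.exp (-(κ v) * t))⁻¹)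
        (Set.Iio (0 : ℝ))) ∧
    -- the explicit formula
    (Φ 0 - (∑' ρ : {ρ : ℂ // 0 < ρ.re ∧ ρ.re < 1 ∧ Z ρ = 0}, (m ρ.1 : ℂ) * Φ ρ.1) + Φ 1
      = (∑' p : {p : Ideal (𝓞 K) // p ≠ ⊥ ∧ p.IsPrime},
          (Real.log (Ideal.absNorm p.1) : ℂ) *
            ((∑' k : ℕ, φ (((k : ℝ) + 1) * Real.log (Ideal.absNorm p.1))) +
             (∑' k : ℕ, ((Ideal.absNorm p.1 : ℂ) ^ (k + 1))⁻¹ *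
                φ (-(((k : ℝ) + 1) * Real.log (Ideal.absNorm p.1))))))
        + ∑' v : InfinitePlace K, W v) := by
  have hζ : IsZeta K Z := hZval
  have hT : IsTest φ := ⟨hφ, hφc⟩
  obtain rfl : Φ = laplace φ := funext hΦ
  have hκ' : ∀ v, κ v = -poleStep v := fun v => by
    rcases v.isReal_or_isComplex with h | h
    · rw [(hκ v).1 h, poleStep, h.mult_eq_one]
      norm_num
    · rw [(hκ v).2 h, poleStep, h.mult_eq_two]
      norm_num
  obtain rfl : κ = fun v => -poleStep v := funext hκ'
  -- the zeros
  let e : {ρ : ℂ // 0 < ρ.re ∧ ρ.re < 1 ∧ Z ρ = 0} ≃ {ρ : ℂ // xiFun K ρ = 0} :=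
    Equiv.subtypeEquivRight fun ρ => (hζ.xiFun_eq_zero_iff hZ ρ).symm
  have hmul : ∀ ρ : {ρ : ℂ // 0 < ρ.re ∧ ρ.re < 1 ∧ Z ρ = 0},
      analyticOrderNatAt (xiFun K) ρ.1 = m ρ.1 := fun ρ => by
    obtain ⟨g, hg, hg0, h⟩ := hm ρ.1 ρ.2.1 ρ.2.2.1 ρ.2.2.2
    exact hζ.analyticOrderNatAt_xiFun hZ ρ.2.1 ρ.2.2.1 hg hg0 h
  have hval : ∀ ρ, (e ρ).1 = ρ.1 := fun ρ => rfl
  -- the finite places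
  obtain ⟨R, hR⟩ := hT.exists_bound
  have hfin := finite_primeLength_le (K := K) R
  have hz : ∀ x : FinitePlace' K × ℕ, x ∉ {x : FinitePlace' K × ℕ | primeLength x ≤ R} →
      φ (primeLength x) = 0 ∧ φ (-primeLength x) = 0 := fun x hx => by
    have hx' : R < primeLength x := not_le.mp hx
    have h1 := abs_of_pos (primeLength_pos x)
    exact ⟨hR _ (by rwa [h1]), hR _ (by rwa [abs_neg, h1])⟩
  have hs1 : ∀ p : FinitePlace' K, Summable fun k : ℕ => ‖φ (primeLength (p, k))‖ := fun p =>
    summable_of_hasFiniteSupport <| (hfin.preimage (Prod.mk_right_injective p).injOn).subset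
      fun k hk => by
        by_contra h
        exact hk (by simp only [(hz (p, k) h).1, norm_zero])
  have hs2 : ∀ p : FinitePlace' K, Summable fun k : ℕ =>
      ‖((Ideal.absNorm p.1 : ℂ) ^ (k + 1))⁻¹ * φ (-primeLength (p, k))‖ := fun p =>
    summable_of_hasFiniteSupport <| (hfin.preimage (Prod.mk_right_injective p).injOn).subset
      fun k hk => by
        by_contra h
        exact hk (by simp only [(hz (p, k) h).2, mul_zero, norm_zero])
  obtain ⟨S, hS, hρ⟩ := hζ.hasSum_zeros hZ hT hφ0
  have hp := hS.prod_fiberwise fun p => by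
    simp only [← inv_absNorm_pow]
    exact ((hs1 p).of_norm.hasSum.add (hs2 p).of_norm.hasSum).mul_left _
  refine ⟨?_, fun p => ⟨hs1 p, hs2 p⟩, ?_, fun v => ⟨?_, ?_⟩, ?_⟩
  · have h := e.summable_iff.mpr (hζ.summable_zeros hZ hT)
    refine h.congr fun ρ => ?_
    rw [Function.comp_apply, hval, hmul]
  · refine summable_of_hasFiniteSupport <| (hfin.image Prod.fst).subset fun p hk => ?_
    by_contra h
    refine hk ?_
    have h1 : ∀ k : ℕ, φ (primeLength (p, k)) = 0 ∧ φ (-primeLength (p, k)) = 0 := fun k =>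
      hz (p, k) fun hm => h ⟨(p, k), hm, rfl⟩
    have h2 : ∀ k : ℕ, φ (((k : ℝ) + 1) * Real.log (Ideal.absNorm p.1)) = 0 := fun k => (h1 k).1
    have h3 : ∀ k : ℕ, φ (-(((k : ℝ) + 1) * Real.log (Ideal.absNorm p.1))) = 0 :=
      fun k => (h1 k).2
    simp only [h2, h3, mul_zero, tsum_zero, add_zero, norm_zero]
  · exact (hT.integrable_mul_of_continuousAt hφ0 fun t ht => continuousAt_inv_one_sub_exp
      (neg_ne_zero.mpr (poleStep_pos v).ne') ht).integrableOn
  · simp only [mul_assoc]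
    refine (hT.integrable_mul_of_continuousAt hφ0 fun t ht => ?_).integrableOn
    have h1 : ContinuousAt (fun t : ℝ => (Real.exp t : ℂ)) t :=
      (by fun_prop : Continuous fun t : ℝ => (Real.exp t : ℂ)).continuousAt
    exact h1.mul (continuousAt_inv_one_sub_exp
      (neg_ne_zero.mpr (neg_ne_zero.mpr (poleStep_pos v).ne')) ht)
  · have h := e.hasSum_iff.mpr hρ
    simp only [Function.comp_def, hval, hmul] at h
    have h2 := hp.tsum_eq
    simp only [primeLength, logNorm] at h2
    rw [h.tsum_eq, h2, tsum_fintype]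
    simp only [hW, neg_neg]
    ring
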